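/- (Mazurovskiĭ's classification) The deformation equivalence relation on configurations of 6 pairwise skew lines in RP³ — two 6-element configurations being equivalent if and only if some orderings of them are connected by a continuous path of 6-tuples of pairwise skew lines — has exactly 19 equivalence classes. -/

import Mathlib

open Submodule

abbrev V4 : Type := Fin 4 → ℝ

abbrev PLine : Type := Submodule ℝ V4

def IsLine (P : PLine) : Prop := Module.finrank ℝ P = 2

def Skew (P Q : PLine) : Prop := IsLine P ∧ IsLine Q ∧ P ⊓ Q = ⊥

def PairwiseSkew {n : ℕ} (L : Fin n → PLine) : Prop :=
  ∀ i j : Fin n, i ≠ j → Skew (L i) (L j)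

noncomputable def det2 (a b c d : V4) : ℝ := Matrix.det (Matrix.of ![a, b, c, d])

open Classical in
noncomputable def lk (P Q R : PLine) : ℝ :=
  if h : ∃ v : Fin 6 → V4,
      P = span ℝ {v 0, v 1} ∧ Q = span ℝ {v 2, v 3} ∧ R = span ℝ {v 4, v 5} then
    Real.sign (det2 (h.choose 0) (h.choose 1) (h.choose 2) (h.choose 3) *
      det2 (h.choose 0) (h.choose 1) (h.choose 4) (h.choose 5) *
      det2 (h.choose 2) (h.choose 3) (h.choose 4) (h.choose 5))
  else 0

noncomputable def sgnOf {n : ℕ} (L : Fin n → PLine) : ℝ :=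
  ∑ i : Fin n, ∑ j : Fin n, ∑ k : Fin n,
    if i < j ∧ j < k then lk (L i) (L j) (L k) else 0

def ContinuousLineFamily (L : ℝ → PLine) : Prop :=
  ∃ v w : ℝ → V4, ContinuousOn v (Set.Icc 0 1) ∧ ContinuousOn w (Set.Icc 0 1) ∧
    ∀ t ∈ Set.Icc (0:ℝ) 1, L t = span ℝ {v t, w t}

def Deformation {n : ℕ} (L L' : Fin n → PLine) : Prop :=
  ∃ F : ℝ → Fin n → PLine,
    (∀ i, ContinuousLineFamily (fun t => F t i)) ∧
    (∀ t ∈ Set.Icc (0:ℝ) 1, PairwiseSkew (F t)) ∧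
    F 0 = L ∧ F 1 = L'

def DeformEquiv {n : ℕ} (L L' : Fin n → PLine) : Prop :=
  ∃ π π' : Equiv.Perm (Fin n), Deformation (L ∘ π) (L' ∘ π')

def IsMirror {n : ℕ} (L L' : Fin n → PLine) : Prop :=
  ∃ A : V4 →ₗ[ℝ] V4, LinearMap.det A < 0 ∧ ∀ i, L' i = (L i).map A

def CoarseDeformEquiv {n : ℕ} (L L' : Fin n → PLine) : Prop :=
  DeformEquiv L L' ∨ ∃ M : Fin n → PLine, IsMirror L' M ∧ DeformEquiv L M

noncomputable def joinConfig {n : ℕ} (σ : Equiv.Perm (Fin n)) : Fin n → PLine :=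
  fun i => span ℝ {![1, (i.val : ℝ) + 1, 0, 0], ![0, 0, ((σ i).val : ℝ) + 1, 1]}

def IsSchlafliSix (L : Fin 6 → PLine) : Prop :=
  PairwiseSkew L ∧
  ∃ F : MvPolynomial (Fin 4) ℝ,
    F ≠ 0 ∧ F.IsHomogeneous 3 ∧
    (∀ i : Fin 6, ∀ x ∈ L i, MvPolynomial.eval x F = 0) ∧
    (∀ z : Fin 4 → ℂ, z ≠ 0 →
      MvPolynomial.eval z (MvPolynomial.map (algebraMap ℝ ℂ) F) = 0 →
      ∃ j : Fin 4, MvPolynomial.eval z (MvPolynomial.map (algebraMap ℝ ℂ) (MvPolynomial.pderiv j F)) ≠ 0)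

def Reducible {n : ℕ} (L : Fin n → PLine) : Prop :=
  ∃ i j : Fin n, i ≠ j ∧ ∃ F : ℝ → Fin n → PLine,
    (∀ k, ContinuousLineFamily (fun t => F t k)) ∧
    F 0 = L ∧
    (∀ t ∈ Set.Ico (0:ℝ) 1, PairwiseSkew (F t)) ∧
    F 1 i = F 1 j ∧
    (∀ k l : Fin n, k ≠ l → ¬(k = i ∧ l = j) → ¬(k = j ∧ l = i) → Skew (F 1 k) (F 1 l))

/-! ### Frames and brackets -/

/-- A frame: a pair of vectors for each of six lines. -/
abbrev Fr : Type := Fin 6 → V4 × V4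

/-- The bracket of two frames of lines. -/
noncomputable def br (x y : V4 × V4) : ℝ := det2 x.1 x.2 y.1 y.2

/-- The line spanned by a frame. -/
noncomputable def plane (x : V4 × V4) : PLine := span ℝ {x.1, x.2}

/-- The configuration spanned by a frame. -/
noncomputable def cfg (x : Fr) : Fin 6 → PLine := fun i => plane (x i)

/-- Frames of configurations of pairwise skew lines. -/
def SkewFr : Set Fr := {x | ∀ i j, i ≠ j → br (x i) (x j) ≠ 0}

theorem br_eq (x y : V4 × V4) : br x y =
    (x.1 0 * x.2 1 - x.1 1 * x.2 0) * (y.1 2 * y.2 3 - y.1 3 * y.2 2)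
    - (x.1 0 * x.2 2 - x.1 2 * x.2 0) * (y.1 1 * y.2 3 - y.1 3 * y.2 1)
    + (x.1 0 * x.2 3 - x.1 3 * x.2 0) * (y.1 1 * y.2 2 - y.1 2 * y.2 1)
    + (x.1 1 * x.2 2 - x.1 2 * x.2 1) * (y.1 0 * y.2 3 - y.1 3 * y.2 0)
    - (x.1 1 * x.2 3 - x.1 3 * x.2 1) * (y.1 0 * y.2 2 - y.1 2 * y.2 0)
    + (x.1 2 * x.2 3 - x.1 3 * x.2 2) * (y.1 0 * y.2 1 - y.1 1 * y.2 0) := by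
  simp only [br, det2]
  simp [Matrix.det_succ_row_zero, Fin.sum_univ_succ, Fin.succAbove]
  ring

theorem br_self (x : V4 × V4) : br x x = 0 := by rw [br_eq]; ring

theorem br_comm (x y : V4 × V4) : br x y = br y x := by rw [br_eq, br_eq]; ring

theorem continuous_br : Continuous fun p : (V4 × V4) × (V4 × V4) => br p.1 p.2 := by
  simp only [br_eq]; fun_prop

theorem linearIndependent_of_br_ne_zero {x y : V4 × V4} (h : br x y ≠ 0) :
    LinearIndependent ℝ ![x.1, x.2, y.1, y.2] := by
  have := Matrix.linearIndependent_rows_iff_isUnit (A := Matrix.of ![x.1, x.2, y.1, y.2])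
  rw [Matrix.isUnit_iff_isUnit_det, isUnit_iff_ne_zero] at this
  exact this.2 h

theorem skew_of_br_ne_zero {x y : V4 × V4} (h : br x y ≠ 0) : Skew (plane x) (plane y) := by
  have key : ∀ x y : V4 × V4, br x y ≠ 0 → Module.finrank ℝ (plane x) = 2 := by
    intro x y h
    have h4 := linearIndependent_of_br_ne_zero h
    have h2 : LinearIndependent ℝ ![x.1, x.2] := by
      have := h4.comp (![0, 1] : Fin 2 → Fin 4) (by decide)
      convert this using 1
      ext i; fin_cases i <;> rfl
    have := finrank_span_eq_card h2
    rwa [Matrix.range_cons, Matrix.range_cons, Matrix.range_empty, Set.union_empty,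
      Set.singleton_union, Fintype.card_fin] at this
  refine ⟨key x y h, key y x (by rwa [br_comm]), ?_⟩
  have h4 := linearIndependent_of_br_ne_zero h
  have := h4.disjoint_span_image (s := {0, 1}) (t := {2, 3}) (by
    rw [Set.disjoint_left]; intro a; fin_cases a <;> simp)
  rw [Set.image_pair, Set.image_pair] at this
  exact this.eq_bot

theorem br_ne_zero_of_skew {x y : V4 × V4} (h : Skew (plane x) (plane y)) : br x y ≠ 0 := by
  obtain ⟨h1, h2, h3⟩ := h
  have hs := Submodule.finrank_sup_add_finrank_inf_eq (plane x) (plane y)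
  rw [h3, finrank_bot, add_zero] at hs
  rw [IsLine] at h1 h2
  rw [h1, h2] at hs
  have ht : plane x ⊔ plane y = ⊤ := Submodule.eq_top_of_finrank_eq (by rw [hs]; simp)
  have hr : (⊤ : Submodule ℝ V4) ≤ span ℝ (Set.range ![x.1, x.2, y.1, y.2]) := by
    rw [← ht, plane, plane, ← Submodule.span_union]
    apply Submodule.span_mono
    rintro v hv
    simp only [Set.mem_union, Set.mem_insert_iff, Set.mem_singleton_iff] at hv
    rcases hv with (rfl | rfl) | (rfl | rfl)
    exacts [⟨0, rfl⟩, ⟨1, rfl⟩, ⟨2, rfl⟩, ⟨3, rfl⟩]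
  have hl := linearIndependent_of_top_le_span_of_card_eq_finrank hr (by simp)
  have := Matrix.linearIndependent_rows_iff_isUnit (A := Matrix.of ![x.1, x.2, y.1, y.2])
  rw [Matrix.isUnit_iff_isUnit_det, isUnit_iff_ne_zero] at this
  exact this.1 hl

theorem pairwiseSkew_cfg {x : Fr} : PairwiseSkew (cfg x) ↔ x ∈ SkewFr :=
  ⟨fun h i j hij => br_ne_zero_of_skew (h i j hij), fun h i j hij => skew_of_br_ne_zero (h i j hij)⟩

theorem exists_frame {P : PLine} (h : IsLine P) : ∃ x, plane x = P := by
  obtain ⟨b⟩ : Nonempty (Module.Basis (Fin 2) ℝ P) := ⟨Module.finBasisOfFinrankEq ℝ P h⟩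
  refine ⟨(b 0, b 1), ?_⟩
  have := b.span_eq
  apply_fun Submodule.map P.subtype at this
  rw [Submodule.map_span, Submodule.map_subtype_top] at this
  refine Eq.trans ?_ this
  rw [plane]
  congr 1
  ext v
  simp [Fin.exists_fin_two, eq_comm]

theorem exists_cfg {L : Fin 6 → PLine} (h : PairwiseSkew L) : ∃ x ∈ SkewFr, cfg x = L := by
  have : ∀ i, ∃ x, plane x = L i := fun i => by
    obtain ⟨j, hj⟩ := exists_ne i
    exact exists_frame (h i j hj.symm).1
  choose x hx using this
  have hx : cfg x = L := funext hx
  exact ⟨x, pairwiseSkew_cfg.1 (hx ▸ h), hx⟩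

theorem deformation_iff {L L' : Fin 6 → PLine} :
    Deformation L L' ↔ ∃ x y, JoinedIn SkewFr x y ∧ cfg x = L ∧ cfg y = L' := by
  constructor
  · rintro ⟨F, hF, hs, h0, h1⟩
    choose v w hv hw hvw using hF
    have hcfg : ∀ t ∈ Set.Icc (0:ℝ) 1, cfg (fun i => (v i t, w i t)) = F t := fun t ht =>
      funext fun i => (hvw i t ht).symm
    refine ⟨fun i => (v i 0, w i 0), fun i => (v i 1, w i 1), ⟨⟨⟨fun t i => (v i t, w i t), ?_⟩,
      ?_, ?_⟩, ?_⟩, ?_, ?_⟩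
    · refine continuous_pi fun i => ?_
      exact (hv i).domRestrict.prodMk (hw i).domRestrict
    · simp
    · simp
    · intro t
      exact pairwiseSkew_cfg.1 ((hcfg t t.2).symm ▸ hs t t.2)
    · rw [hcfg 0 (by simp), h0]
    · rw [hcfg 1 (by simp), h1]
  · rintro ⟨x, y, ⟨γ, hγ⟩, rfl, rfl⟩
    refine ⟨fun t => cfg (γ.extend t), fun i => ⟨fun t => (γ.extend t i).1, fun t => (γ.extend t i).2,
      ?_, ?_, fun t _ => rfl⟩, fun t ht => ?_, by simp, by simp⟩
    · have := γ.continuous_extend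
      fun_prop
    · have := γ.continuous_extend
      fun_prop
    · rw [pairwiseSkew_cfg, Path.extend_apply γ ht]
      exact hγ _

/-! ### Connectedness of the group of matrices of positive determinant -/

theorem JoinedIn.setOf_pos {X : Type*} [TopologicalSpace X] {S : Set X} {x y : X}
    (h : JoinedIn S x y) {f : X → ℝ} (hf : ContinuousOn f S) (h0 : ∀ z ∈ S, f z ≠ 0)
    (hx : 0 < f x) : JoinedIn {z | z ∈ S ∧ 0 < f z} x y := by
  obtain ⟨γ, hγ⟩ := h
  refine ⟨γ, fun s => ⟨hγ s, ?_⟩⟩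
  by_contra hy
  have hc : IsPreconnected ((fun t => f (γ t)) '' Set.univ) :=
    isPreconnected_univ.image _ (hf.comp γ.continuous.continuousOn fun t _ => hγ t)
  obtain ⟨t, -, ht⟩ := hc.ordConnected.out ⟨s, trivial, rfl⟩ ⟨0, trivial, by simp⟩
    ⟨not_lt.1 hy, hx.le⟩
  exact h0 _ (hγ t) ht

theorem JoinedIn.pos_of_pos {X : Type*} [TopologicalSpace X] {S : Set X} {x y : X}
    (h : JoinedIn S x y) {f : X → ℝ} (hf : ContinuousOn f S) (h0 : ∀ z ∈ S, f z ≠ 0)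
    (hx : 0 < f x) : 0 < f y :=
  (h.setOf_pos hf h0 hx).target_mem.2

section MatrixPaths

variable {n : Type*} [Fintype n] [DecidableEq n]

theorem JoinedIn.matrix_mul {A B C D : Matrix n n ℝ} (h : JoinedIn {M | M.det ≠ 0} A B)
    (h' : JoinedIn {M | M.det ≠ 0} C D) : JoinedIn {M | M.det ≠ 0} (A * C) (B * D) := by
  refine (h.mul h').mono ?_
  rintro _ ⟨M, hM, N, hN, rfl⟩
  simpa [Matrix.det_mul] using And.intro hM hN

theorem joinedIn_transvection {i j : n} (hij : i ≠ j) (c : ℝ) :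
    JoinedIn {M : Matrix n n ℝ | M.det ≠ 0} (Matrix.transvection i j c) 1 := by
  refine JoinedIn.ofLine (f := fun t => Matrix.transvection i j ((1 - t) * c)) ?_ (by simp)
    (by simp) ?_
  · unfold Matrix.transvection
    refine Continuous.continuousOn ?_
    refine continuous_const.add ?_
    refine continuous_matrix fun a b => ?_
    simp only [Matrix.single_apply]
    split_ifs <;> fun_prop
  · rintro _ ⟨t, -, rfl⟩
    simp [Matrix.det_transvection_of_ne i j hij]

theorem exists_joinedIn_sign (M : Matrix n n ℝ) (h : M.det ≠ 0) :
    ∃ v : n → ℝ, (∀ i, v i = 1 ∨ v i = -1) ∧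
      JoinedIn {M : Matrix n n ℝ | M.det ≠ 0} M (Matrix.diagonal v) := by
  refine Matrix.diagonal_transvection_induction_of_det_ne_zero (fun M => ∃ v : n → ℝ,
    (∀ i, v i = 1 ∨ v i = -1) ∧
      JoinedIn {M : Matrix n n ℝ | M.det ≠ 0} M (Matrix.diagonal v)) M h ?_ ?_ ?_
  · intro D hD
    rw [Matrix.det_diagonal, Finset.prod_ne_zero_iff] at hD
    refine ⟨fun i => if 0 < D i then 1 else -1, fun i => by
      by_cases h : 0 < D i <;> simp [h], ?_⟩
    refine JoinedIn.ofLine (f := fun t => Matrix.diagonal fun i =>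
      (1 - t) * D i + t * if 0 < D i then 1 else -1) (by fun_prop) (by simp) (by simp) ?_
    rintro _ ⟨t, ⟨h0, h1⟩, rfl⟩
    simp only [Set.mem_ofPred_eq, Matrix.det_diagonal, Finset.prod_ne_zero_iff]
    intro i _
    have := hD i (Finset.mem_univ i)
    rcases lt_or_gt_of_ne this with hi | hi
    · rw [if_neg (by linarith)]
      have : (1 - t) * D i + t * (-1) < 0 := by
        rcases h0.eq_or_lt with rfl | h0
        · simpa
        · nlinarith
      exact this.ne
    · rw [if_pos hi]
      have : 0 < (1 - t) * D i + t * 1 := by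
        rcases h0.eq_or_lt with rfl | h0
        · simpa
        · nlinarith
      exact this.ne'
  · intro t
    exact ⟨1, by simp, by simpa [Matrix.TransvectionStruct.toMatrix] using joinedIn_transvection t.hij t.c⟩
  · rintro A B - - ⟨v, hv, hvA⟩ ⟨w, hw, hwB⟩
    refine ⟨v * w, fun i => ?_, ?_⟩
    · rcases hv i with h | h <;> rcases hw i with h' | h' <;> simp [h, h']
    · simpa [Matrix.diagonal_mul_diagonal, Pi.mul_def] using hvA.matrix_mul hwB

theorem JoinedIn.det_pos {A B : Matrix n n ℝ} (h : JoinedIn {M | M.det ≠ 0} A B)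
    (hA : 0 < A.det) : JoinedIn {M | 0 < M.det} A B :=
  (h.setOf_pos (f := fun M => M.det) continuous_id.matrix_det.continuousOn (fun _ h => h) hA).mono
    fun _ h => h.2

end MatrixPaths

theorem joinedIn_one_of_det_pos_two {M : Matrix (Fin 2) (Fin 2) ℝ} (h : 0 < M.det) :
    JoinedIn {M | 0 < M.det} M 1 := by
  obtain ⟨v, hv, hj⟩ := exists_joinedIn_sign M h.ne'
  have hp := hj.pos_of_pos (f := fun M => M.det) (continuous_id.matrix_det).continuousOn
    (fun _ h => h) h
  refine JoinedIn.det_pos (hj.trans ?_) h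
  have e : JoinedIn {M : Matrix (Fin 2) (Fin 2) ℝ | M.det ≠ 0} (Matrix.diagonal ![-1, -1]) 1 := by
    have h1 := joinedIn_transvection (n := Fin 2) (i := 0) (j := 1) (by decide) 1
    have h2 := joinedIn_transvection (n := Fin 2) (i := 1) (j := 0) (by decide) (-1)
    have := (h1.matrix_mul h2).matrix_mul h1
    have := this.matrix_mul this
    convert this using 1
    · ext i j
      fin_cases i <;> fin_cases j <;> simp [Matrix.transvection, Matrix.mul_apply, Matrix.one_apply,
        Matrix.single_apply, Fin.sum_univ_two]
    · simp
  simp only [Matrix.det_diagonal, Fin.prod_univ_two] at hp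
  rcases hv 0 with h0 | h0 <;> rcases hv 1 with h1 | h1 <;> rw [h0, h1] at hp
  · have : v = 1 := by ext i; fin_cases i <;> simp [h0, h1]
    rw [this]
    simpa using JoinedIn.refl (F := {M : Matrix (Fin 2) (Fin 2) ℝ | M.det ≠ 0}) (x := 1) (by simp)
  · norm_num at hp
  · norm_num at hp
  · have : v = ![-1, -1] := by ext i; fin_cases i <;> simp [h0, h1]
    rwa [this]

theorem joinedIn_one_of_det_pos_four {M : Matrix (Fin 4) (Fin 4) ℝ} (h : 0 < M.det) :
    JoinedIn {M | 0 < M.det} M 1 := by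
  obtain ⟨v, hv, hj⟩ := exists_joinedIn_sign M h.ne'
  have hp := hj.pos_of_pos (f := fun M => M.det) (continuous_id.matrix_det).continuousOn
    (fun _ h => h) h
  refine JoinedIn.det_pos (hj.trans ?_) h
  have e1 : JoinedIn {M : Matrix (Fin 4) (Fin 4) ℝ | M.det ≠ 0}
      (Matrix.diagonal ![-1, -1, 1, 1]) 1 := by
    have h1 := joinedIn_transvection (n := Fin 4) (i := 0) (j := 1) (by decide) 1
    have h2 := joinedIn_transvection (n := Fin 4) (i := 1) (j := 0) (by decide) (-1)
    have := (h1.matrix_mul h2).matrix_mul h1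
    have := this.matrix_mul this
    convert this using 1
    · ext i j
      fin_cases i <;> fin_cases j <;> simp [Matrix.transvection, Matrix.mul_apply, Matrix.one_apply,
        Matrix.single_apply, Fin.sum_univ_four]
    · simp
  have e2 : JoinedIn {M : Matrix (Fin 4) (Fin 4) ℝ | M.det ≠ 0}
      (Matrix.diagonal ![1, -1, -1, 1]) 1 := by
    have h1 := joinedIn_transvection (n := Fin 4) (i := 1) (j := 2) (by decide) 1
    have h2 := joinedIn_transvection (n := Fin 4) (i := 2) (j := 1) (by decide) (-1)
    have := (h1.matrix_mul h2).matrix_mul h1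
    have := this.matrix_mul this
    convert this using 1
    · ext i j
      fin_cases i <;> fin_cases j <;> simp [Matrix.transvection, Matrix.mul_apply, Matrix.one_apply,
        Matrix.single_apply, Fin.sum_univ_four]
    · simp
  have e3 : JoinedIn {M : Matrix (Fin 4) (Fin 4) ℝ | M.det ≠ 0}
      (Matrix.diagonal ![1, 1, -1, -1]) 1 := by
    have h1 := joinedIn_transvection (n := Fin 4) (i := 2) (j := 3) (by decide) 1
    have h2 := joinedIn_transvection (n := Fin 4) (i := 3) (j := 2) (by decide) (-1)
    have := (h1.matrix_mul h2).matrix_mul h1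
    have := this.matrix_mul this
    convert this using 1
    · ext i j
      fin_cases i <;> fin_cases j <;> simp [Matrix.transvection, Matrix.mul_apply, Matrix.one_apply,
        Matrix.single_apply, Fin.sum_univ_four]
    · simp
  have e0 : JoinedIn {M : Matrix (Fin 4) (Fin 4) ℝ | M.det ≠ 0} 1 1 := JoinedIn.refl (by simp)
  have hmul : ∀ u w : Fin 4 → ℝ, JoinedIn {M : Matrix (Fin 4) (Fin 4) ℝ | M.det ≠ 0}
      (Matrix.diagonal u) 1 → JoinedIn {M : Matrix (Fin 4) (Fin 4) ℝ | M.det ≠ 0}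
      (Matrix.diagonal w) 1 → JoinedIn {M : Matrix (Fin 4) (Fin 4) ℝ | M.det ≠ 0}
      (Matrix.diagonal (u * w)) 1 := by
    intro u w hu hw
    simpa [Matrix.diagonal_mul_diagonal, Pi.mul_def] using hu.matrix_mul hw
  simp only [Matrix.det_diagonal, Fin.prod_univ_four] at hp
  have hvv : v = ![v 0, v 1, v 2, v 3] := by ext i; fin_cases i <;> rfl
  rw [hvv]
  rcases hv 0 with h0 | h0 <;> rcases hv 1 with h1 | h1 <;> rcases hv 2 with h2 | h2 <;>
    rcases hv 3 with h3 | h3 <;> rw [h0, h1, h2, h3] at hp <;> norm_num at hp <;>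
    rw [h0, h1, h2, h3]
  · convert e0; ext i j; fin_cases i <;> fin_cases j <;> simp
  · exact e3
  · convert hmul _ _ e2 e3 using 2; ext i; fin_cases i <;> simp
  · exact e2
  · convert hmul _ _ (hmul _ _ e1 e2) e3 using 2; ext i; fin_cases i <;> simp
  · convert hmul _ _ e1 e2 using 2; ext i; fin_cases i <;> simp
  · exact e1
  · convert hmul _ _ e1 e3 using 2; ext i; fin_cases i <;> simp

/-! ### Change of frame, relabelling and linear transformations -/

/-- Change of basis of a line. -/
def act (g : Matrix (Fin 2) (Fin 2) ℝ) (x : V4 × V4) : V4 × V4 :=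
  (g 0 0 • x.1 + g 0 1 • x.2, g 1 0 • x.1 + g 1 1 • x.2)

/-- Image of a frame under a linear transformation. -/
noncomputable def mapP (A : Matrix (Fin 4) (Fin 4) ℝ) (x : V4 × V4) : V4 × V4 :=
  (A.mulVec x.1, A.mulVec x.2)

theorem br_act_left (g : Matrix (Fin 2) (Fin 2) ℝ) (x y : V4 × V4) :
    br (act g x) y = g.det * br x y := by
  simp only [br_eq, act, Matrix.det_fin_two, Pi.add_apply, Pi.smul_apply, smul_eq_mul]
  ring

theorem br_act_right (g : Matrix (Fin 2) (Fin 2) ℝ) (x y : V4 × V4) :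
    br x (act g y) = g.det * br x y := by
  rw [br_comm, br_act_left, br_comm]

theorem br_mapP (A : Matrix (Fin 4) (Fin 4) ℝ) (x y : V4 × V4) :
    br (mapP A x) (mapP A y) = A.det * br x y := by
  have : Matrix.of ![A.mulVec x.1, A.mulVec x.2, A.mulVec y.1, A.mulVec y.2] =
      Matrix.of ![x.1, x.2, y.1, y.2] * A.transpose := by
    ext i j
    fin_cases i <;> simp [Matrix.mul_apply, Matrix.mulVec, dotProduct, mul_comm]
  rw [br, br, det2, det2, mapP, mapP, this, Matrix.det_mul, Matrix.det_transpose, mul_comm]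

theorem plane_act_le (g : Matrix (Fin 2) (Fin 2) ℝ) (x : V4 × V4) : plane (act g x) ≤ plane x := by
  have h1 : x.1 ∈ plane x := subset_span (by simp)
  have h2 : x.2 ∈ plane x := subset_span (by simp)
  refine span_le.2 ?_
  rintro v hv
  simp only [Set.mem_insert_iff, Set.mem_singleton_iff] at hv
  rcases hv with rfl | rfl
  · exact add_mem (smul_mem _ _ h1) (smul_mem _ _ h2)
  · exact add_mem (smul_mem _ _ h1) (smul_mem _ _ h2)

theorem act_act (g h : Matrix (Fin 2) (Fin 2) ℝ) (x : V4 × V4) :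
    act g (act h x) = act (g * h) x := by
  ext i <;> simp [act, Matrix.mul_apply, Fin.sum_univ_two] <;> ring

theorem act_one (x : V4 × V4) : act 1 x = x := by
  ext i <;> simp [act]

theorem plane_act {g : Matrix (Fin 2) (Fin 2) ℝ} (hg : g.det ≠ 0) (x : V4 × V4) :
    plane (act g x) = plane x := by
  refine le_antisymm (plane_act_le g x) ?_
  calc plane x = plane (act g⁻¹ (act g x)) := by
        rw [act_act, Matrix.nonsing_inv_mul _ (isUnit_iff_ne_zero.2 hg), act_one]
    _ ≤ _ := plane_act_le _ _

theorem exists_act {x y : V4 × V4} (h : plane y = plane x) : ∃ g, y = act g x := by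
  have h1 : y.1 ∈ plane x := h ▸ subset_span (by simp)
  have h2 : y.2 ∈ plane x := h ▸ subset_span (by simp)
  obtain ⟨a, b, hab⟩ := mem_span_pair.1 h1
  obtain ⟨c, d, hcd⟩ := mem_span_pair.1 h2
  exact ⟨!![a, b; c, d], by ext <;> simp [act, ← hab, ← hcd]⟩

theorem exists_act_fr {x y : Fr} (hy : y ∈ SkewFr) (h : cfg y = cfg x) :
    ∃ g : Fin 6 → Matrix (Fin 2) (Fin 2) ℝ, (∀ i, (g i).det ≠ 0) ∧ y = fun i => act (g i) (x i) := by
  choose g hg using fun i => exists_act (congrFun h i)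
  refine ⟨g, fun i hi => ?_, funext hg⟩
  obtain ⟨j, hj⟩ := exists_ne i
  have := hy i j hj.symm
  rw [hg i, br_act_left, hi, zero_mul] at this
  exact this rfl

theorem act_mem {x : Fr} (hx : x ∈ SkewFr) {g : Fin 6 → Matrix (Fin 2) (Fin 2) ℝ}
    (hg : ∀ i, (g i).det ≠ 0) : (fun i => act (g i) (x i)) ∈ SkewFr := by
  intro i j hij
  rw [br_act_left, br_act_right]
  exact mul_ne_zero (hg i) (mul_ne_zero (hg j) (hx i j hij))

theorem cfg_act {x : Fr} {g : Fin 6 → Matrix (Fin 2) (Fin 2) ℝ} (hg : ∀ i, (g i).det ≠ 0) :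
    cfg (fun i => act (g i) (x i)) = cfg x :=
  funext fun i => plane_act (hg i) _

theorem comp_mem {x : Fr} (hx : x ∈ SkewFr) (π : Equiv.Perm (Fin 6)) : x ∘ π ∈ SkewFr :=
  fun i j hij => hx (π i) (π j) fun h => hij (π.injective h)

theorem JoinedIn.deformation {x y : Fr} (h : JoinedIn SkewFr x y) : Deformation (cfg x) (cfg y) :=
  deformation_iff.2 ⟨x, y, h, rfl, rfl⟩

theorem deformation_symm {L M : Fin 6 → PLine} (h : Deformation L M) : Deformation M L := by
  obtain ⟨x, y, hj, rfl, rfl⟩ := deformation_iff.1 h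
  exact hj.symm.deformation

theorem deformation_trans {L M N : Fin 6 → PLine} (h : Deformation L M) (h' : Deformation M N) :
    Deformation L N := by
  obtain ⟨x, y, hj, rfl, rfl⟩ := deformation_iff.1 h
  obtain ⟨y', z, hj', hy, rfl⟩ := deformation_iff.1 h'
  obtain ⟨g, hg, rfl⟩ := exists_act_fr hj.target_mem hy.symm
  have : JoinedIn SkewFr (fun i => act (g i) (y' i)) (fun i => act (g i) (z i)) := by
    refine (hj'.map (f := fun u i => act (g i) (u i)) ?_).mono ?_
    · unfold act; fun_prop
    · rintro _ ⟨u, hu, rfl⟩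
      exact act_mem hu hg
  rw [← cfg_act (x := z) hg]
  exact (hj.trans this).deformation

theorem deformation_comp {L M : Fin 6 → PLine} (h : Deformation L M) (π : Equiv.Perm (Fin 6)) :
    Deformation (L ∘ π) (M ∘ π) := by
  obtain ⟨x, y, hj, rfl, rfl⟩ := deformation_iff.1 h
  refine JoinedIn.deformation (x := x ∘ π) (y := y ∘ π)
    ((hj.map (f := fun u => u ∘ π) (by fun_prop)).mono ?_)
  rintro _ ⟨u, hu, rfl⟩
  exact comp_mem hu π

theorem deformEquiv_iff {L M : Fin 6 → PLine} :
    DeformEquiv L M ↔ ∃ π : Equiv.Perm (Fin 6), Deformation L (M ∘ π) := by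
  constructor
  · rintro ⟨π, π', h⟩
    refine ⟨π' * π⁻¹, ?_⟩
    have := deformation_comp h π⁻¹
    rwa [show (L ∘ π) ∘ (π⁻¹ : Equiv.Perm (Fin 6)) = L by ext; simp] at this
  · rintro ⟨π, h⟩
    exact ⟨1, π, h⟩

theorem deformEquiv_symm {L M : Fin 6 → PLine} (h : DeformEquiv L M) : DeformEquiv M L := by
  obtain ⟨π, π', h⟩ := h
  exact ⟨π', π, deformation_symm h⟩

theorem deformEquiv_trans {L M N : Fin 6 → PLine} (h : DeformEquiv L M) (h' : DeformEquiv M N) :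
    DeformEquiv L N := by
  obtain ⟨π, h⟩ := deformEquiv_iff.1 h
  obtain ⟨ρ, hρ⟩ := deformEquiv_iff.1 h'
  exact deformEquiv_iff.2 ⟨ρ * π, deformation_trans h (deformation_comp hρ π)⟩

/-- Deformation equivalence of the configurations spanned by two systems of frames. -/
def FrEquiv (x y : Fr) : Prop := x ∈ SkewFr ∧ y ∈ SkewFr ∧ DeformEquiv (cfg x) (cfg y)

theorem FrEquiv.symm {x y : Fr} (h : FrEquiv x y) : FrEquiv y x :=
  ⟨h.2.1, h.1, deformEquiv_symm h.2.2⟩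

theorem FrEquiv.trans {x y z : Fr} (h : FrEquiv x y) (h' : FrEquiv y z) : FrEquiv x z :=
  ⟨h.1, h'.2.1, deformEquiv_trans h.2.2 h'.2.2⟩

theorem JoinedIn.frEquiv {x y : Fr} (h : JoinedIn SkewFr x y) : FrEquiv x y :=
  ⟨h.source_mem, h.target_mem, 1, 1, h.deformation⟩

theorem FrEquiv.of_act {x : Fr} (hx : x ∈ SkewFr) {g : Fin 6 → Matrix (Fin 2) (Fin 2) ℝ}
    (hg : ∀ i, (g i).det ≠ 0) : FrEquiv x (fun i => act (g i) (x i)) :=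
  ⟨hx, act_mem hx hg, cfg_act (x := x) hg ▸ (JoinedIn.refl hx).frEquiv.2.2⟩

theorem FrEquiv.of_comp {x : Fr} (hx : x ∈ SkewFr) (π : Equiv.Perm (Fin 6)) : FrEquiv x (x ∘ π) :=
  ⟨hx, comp_mem hx π, π, 1, (JoinedIn.refl (comp_mem hx π)).deformation⟩

theorem mapP_mem {x : Fr} (hx : x ∈ SkewFr) {A : Matrix (Fin 4) (Fin 4) ℝ} (hA : A.det ≠ 0) :
    (fun i => mapP A (x i)) ∈ SkewFr := by
  intro i j hij
  rw [br_mapP]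
  exact mul_ne_zero hA (hx i j hij)

theorem FrEquiv.of_mapP {x : Fr} (hx : x ∈ SkewFr) {A : Matrix (Fin 4) (Fin 4) ℝ}
    (hA : 0 < A.det) : FrEquiv x (fun i => mapP A (x i)) := by
  refine FrEquiv.symm (JoinedIn.frEquiv ?_)
  have h := joinedIn_one_of_det_pos_four hA
  have := (h.map (f := fun A i => mapP A (x i)) (by unfold mapP; fun_prop)).mono (V := SkewFr) (by
    rintro _ ⟨B, hB, rfl⟩
    exact mapP_mem hx (ne_of_gt hB))
  simpa [mapP] using this

theorem plane_mapP (A : Matrix (Fin 4) (Fin 4) ℝ) (x : V4 × V4) :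
    plane (mapP A x) = (plane x).map A.mulVecLin := by
  rw [plane, plane, map_span, Set.image_pair]
  rfl

theorem deformation_map {L M : Fin 6 → PLine} (h : Deformation L M) {A : Matrix (Fin 4) (Fin 4) ℝ}
    (hA : A.det ≠ 0) :
    Deformation (fun i => (L i).map A.mulVecLin) (fun i => (M i).map A.mulVecLin) := by
  obtain ⟨x, y, hj, rfl, rfl⟩ := deformation_iff.1 h
  refine deformation_iff.2 ⟨fun i => mapP A (x i), fun i => mapP A (y i),
    (hj.map (f := fun u i => mapP A (u i)) (by unfold mapP; fun_prop)).mono ?_,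
    funext fun i => plane_mapP A _, funext fun i => plane_mapP A _⟩
  rintro _ ⟨u, hu, rfl⟩
  exact mapP_mem hu hA

theorem FrEquiv.map {x y : Fr} (h : FrEquiv x y) {A : Matrix (Fin 4) (Fin 4) ℝ} (hA : A.det ≠ 0) :
    FrEquiv (fun i => mapP A (x i)) (fun i => mapP A (y i)) := by
  refine ⟨mapP_mem h.1 hA, mapP_mem h.2.1 hA, ?_⟩
  obtain ⟨π, π', h⟩ := h.2.2
  refine ⟨π, π', ?_⟩
  have := deformation_map h hA
  convert this using 1
  · exact funext fun i => plane_mapP A _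
  · exact funext fun i => plane_mapP A _

theorem mapP_mapP (A B : Matrix (Fin 4) (Fin 4) ℝ) (x : V4 × V4) :
    mapP A (mapP B x) = mapP (A * B) x := by
  simp [mapP, Matrix.mulVec_mulVec]

theorem mapP_one (x : V4 × V4) : mapP 1 x = x := by simp [mapP]

theorem FrEquiv.of_map_neg {x y : Fr} {A B : Matrix (Fin 4) (Fin 4) ℝ}
    (hA : A.det < 0) (hB : B.det < 0)
    (h : FrEquiv (fun i => mapP A (x i)) (fun i => mapP B (y i))) (hy : y ∈ SkewFr) :
    FrEquiv x y := by
  have hA' : IsUnit A.det := isUnit_iff_ne_zero.2 hA.ne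
  have hi : A⁻¹.det < 0 := by
    rw [Matrix.det_nonsing_inv, Ring.inverse_eq_inv']
    exact inv_lt_zero.2 hA
  have h1 := h.map (A := A⁻¹) hi.ne
  simp only [mapP_mapP, Matrix.nonsing_inv_mul _ hA', mapP_one] at h1
  refine h1.trans (FrEquiv.symm (FrEquiv.of_mapP hy ?_))
  rw [Matrix.det_mul]
  exact mul_pos_of_neg_of_neg hi hB

/-! ### A normal form -/

/-- The frame of the line attached to a `2 × 2` matrix. -/
def lineQ (Q : Matrix (Fin 2) (Fin 2) ℝ) : V4 × V4 :=
  (![Q 0 0, 1, Q 0 1, 0], ![Q 1 0, 0, Q 1 1, 1])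

/-- The parameters of a normal form. -/
abbrev Par : Type := ℝ × ℝ × Matrix (Fin 2) (Fin 2) ℝ × Matrix (Fin 2) (Fin 2) ℝ

/-- The normal form of a system of six frames. -/
def nf (p : Par) : Fr :=
  ![(![1, 0, 0, 0], ![0, 1, 0, 0]), (![0, 0, 1, 0], ![0, 0, 0, 1]),
    (![1, 0, 1, 0], ![0, 1, 0, 1]), (![p.1, 0, 1, 0], ![0, 1, 0, p.2.1]),
    lineQ p.2.2.1, lineQ p.2.2.2]

/-- The brackets of the line attached to a matrix with the first four lines of a normal form. -/
def el (l k : ℝ) (Q : Matrix (Fin 2) (Fin 2) ℝ) : Fin 4 → ℝ :=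
  ![Q 0 1, -Q 1 0, Q 0 1 - Q 0 0 + Q 1 1 - Q 1 0,
    l * Q 0 1 - Q 0 0 + k * (l * Q 1 1 - Q 1 0)]

/-- The parameters of normal forms with prescribed signs of brackets. -/
def Reg (e f : Fin 4 → ℝ) (s : ℝ) : Set Par :=
  {p | 1 < p.1 ∧ 1 < p.2.1 ∧ (∀ i, 0 < e i * el p.1 p.2.1 p.2.2.1 i) ∧
    (∀ i, 0 < f i * el p.1 p.2.1 p.2.2.2 i) ∧ 0 < s * (p.2.2.1 - p.2.2.2).det}

theorem continuous_nf : Continuous nf := by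
  refine continuous_pi fun i => ?_
  have h2 : ∀ f g : Par → V4, (∀ i, Continuous fun p => f p i) → (∀ i, Continuous fun p => g p i) →
      Continuous fun p => (f p, g p) := fun f g hf hg =>
    (continuous_pi hf).prodMk (continuous_pi hg)
  fin_cases i <;> refine h2 _ _ (fun i => ?_) (fun i => ?_) <;> fin_cases i <;>
    simp [lineQ] <;> fun_prop

theorem br_nf_four (p : Par) (i : Fin 4) :
    br (nf p (i.castLE (by norm_num))) (nf p 4) = el p.1 p.2.1 p.2.2.1 i := by
  fin_cases i <;> simp [br_eq, nf, lineQ, el] <;> ring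

theorem br_nf_five (p : Par) (i : Fin 4) :
    br (nf p (i.castLE (by norm_num))) (nf p 5) = el p.1 p.2.1 p.2.2.2 i := by
  fin_cases i <;> simp [br_eq, nf, lineQ, el] <;> ring

theorem br_nf_four_five (p : Par) : br (nf p 4) (nf p 5) = -(p.2.2.1 - p.2.2.2).det := by
  simp [br_eq, nf, lineQ, Matrix.det_fin_two]
  ring

theorem br_nf (p : Par) : br (nf p 0) (nf p 1) = 1 ∧ br (nf p 0) (nf p 2) = 1 ∧
    br (nf p 1) (nf p 2) = 1 ∧ br (nf p 0) (nf p 3) = p.2.1 ∧ br (nf p 1) (nf p 3) = p.1 ∧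
    br (nf p 2) (nf p 3) = -((p.1 - 1) * (p.2.1 - 1)) := by
  refine ⟨?_, ?_, ?_, ?_, ?_, ?_⟩ <;> simp [br_eq, nf] <;> ring

theorem forall_lt_six {P : Fin 6 → Fin 6 → Prop} (h01 : P 0 1) (h02 : P 0 2) (h03 : P 0 3)
    (h04 : P 0 4) (h05 : P 0 5) (h12 : P 1 2) (h13 : P 1 3) (h14 : P 1 4) (h15 : P 1 5)
    (h23 : P 2 3) (h24 : P 2 4) (h25 : P 2 5) (h34 : P 3 4) (h35 : P 3 5) (h45 : P 4 5) :
    ∀ i j, i < j → P i j := by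
  intro i j hij
  fin_cases i <;> fin_cases j <;> first
    | exact absurd hij (by decide)
    | assumption

theorem mem_skewFr_of_lt {x : Fr} (h : ∀ i j, i < j → br (x i) (x j) ≠ 0) : x ∈ SkewFr := by
  intro i j hij
  rcases lt_or_gt_of_ne hij with h' | h'
  · exact h i j h'
  · exact br_comm (x i) (x j) ▸ h j i h'

theorem nf_mem {e f : Fin 4 → ℝ} {s : ℝ} {p : Par} (hp : p ∈ Reg e f s) : nf p ∈ SkewFr := by
  obtain ⟨hl, hk, he, hf, hs⟩ := hp
  have h4 : ∀ i : Fin 4, br (nf p (i.castLE (by norm_num))) (nf p 4) ≠ 0 := fun i => by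
    rw [br_nf_four]; exact right_ne_zero_of_mul (he i).ne'
  have h5 : ∀ i : Fin 4, br (nf p (i.castLE (by norm_num))) (nf p 5) ≠ 0 := fun i => by
    rw [br_nf_five]; exact right_ne_zero_of_mul (hf i).ne'
  have h45 : br (nf p 4) (nf p 5) ≠ 0 := by
    rw [br_nf_four_five]; exact neg_ne_zero.2 (right_ne_zero_of_mul hs.ne')
  obtain ⟨h01, h02, h12, h03, h13, h23⟩ := br_nf p
  have : 0 < (p.1 - 1) * (p.2.1 - 1) := mul_pos (by linarith) (by linarith)
  exact mem_skewFr_of_lt (forall_lt_six (h01 ▸ one_ne_zero) (h02 ▸ one_ne_zero)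
    (h03 ▸ by linarith) (h4 0) (h5 0) (h12 ▸ one_ne_zero) (h13 ▸ by linarith) (h4 1) (h5 1)
    (h23 ▸ by linarith) (h4 2) (h5 2) (h4 3) (h5 3) h45)

theorem JoinedIn.nf {e f : Fin 4 → ℝ} {s : ℝ} {p q : Par} (h : JoinedIn (Reg e f s) p q) :
    FrEquiv (nf p) (nf q) := by
  refine ((h.map (f := _root_.nf) continuous_nf).mono ?_).frEquiv
  rintro _ ⟨u, hu, rfl⟩
  exact nf_mem hu

theorem el_add (l k : ℝ) (Q R : Matrix (Fin 2) (Fin 2) ℝ) (i : Fin 4) :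
    el l k (Q + R) i = el l k Q i + el l k R i := by
  fin_cases i <;> simp [el] <;> ring

theorem el_smul (l k c : ℝ) (Q : Matrix (Fin 2) (Fin 2) ℝ) (i : Fin 4) :
    el l k (c • Q) i = c * el l k Q i := by
  fin_cases i <;> simp [el] <;> ring

theorem el_neg (l k : ℝ) (Q : Matrix (Fin 2) (Fin 2) ℝ) (i : Fin 4) :
    el l k (-Q) i = - el l k Q i := by
  fin_cases i <;> simp [el] <;> ring

theorem el_sub (l k : ℝ) (Q R : Matrix (Fin 2) (Fin 2) ℝ) (i : Fin 4) :
    el l k (Q - R) i = el l k Q i - el l k R i := by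
  fin_cases i <;> simp [el] <;> ring

theorem continuous_el {X : Type*} [TopologicalSpace X] {l k : X → ℝ}
    {Q : X → Matrix (Fin 2) (Fin 2) ℝ} (hl : Continuous l) (hk : Continuous k) (hQ : Continuous Q)
    (i : Fin 4) : Continuous fun x => el (l x) (k x) (Q x) i := by
  fin_cases i <;> simp [el] <;> fun_prop

/-- The matrix whose brackets are `l * k - 1` times the given numbers. -/
def center (l k : ℝ) (c : Fin 4 → ℝ) : Matrix (Fin 2) (Fin 2) ℝ :=
  !![c 3 - l * c 0 - k * c 1 - l * k * (c 2 - c 0 - c 1), (l * k - 1) * c 0;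
     -((l * k - 1) * c 1), c 3 - l * c 0 - k * c 1 - (c 2 - c 0 - c 1)]

theorem el_center (l k : ℝ) (c : Fin 4 → ℝ) (i : Fin 4) :
    el l k (center l k c) i = (l * k - 1) * c i := by
  fin_cases i <;> simp [el, center] <;> ring

theorem continuous_center (c : Fin 4 → ℝ) : Continuous fun p : ℝ × ℝ => center p.1 p.2 c := by
  refine continuous_matrix fun i j => ?_
  fin_cases i <;> fin_cases j <;> simp [center] <;> fun_prop

theorem joinedIn_reg_of_sub_eq {e f : Fin 4 → ℝ} {s l k : ℝ}
    {Q R Q' R' : Matrix (Fin 2) (Fin 2) ℝ} (hp : (l, k, Q, R) ∈ Reg e f s)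
    (hq : (l, k, Q', R') ∈ Reg e f s) (h : Q - R = Q' - R') :
    JoinedIn (Reg e f s) (l, k, Q, R) (l, k, Q', R') := by
  refine JoinedIn.of_segment_subset ?_
  rintro _ ⟨a, b, ha, hb, hab, rfl⟩
  have hl : a * l + b * l = l := by rw [← add_mul, hab, one_mul]
  have hk : a * k + b * k = k := by rw [← add_mul, hab, one_mul]
  have key : ∀ x y : ℝ, 0 < x → 0 < y → 0 < a * x + b * y := fun x y hx hy => by
    rcases ha.eq_or_lt with rfl | ha
    · have : b = 1 := by linarith
      simpa [this]
    · positivity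
  simp only [Prod.smul_mk, Prod.mk_add_mk, smul_eq_mul, hl, hk]
  refine ⟨hp.1, hp.2.1, fun i => ?_, fun i => ?_, ?_⟩
  · have := key _ _ (hp.2.2.1 i) (hq.2.2.1 i)
    simp only [el_add, el_smul] at this ⊢
    linarith
  · have := key _ _ (hp.2.2.2.1 i) (hq.2.2.2.1 i)
    simp only [el_add, el_smul] at this ⊢
    linarith
  · have h1 : a • Q + b • Q' - (a • R + b • R') = Q - R := by
      have : a • Q + b • Q' - (a • R + b • R') = a • (Q - R) + b • (Q' - R') := by
        simp only [smul_sub]; abel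
      rw [this, ← h, ← add_smul, hab, one_smul]
    simpa only [h1] using hp.2.2.2.2

/-- The possible differences of the two matrices of a normal form. -/
def Diff (e f : Fin 4 → ℝ) (s : ℝ) : Set (Matrix (Fin 2) (Fin 2) ℝ) :=
  {R | 0 < s * R.det ∧ (e 0 ≠ f 0 → 0 < e 0 * R 0 1) ∧ (e 1 ≠ f 1 → 0 < e 1 * -R 1 0)}

theorem nf_equiv_of_diff {e f : Fin 4 → ℝ} {s : ℝ} {p q : Par} (he : ∀ i, e i = 1 ∨ e i = -1)
    (hf : ∀ i, f i = 1 ∨ f i = -1) (h2 : e 2 = f 2) (h3 : e 3 = f 3)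
    (hp : p ∈ Reg e f s) (hq : q ∈ Reg e f s)
    (h : JoinedIn (Diff e f s) (p.2.2.1 - p.2.2.2) (q.2.2.1 - q.2.2.2)) :
    FrEquiv (nf p) (nf q) := by
  obtain ⟨l, k, Q, R⟩ := p
  obtain ⟨l', k', Q', R'⟩ := q
  obtain ⟨γ, hγ⟩ := h
  have hl : 1 < l := hp.1
  have hk : 1 < k := hp.2.1
  have hl' : 1 < l' := hq.1
  have hk' : 1 < k' := hq.2.1
  dsimp only at γ
  set lt : unitInterval → ℝ := fun t => (1 - t) * l + t * l' with hlt
  set kt : unitInterval → ℝ := fun t => (1 - t) * k + t * k' with hkt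
  have cl : Continuous lt := by fun_prop
  have ck : Continuous kt := by fun_prop
  have conv : ∀ (t : unitInterval) (x y : ℝ), 1 < x → 1 < y → 1 < (1 - (t : ℝ)) * x + t * y :=
    fun t x y hx hy => by
      have h0 := t.2.1
      have h1 := t.2.2
      rcases h0.eq_or_lt with h0 | h0
      · rw [← h0]; linarith
      · nlinarith
  have ltpos : ∀ t, 1 < lt t := fun t => conv t l l' hl hl'
  have ktpos : ∀ t, 1 < kt t := fun t => conv t k k' hk hk'
  have dpos : ∀ t, 0 < lt t * kt t - 1 := fun t => by nlinarith [ltpos t, ktpos t]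
  obtain ⟨K, hK⟩ : ∃ K : ℝ, ∀ t i, |el (lt t) (kt t) (γ t) i| < (lt t * kt t - 1) * K := by
    have hc : Continuous fun t : unitInterval =>
        ∑ i, |el (lt t) (kt t) (γ t) i| / (lt t * kt t - 1) := by
      refine continuous_finsetSum _ fun i _ => Continuous.div ?_ (by fun_prop)
        fun t => (dpos t).ne'
      exact (continuous_el cl ck γ.continuous i).abs
    obtain ⟨K, hK⟩ := (isCompact_range hc).bddAbove
    refine ⟨K + 1, fun t i => ?_⟩
    have h1 : |el (lt t) (kt t) (γ t) i| / (lt t * kt t - 1) ≤ K :=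
      (Finset.single_le_sum (f := fun i => |el (lt t) (kt t) (γ t) i| / (lt t * kt t - 1))
        (fun i _ => div_nonneg (abs_nonneg _) (dpos t).le) (Finset.mem_univ i)).trans
        (hK ⟨t, rfl⟩)
    rw [div_le_iff₀ (dpos t)] at h1
    nlinarith [dpos t]
  set c : Fin 4 → ℝ := fun i => (e i + f i) / 2 * K
  set q : unitInterval → Par := fun t => (lt t, kt t,
    center (lt t) (kt t) c + (1 / 2 : ℝ) • γ t, center (lt t) (kt t) c - (1 / 2 : ℝ) • γ t)
    with hqdef
  have cq : Continuous q := by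
    have := (continuous_center c).comp (cl.prodMk ck)
    simp only [Function.comp_def] at this
    have hγ := γ.continuous
    fun_prop
  have hdiff : ∀ t, (q t).2.2.1 - (q t).2.2.2 = γ t := fun t => by
    simp only [hqdef]
    ext i j
    simp
    ring
  have mem : ∀ t, q t ∈ Reg e f s := by
    intro t
    have key : ∀ i, 0 < e i * (el (lt t) (kt t) (center (lt t) (kt t) c) i +
          1 / 2 * el (lt t) (kt t) (γ t) i) ∧
        0 < f i * (el (lt t) (kt t) (center (lt t) (kt t) c) i -
          1 / 2 * el (lt t) (kt t) (γ t) i) := by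
      intro i
      have hb := abs_lt.1 (hK t i)
      rw [el_center]
      rcases he i with e1 | e1 <;>
      rcases hf i with f1 | f1
      all_goals
        have D := hγ t
        simp only [c, e1, f1]
      · constructor <;> nlinarith
      · have : 0 < el (lt t) (kt t) (γ t) i := by
          fin_cases i
          · have := D.2.1 (by simp at e1 f1; rw [e1, f1]; norm_num)
            simp at e1
            simpa [el, e1] using this
          · have := D.2.2 (by simp at e1 f1; rw [e1, f1]; norm_num)
            simp at e1
            simpa [el, e1] using this
          · simp at e1 f1; linarith
          · simp at e1 f1; linarith
        constructor <;> nlinarith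
      · have : el (lt t) (kt t) (γ t) i < 0 := by
          fin_cases i
          · have := D.2.1 (by simp at e1 f1; rw [e1, f1]; norm_num)
            simp at e1
            simpa [el, e1] using this
          · have := D.2.2 (by simp at e1 f1; rw [e1, f1]; norm_num)
            simp at e1
            simpa [el, e1] using this
          · simp at e1 f1; linarith
          · simp at e1 f1; linarith
        constructor <;> nlinarith
      · constructor <;> nlinarith
    refine ⟨ltpos t, ktpos t, fun i => ?_, fun i => ?_, ?_⟩
    · simpa only [hqdef, el_add, el_smul] using (key i).1
    · simpa only [hqdef, el_sub, el_smul] using (key i).2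
    · rw [hdiff]
      exact (hγ t).1
  have e0 : lt 0 = l ∧ kt 0 = k := by simp [hlt, hkt]
  have e1 : lt 1 = l' ∧ kt 1 = k' := by simp [hlt, hkt]
  have mid : JoinedIn (Reg e f s) (q 0) (q 1) :=
    ⟨⟨⟨q, cq⟩, rfl, rfl⟩, mem⟩
  refine JoinedIn.nf (JoinedIn.trans ?_ (mid.trans (JoinedIn.symm ?_))) (e := e) (f := f) (s := s)
  · have m0 := mem 0
    have d0 := hdiff 0
    simp only [hqdef, e0.1, e0.2] at m0 d0 ⊢
    exact joinedIn_reg_of_sub_eq hp m0 (by rw [d0, γ.source])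
  · have m0 := mem 1
    have d0 := hdiff 1
    simp only [hqdef, e1.1, e1.2] at m0 d0 ⊢
    exact joinedIn_reg_of_sub_eq hq m0 (by rw [d0, γ.target])

theorem add_pos_of_convex {a b x y : ℝ} (ha : 0 ≤ a) (hb : 0 ≤ b) (hab : a + b = 1) (hx : 0 < x)
    (hy : 0 < y) : 0 < a * x + b * y := by
  rcases ha.eq_or_lt with rfl | ha
  · have : b = 1 := by linarith
    simpa [this]
  · positivity

theorem joinedIn_diff_of_row {e f : Fin 4 → ℝ} {s : ℝ} {R R' : Matrix (Fin 2) (Fin 2) ℝ} {i : Fin 2}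
    (hR : R ∈ Diff e f s) (hR' : R' ∈ Diff e f s) (h : ∀ j, R i j = R' i j) :
    JoinedIn (Diff e f s) R R' := by
  refine JoinedIn.of_segment_subset ?_
  rintro _ ⟨a, b, ha, hb, hab, rfl⟩
  have hdet : (a • R + b • R').det = a * R.det + b * R'.det := by
    have h0 := h 0
    have h1 := h 1
    have : a = 1 - b := by linarith
    subst this
    fin_cases i <;> simp only [Fin.zero_eta, Fin.mk_one] at h0 h1 <;>
      simp [Matrix.det_fin_two, h0, h1] <;> ring
  refine ⟨?_, fun h => ?_, fun h => ?_⟩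
  · rw [hdet]
    have := add_pos_of_convex ha hb hab hR.1 hR'.1
    linarith
  · have := add_pos_of_convex ha hb hab (hR.2.1 h) (hR'.2.1 h)
    simp only [Matrix.add_apply, Matrix.smul_apply, smul_eq_mul]
    linarith
  · have := add_pos_of_convex ha hb hab (hR.2.2 h) (hR'.2.2 h)
    simp only [Matrix.add_apply, Matrix.smul_apply, smul_eq_mul]
    linarith

theorem joinedIn_diff_self {e : Fin 4 → ℝ} {s : ℝ} {R R' : Matrix (Fin 2) (Fin 2) ℝ}
    (hR : 0 < s * R.det) (hR' : 0 < s * R'.det) : JoinedIn (Diff e e s) R R' := by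
  have hpos : ∀ {R R' : Matrix (Fin 2) (Fin 2) ℝ}, 0 < R.det → 0 < R'.det →
      JoinedIn {M : Matrix (Fin 2) (Fin 2) ℝ | 0 < M.det} R R' := fun h h' =>
    (joinedIn_one_of_det_pos_two h).trans (joinedIn_one_of_det_pos_two h').symm
  rcases lt_or_ge 0 s with hs | hs
  · refine (hpos (pos_of_mul_pos_right hR hs.le) (pos_of_mul_pos_right hR' hs.le)).mono ?_
    intro M hM
    exact ⟨mul_pos hs hM, by simp, by simp⟩
  · have neg : ∀ {R : Matrix (Fin 2) (Fin 2) ℝ}, 0 < s * R.det → 0 < (!![-1, 0; 0, 1] * R).det :=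
      fun h => by
        rw [Matrix.det_mul, Matrix.det_fin_two_of]
        nlinarith
    have := ((hpos (neg hR) (neg hR')).map (f := fun M => !![-1, 0; 0, 1] * M)
      (by fun_prop)).mono (V := Diff e e s) (by
        rintro _ ⟨M, hM, rfl⟩
        have hs' : s < 0 := lt_of_le_of_ne hs (by rintro rfl; simp at hR)
        have hM : 0 < M.det := hM
        refine ⟨?_, by simp, by simp⟩
        rw [Matrix.det_mul, Matrix.det_fin_two_of]
        nlinarith)
    simp only [← Matrix.mul_assoc] at this
    have h1 : (!![-1, 0; 0, 1] * !![-1, 0; 0, 1] : Matrix (Fin 2) (Fin 2) ℝ) = 1 := by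
      ext i j; fin_cases i <;> fin_cases j <;> simp
    simpa only [h1, Matrix.one_mul] using this

theorem nf_equiv_twin {e : Fin 4 → ℝ} {s : ℝ} {p q : Par} (he : ∀ i, e i = 1 ∨ e i = -1)
    (hp : p ∈ Reg e e s) (hq : q ∈ Reg e e s) : FrEquiv (nf p) (nf q) :=
  nf_equiv_of_diff he he rfl rfl hp hq (joinedIn_diff_self hp.2.2.2.2 hq.2.2.2.2)

theorem diff_mem {e f : Fin 4 → ℝ} {s : ℝ} {p : Par} (h0 : e 0 = -f 0) (h1 : e 1 = -f 1)
    (hp : p ∈ Reg e f s) : p.2.2.1 - p.2.2.2 ∈ Diff e f s ∧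
      0 < e 0 * (p.2.2.1 - p.2.2.2) 0 1 ∧ 0 < e 1 * -(p.2.2.1 - p.2.2.2) 1 0 := by
  have e0 := hp.2.2.1 0
  have e1 := hp.2.2.1 1
  have f0 := hp.2.2.2.1 0
  have f1 := hp.2.2.2.1 1
  rw [el] at e0 e1 f0 f1
  simp at e0 e1 f0 f1
  have k0 : 0 < e 0 * (p.2.2.1 - p.2.2.2) 0 1 := by
    simp only [Matrix.sub_apply]; rw [h0] at e0 ⊢; linarith
  have k1 : 0 < e 1 * -(p.2.2.1 - p.2.2.2) 1 0 := by
    simp only [Matrix.sub_apply]; rw [h1] at e1 ⊢; linarith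
  exact ⟨⟨hp.2.2.2.2, fun _ => k0, fun _ => k1⟩, k0, k1⟩

theorem joinedIn_diff_of_good {e f : Fin 4 → ℝ} {s : ℝ} {R R' : Matrix (Fin 2) (Fin 2) ℝ}
    (hs : s = e 0 * e 1) (hR : R ∈ Diff e f s) (hR' : R' ∈ Diff e f s)
    (h0 : 0 < e 0 * R 0 1) (h1 : 0 < e 1 * -R 1 0)
    (h0' : 0 < e 0 * R' 0 1) (h1' : 0 < e 1 * -R' 1 0) : JoinedIn (Diff e f s) R R' := by
  have step : ∀ x y z : ℝ, ∀ w, x * w = 0 → 0 < e 0 * y → 0 < e 1 * -z →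
      !![x, y; z, w] ∈ Diff e f s := fun x y z w hx hy hz => by
    refine ⟨?_, fun _ => by simpa using hy, fun _ => by simpa using hz⟩
    rw [Matrix.det_fin_two_of, hs, hx]
    have := mul_pos hy hz
    linarith
  have s1 := step 0 (R 0 1) (R 1 0) (R 1 1) (by simp) h0 h1
  have s2 := step 0 (R 0 1) (R' 1 0) 0 (by simp) h0 h1'
  have s3 := step (R' 0 0) (R' 0 1) (R' 1 0) 0 (by simp) h0' h1'
  refine (joinedIn_diff_of_row (i := 1) hR s1 fun j => ?_).trans
    ((joinedIn_diff_of_row (i := 0) s1 s2 fun j => ?_).trans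
    ((joinedIn_diff_of_row (i := 1) s2 s3 fun j => ?_).trans
    (joinedIn_diff_of_row (i := 0) s3 hR' fun j => ?_))) <;> fin_cases j <;> simp

theorem joinedIn_diff_of_bad {e f : Fin 4 → ℝ} {s : ℝ} {R R' : Matrix (Fin 2) (Fin 2) ℝ}
    (hs : s = -(e 0 * e 1)) (hR : R ∈ Diff e f s) (hR' : R' ∈ Diff e f s)
    (h0 : 0 < e 0 * R 0 1) (h1 : 0 < e 1 * -R 1 0)
    (h0' : 0 < e 0 * R' 0 1) (h1' : 0 < e 1 * -R' 1 0) (h : 0 < R 0 0 * R' 0 0) :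
    JoinedIn (Diff e f s) R R' := by
  have a : 0 < s * (R 0 0 * R 1 1) := by
    have h2 := hR.1
    rw [Matrix.det_fin_two] at h2
    have := mul_pos h0 h1
    rw [hs] at h2 ⊢
    nlinarith
  have a' : 0 < s * (R' 0 0 * R' 1 1) := by
    have h2 := hR'.1
    rw [Matrix.det_fin_two] at h2
    have := mul_pos h0' h1'
    rw [hs] at h2 ⊢
    nlinarith
  have b : 0 < s * (R' 0 0 * R 1 1) := by
    have h3 : 0 < (R 0 0) ^ 2 * (s * (R' 0 0 * R 1 1)) := by
      have := mul_pos a h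
      nlinarith
    exact pos_of_mul_pos_right h3 (sq_nonneg _)
  obtain ⟨K, hK1, hK⟩ : ∃ K : ℝ, 1 ≤ K ∧ s * (R' 0 1 * R 1 0) < K * (s * (R' 0 0 * R 1 1)) := by
    obtain ⟨n, hn⟩ := exists_lt_nsmul b (s * (R' 0 1 * R 1 0))
    refine ⟨n + 1, by simp, ?_⟩
    rw [nsmul_eq_mul] at hn
    linarith
  have s1 : !![K * R' 0 0, R' 0 1; R 1 0, R 1 1] ∈ Diff e f s := by
    refine ⟨?_, fun _ => by simpa using h0', fun _ => by simpa using h1⟩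
    rw [Matrix.det_fin_two_of]
    linarith
  have s2 : !![K * R' 0 0, R' 0 1; R' 1 0, R' 1 1] ∈ Diff e f s := by
    refine ⟨?_, fun _ => by simpa using h0', fun _ => by simpa using h1'⟩
    have h2 := hR'.1
    rw [Matrix.det_fin_two] at h2
    rw [Matrix.det_fin_two_of]
    nlinarith
  refine (joinedIn_diff_of_row (i := 1) hR s1 fun j => ?_).trans
    ((joinedIn_diff_of_row (i := 0) s1 s2 fun j => ?_).trans
    (joinedIn_diff_of_row (i := 1) s2 hR' fun j => ?_)) <;> fin_cases j <;> simp

theorem nf_equiv_good {e f : Fin 4 → ℝ} {s : ℝ} {p q : Par} (he : ∀ i, e i = 1 ∨ e i = -1)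
    (hf : ∀ i, f i = 1 ∨ f i = -1) (h0 : e 0 = -f 0) (h1 : e 1 = -f 1) (h2 : e 2 = f 2)
    (h3 : e 3 = f 3) (hs : s = e 0 * e 1) (hp : p ∈ Reg e f s) (hq : q ∈ Reg e f s) :
    FrEquiv (nf p) (nf q) := by
  obtain ⟨hp1, hp2, hp3⟩ := diff_mem h0 h1 hp
  obtain ⟨hq1, hq2, hq3⟩ := diff_mem h0 h1 hq
  exact nf_equiv_of_diff he hf h2 h3 hp hq (joinedIn_diff_of_good hs hp1 hq1 hp2 hp3 hq2 hq3)

theorem nf_equiv_bad {e f : Fin 4 → ℝ} {s : ℝ} {p q : Par} (he : ∀ i, e i = 1 ∨ e i = -1)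
    (hf : ∀ i, f i = 1 ∨ f i = -1) (h0 : e 0 = -f 0) (h1 : e 1 = -f 1) (h2 : e 2 = f 2)
    (h3 : e 3 = f 3) (hs : s = -(e 0 * e 1)) (hp : p ∈ Reg e f s) (hq : q ∈ Reg e f s)
    (h : 0 < (p.2.2.1 - p.2.2.2) 0 0 * (q.2.2.1 - q.2.2.2) 0 0) :
    FrEquiv (nf p) (nf q) := by
  obtain ⟨hp1, hp2, hp3⟩ := diff_mem h0 h1 hp
  obtain ⟨hq1, hq2, hq3⟩ := diff_mem h0 h1 hq
  exact nf_equiv_of_diff he hf h2 h3 hp hq (joinedIn_diff_of_bad hs hp1 hq1 hp2 hp3 hq2 hq3 h)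

/-! ### Exchanging the first two lines of a normal form with the next two -/

/-- Action on matrices of the exchange of the first two pairs of lines. -/
def swapQ (l k : ℝ) (Q : Matrix (Fin 2) (Fin 2) ℝ) : Matrix (Fin 2) (Fin 2) ℝ :=
  !![k * (Q 0 0 + Q 1 0 - l * Q 0 1 - l * Q 1 1), k * (Q 0 0 + Q 1 0 - Q 0 1 - Q 1 1);
     l * Q 0 1 - Q 0 0 + k * (l * Q 1 1 - Q 1 0), Q 0 1 - Q 0 0 + k * (Q 1 1 - Q 1 0)]

/-- Action on parameters of the exchange of the first two pairs of lines. -/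
def swapPar (p : Par) : Par := (p.1, p.2.1, swapQ p.1 p.2.1 p.2.2.1, swapQ p.1 p.2.1 p.2.2.2)

/-- The linear transformation exchanging the first two pairs of lines. -/
def swapA (l k : ℝ) : Matrix (Fin 4) (Fin 4) ℝ :=
  !![k * (k - 1), 0, -(k * (k - 1) * l), 0; 0, k, 0, -1;
     k * (k - 1), 0, -(k * (k - 1)), 0; 0, k, 0, -k]

theorem det_swapA (l k : ℝ) :
    (swapA l k).det = -((k * (k - 1)) ^ 2 * (l - 1) * (k * (k - 1))) := by
  simp [swapA, Matrix.det_succ_row_zero, Fin.sum_univ_succ, Fin.succAbove]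
  ring

theorem det_swapQ (l k : ℝ) (Q : Matrix (Fin 2) (Fin 2) ℝ) :
    (swapQ l k Q).det = -((l - 1) * (k * (k - 1)) * Q.det) := by
  simp [swapQ, Matrix.det_fin_two]
  ring

theorem swapQ_sub (l k : ℝ) (Q R : Matrix (Fin 2) (Fin 2) ℝ) :
    swapQ l k (Q - R) = swapQ l k Q - swapQ l k R := by
  ext i j
  fin_cases i <;> fin_cases j <;> simp [swapQ] <;> ring

theorem el_swapQ (l k : ℝ) (Q : Matrix (Fin 2) (Fin 2) ℝ) :
    el l k (swapQ l k Q) = ![-(k * el l k Q 2), -el l k Q 3, (l - 1) * (k - 1) * el l k Q 0,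
      k * (l - 1) * (k - 1) * el l k Q 1] := by
  ext i
  fin_cases i <;> simp [el, swapQ] <;> ring

theorem swapPar_mem {e f : Fin 4 → ℝ} {s : ℝ} {p : Par} (hp : p ∈ Reg e f s) :
    swapPar p ∈ Reg ![-e 2, -e 3, e 0, e 1] ![-f 2, -f 3, f 0, f 1] (-s) := by
  obtain ⟨hl, hk, he, hf, hs⟩ := hp
  have hl' : 0 < p.1 - 1 := by linarith
  have hk' : 0 < p.2.1 - 1 := by linarith
  have hk0 : 0 < p.2.1 := by linarith
  have key : ∀ {e : Fin 4 → ℝ} {Q : Matrix (Fin 2) (Fin 2) ℝ},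
      (∀ i, 0 < e i * el p.1 p.2.1 Q i) → ∀ i, 0 < (![-e 2, -e 3, e 0, e 1] : Fin 4 → ℝ) i *
        el p.1 p.2.1 (swapQ p.1 p.2.1 Q) i := by
    intro e Q h i
    rw [el_swapQ]
    fin_cases i <;> simp
    · nlinarith [h 2]
    · exact h 3
    · nlinarith [h 0, mul_pos (mul_pos hl' hk') (h 0)]
    · nlinarith [h 1, mul_pos (mul_pos (mul_pos hk0 hl') hk') (h 1)]
  refine ⟨hl, hk, key he, key hf, ?_⟩
  simp only [swapPar]
  rw [← swapQ_sub, det_swapQ]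
  have := mul_pos (mul_pos hl' (mul_pos hk0 hk')) hs
  linarith

theorem mapP_swapA_lineQ (l k : ℝ) (Q : Matrix (Fin 2) (Fin 2) ℝ) :
    mapP (swapA l k) (lineQ Q) = act !![k, k; -1, -k] (lineQ (swapQ l k Q)) := by
  ext i <;> fin_cases i <;> simp [mapP, swapA, lineQ, act, swapQ] <;> ring

theorem nf_swap {e f : Fin 4 → ℝ} {s : ℝ} {p : Par} (hp : p ∈ Reg e f s) :
    FrEquiv (fun i => mapP (swapA p.1 p.2.1) (nf p i)) (nf (swapPar p)) := by
  have hm := nf_mem (swapPar_mem hp)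
  have hl' : p.1 - 1 ≠ 0 := by linarith [hp.1]
  have hk' : p.2.1 - 1 ≠ 0 := by linarith [hp.2.1]
  have hk0 : p.2.1 ≠ 0 := by linarith [hp.2.1]
  set c := p.2.1 * (p.2.1 - 1) with hc
  have hc0 : c ≠ 0 := mul_ne_zero hk0 hk'
  let π : Equiv.Perm (Fin 6) := Equiv.swap 0 2 * Equiv.swap 1 3
  let g : Fin 6 → Matrix (Fin 2) (Fin 2) ℝ := ![!![c, 0; 0, p.2.1], !![-c, 0; 0, -1],
    !![-(c * (p.1 - 1)), 0; 0, p.2.1 - 1], !![c * (p.1 - 1), 0; 0, -c],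
    !![p.2.1, p.2.1; -1, -p.2.1], !![p.2.1, p.2.1; -1, -p.2.1]]
  have h4 : -(p.2.1 * p.2.1) + p.2.1 ≠ 0 := fun h => hc0 (by rw [hc]; linarith)
  have hg : ∀ i, (g i).det ≠ 0 := by
    intro i
    fin_cases i <;> simp [g, Matrix.det_fin_two_of, hl', hk', hk0, hc0, h4]
  have heq : (fun i => mapP (swapA p.1 p.2.1) (nf p i)) =
      fun i => act (g i) ((nf (swapPar p) ∘ π) i) := by
    funext i
    fin_cases i
    · ext i <;> fin_cases i <;> simp [mapP, swapA, nf, act, swapPar, g, π, Equiv.swap_apply_def, hc]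
    · ext i <;> fin_cases i <;> simp [mapP, swapA, nf, act, swapPar, g, π, Equiv.swap_apply_def, hc]
    · ext i <;> fin_cases i <;> simp [mapP, swapA, nf, act, swapPar, g, π, Equiv.swap_apply_def, hc] <;> ring
    · ext i <;> fin_cases i <;> simp [mapP, swapA, nf, act, swapPar, g, π, Equiv.swap_apply_def, hc] <;> ring
    · exact mapP_swapA_lineQ _ _ _
    · exact mapP_swapA_lineQ _ _ _
  rw [heq]
  exact ((FrEquiv.of_comp hm π).trans (FrEquiv.of_act (comp_mem hm π) hg)).symm

theorem nf_equiv_of_swap {e f : Fin 4 → ℝ} {s : ℝ} {p q : Par} (hp : p ∈ Reg e f s)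
    (hq : q ∈ Reg e f s) (h : FrEquiv (nf (swapPar p)) (nf (swapPar q))) :
    FrEquiv (nf p) (nf q) := by
  have neg : ∀ {p : Par}, p ∈ Reg e f s → (swapA p.1 p.2.1).det < 0 := fun {p} hp => by
    have hl' : 0 < p.1 - 1 := by linarith [hp.1]
    have hk' : 0 < p.2.1 - 1 := by linarith [hp.2.1]
    have hk0 : 0 < p.2.1 := by linarith [hp.2.1]
    rw [det_swapA, neg_lt_zero]
    positivity
  exact FrEquiv.of_map_neg (neg hp) (neg hq) ((nf_swap hp).trans (h.trans (nf_swap hq).symm))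
    (nf_mem hq)

theorem swap_sign {e : Fin 4 → ℝ} (he : ∀ i, e i = 1 ∨ e i = -1) :
    ∀ i, (![-e 2, -e 3, e 0, e 1] : Fin 4 → ℝ) i = 1 ∨
      (![-e 2, -e 3, e 0, e 1] : Fin 4 → ℝ) i = -1 := by
  have neg : ∀ {x : ℝ}, x = 1 ∨ x = -1 → -x = 1 ∨ -x = -1 := fun h => by
    rcases h with rfl | rfl <;> simp
  intro i
  fin_cases i
  · exact neg (he 2)
  · exact neg (he 3)
  · exact he 0
  · exact he 1

theorem nf_equiv_good' {e f : Fin 4 → ℝ} {s : ℝ} {p q : Par} (he : ∀ i, e i = 1 ∨ e i = -1)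
    (hf : ∀ i, f i = 1 ∨ f i = -1) (h0 : e 0 = f 0) (h1 : e 1 = f 1) (h2 : e 2 = -f 2)
    (h3 : e 3 = -f 3) (hs : s = -(e 2 * e 3)) (hp : p ∈ Reg e f s) (hq : q ∈ Reg e f s) :
    FrEquiv (nf p) (nf q) :=
  nf_equiv_of_swap hp hq (nf_equiv_good (swap_sign he) (swap_sign hf) (by simp [h2]) (by simp [h3])
    h0 h1 (by simp [hs]) (swapPar_mem hp) (swapPar_mem hq))

theorem nf_equiv_bad' {e f : Fin 4 → ℝ} {s : ℝ} {p q : Par} (he : ∀ i, e i = 1 ∨ e i = -1)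
    (hf : ∀ i, f i = 1 ∨ f i = -1) (h0 : e 0 = f 0) (h1 : e 1 = f 1) (h2 : e 2 = -f 2)
    (h3 : e 3 = -f 3) (hs : s = e 2 * e 3) (hp : p ∈ Reg e f s) (hq : q ∈ Reg e f s)
    (h : 0 < ((swapPar p).2.2.1 - (swapPar p).2.2.2) 0 0 *
      ((swapPar q).2.2.1 - (swapPar q).2.2.2) 0 0) :
    FrEquiv (nf p) (nf q) :=
  nf_equiv_of_swap hp hq (nf_equiv_bad (swap_sign he) (swap_sign hf) (by simp [h2]) (by simp [h3])
    h0 h1 (by simp [hs]) (swapPar_mem hp) (swapPar_mem hq) h)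

/-! ### Moving the last line through another chart -/

/-- A frame of the line attached to `(det A)⁻¹ • A` which makes sense for all `A`. -/
def lineA (A : Matrix (Fin 2) (Fin 2) ℝ) : V4 × V4 :=
  (![1, A 1 1, 0, -A 0 1], ![0, -A 1 0, 1, A 0 0])

/-- The normal form with the last line given in the other chart. -/
def mf (l k : ℝ) (Q A : Matrix (Fin 2) (Fin 2) ℝ) : Fr :=
  ![(![1, 0, 0, 0], ![0, 1, 0, 0]), (![0, 0, 1, 0], ![0, 0, 0, 1]),
    (![1, 0, 1, 0], ![0, 1, 0, 1]), (![l, 0, 1, 0], ![0, 1, 0, k]), lineQ Q, lineA A]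

/-- The bracket of the last two lines of `mf`, up to sign. -/
def mix (Q A : Matrix (Fin 2) (Fin 2) ℝ) : ℝ :=
  Q.det * A.det - (Q 0 0 * A 1 1 - Q 0 1 * A 1 0 - Q 1 0 * A 0 1 + Q 1 1 * A 0 0) + 1

theorem br_mf_five (l k : ℝ) (Q A : Matrix (Fin 2) (Fin 2) ℝ) (i : Fin 4) :
    br (mf l k Q A (i.castLE (by norm_num))) (mf l k Q A 5) = el l k A i := by
  fin_cases i <;> simp [br_eq, mf, lineA, el] <;> ring

theorem br_mf_four_five (l k : ℝ) (Q A : Matrix (Fin 2) (Fin 2) ℝ) :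
    br (mf l k Q A 4) (mf l k Q A 5) = -mix Q A := by
  simp [br_eq, mf, lineQ, lineA, mix, Matrix.det_fin_two]
  ring

theorem br_mf_four (l k : ℝ) (Q A : Matrix (Fin 2) (Fin 2) ℝ) (i : Fin 4) :
    br (mf l k Q A (i.castLE (by norm_num))) (mf l k Q A 4) = el l k Q i := by
  fin_cases i <;> simp [br_eq, mf, lineQ, el] <;> ring

theorem br_mf (l k : ℝ) (Q A : Matrix (Fin 2) (Fin 2) ℝ) :
    br (mf l k Q A 0) (mf l k Q A 1) = 1 ∧ br (mf l k Q A 0) (mf l k Q A 2) = 1 ∧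
    br (mf l k Q A 1) (mf l k Q A 2) = 1 ∧ br (mf l k Q A 0) (mf l k Q A 3) = k ∧
    br (mf l k Q A 1) (mf l k Q A 3) = l ∧
    br (mf l k Q A 2) (mf l k Q A 3) = -((l - 1) * (k - 1)) := by
  refine ⟨?_, ?_, ?_, ?_, ?_, ?_⟩ <;> simp [br_eq, mf]
  ring

theorem mf_mem {l k : ℝ} {Q A : Matrix (Fin 2) (Fin 2) ℝ} (hl : 1 < l) (hk : 1 < k)
    (hQ : ∀ i, el l k Q i ≠ 0) (hA : ∀ i, el l k A i ≠ 0) (h : mix Q A ≠ 0) :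
    mf l k Q A ∈ SkewFr := by
  have h4 : ∀ i : Fin 4, br (mf l k Q A (i.castLE (by norm_num))) (mf l k Q A 4) ≠ 0 :=
    fun i => by rw [br_mf_four]; exact hQ i
  have h5 : ∀ i : Fin 4, br (mf l k Q A (i.castLE (by norm_num))) (mf l k Q A 5) ≠ 0 := fun i => by
    rw [br_mf_five]; exact hA i
  have h45 : br (mf l k Q A 4) (mf l k Q A 5) ≠ 0 := by
    rw [br_mf_four_five]; exact neg_ne_zero.2 h
  obtain ⟨h01, h02, h12, h03, h13, h23⟩ := br_mf l k Q A
  have : 0 < (l - 1) * (k - 1) := mul_pos (by linarith) (by linarith)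
  exact mem_skewFr_of_lt (forall_lt_six (h01 ▸ one_ne_zero) (h02 ▸ one_ne_zero)
    (h03.trans_ne (by linarith)) (h4 0) (h5 0) (h12 ▸ one_ne_zero) (h13.trans_ne (by linarith)) (h4 1) (h5 1)
    (h23 ▸ by linarith) (h4 2) (h5 2) (h4 3) (h5 3) h45)

theorem continuous_mf (l k : ℝ) (Q : Matrix (Fin 2) (Fin 2) ℝ) : Continuous (mf l k Q) := by
  have hA : Continuous lineA := by
    refine Continuous.prodMk (continuous_pi fun i => ?_) (continuous_pi fun i => ?_) <;>
      fin_cases i <;> simp <;> fun_prop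
  refine continuous_pi fun i => ?_
  fin_cases i <;> first | exact continuous_const | exact hA

theorem mf_equiv_nf {l k : ℝ} {Q A : Matrix (Fin 2) (Fin 2) ℝ} (h : mf l k Q A ∈ SkewFr)
    (hA : A.det ≠ 0) : FrEquiv (mf l k Q A) (nf (l, k, Q, A.det⁻¹ • A)) := by
  let g : Fin 6 → Matrix (Fin 2) (Fin 2) ℝ := ![1, 1, 1, 1, 1, A.det⁻¹ • A]
  have hg : ∀ i, (g i).det ≠ 0 := by
    intro i
    fin_cases i <;> simp [g, hA]
  have h1 : A.det⁻¹ * (A 0 0 * A 1 1 - A 0 1 * A 1 0) = 1 := by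
    rw [← Matrix.det_fin_two, inv_mul_cancel₀ hA]
  have hlast : act (A.det⁻¹ • A) (lineA A) = lineQ (A.det⁻¹ • A) := by
    ext i <;> fin_cases i <;> simp [act, lineQ, lineA] <;> linarith
  have heq : (fun i => act (g i) (mf l k Q A i)) = nf (l, k, Q, A.det⁻¹ • A) := by
    funext i
    fin_cases i <;> simp [g, act_one, mf, nf, hlast]
  rw [← heq]
  exact FrEquiv.of_act h hg

theorem nf_equiv_of_segment {l k : ℝ} {Q A B : Matrix (Fin 2) (Fin 2) ℝ} (hl : 1 < l) (hk : 1 < k)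
    (hQ : ∀ i, el l k Q i ≠ 0) {f : Fin 4 → ℝ} (hA : ∀ i, 0 < f i * el l k A i)
    (hB : ∀ i, 0 < f i * el l k B i)
    (hmix : ∀ a b : ℝ, 0 ≤ a → 0 ≤ b → a + b = 1 → mix Q (a • A + b • B) ≠ 0)
    (dA : A.det ≠ 0) (dB : B.det ≠ 0) :
    FrEquiv (nf (l, k, Q, A.det⁻¹ • A)) (nf (l, k, Q, B.det⁻¹ • B)) := by
  have hseg : ∀ C ∈ segment ℝ A B, mf l k Q C ∈ SkewFr := by
    rintro _ ⟨a, b, ha, hb, hab, rfl⟩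
    refine mf_mem hl hk hQ (fun i => ?_) (hmix a b ha hb hab)
    have := add_pos_of_convex ha hb hab (hA i) (hB i)
    rw [el_add, el_smul, el_smul]
    intro h0
    have h2 : f i * (a * el l k A i + b * el l k B i) = 0 := by rw [h0, mul_zero]
    linarith
  have hj : JoinedIn SkewFr (mf l k Q A) (mf l k Q B) := by
    refine ((JoinedIn.of_segment_subset (s := segment ℝ A B) subset_rfl).map
      (continuous_mf l k Q)).mono ?_
    rintro _ ⟨C, hC, rfl⟩
    exact hseg C hC
  exact (mf_equiv_nf hj.source_mem dA).symm.trans (hj.frEquiv.trans (mf_equiv_nf hj.target_mem dB))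

theorem exists_nf_equiv_twin {e : Fin 4 → ℝ} {s l k : ℝ} {Q R W : Matrix (Fin 2) (Fin 2) ℝ}
    (hp : (l, k, Q, R) ∈ Reg e (-e) s) (hW : ∀ i, 0 < e i * el l k W i) (hd : s * W.det < 0) :
    ∃ q ∈ Reg e e (-s), FrEquiv (nf (l, k, Q, R)) (nf q) := by
  set D := Q - R with hD
  obtain ⟨hl, hk, he, hf, hs⟩ := id hp
  simp only at hl hk he hf hs
  rw [← hD] at hs
  have eD : ∀ i, 0 < e i * el l k D i := fun i => by
    have h1 := he i
    have h2 := hf i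
    simp only [Pi.neg_apply] at h2
    rw [hD, el_sub]
    linarith
  have mem : ∀ x y : ℝ, 0 < x → 0 < y → (l, k, x • D, -(y • D)) ∈ Reg e (-e) s := fun x y hx hy => by
    refine ⟨hl, hk, fun i => ?_, fun i => ?_, ?_⟩
    · simp only [el_smul]
      have := mul_pos hx (eD i)
      linarith
    · simp only [el_neg, el_smul, Pi.neg_apply]
      have := mul_pos hy (eD i)
      linarith
    · have : x • D - -(y • D) = (x + y) • D := by rw [add_smul, sub_neg_eq_add]
      simp only [this, Matrix.det_smul, Fintype.card_fin]
      have := mul_pos (pow_pos (add_pos hx hy) 2) hs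
      linarith
  have hsD : D.det ≠ 0 := right_ne_zero_of_mul hs.ne'
  have hsW : W.det ≠ 0 := right_ne_zero_of_mul hd.ne
  set A : Matrix (Fin 2) (Fin 2) ℝ := -(D.det⁻¹ • D) with hA
  set B : Matrix (Fin 2) (Fin 2) ℝ := -s • W with hB
  have hs0 : s ≠ 0 := left_ne_zero_of_mul hs.ne'
  obtain ⟨η, hη, hη1⟩ : ∃ η : ℝ, 0 < η ∧ ∀ t ∈ Set.Icc (0 : ℝ) 1,
      0 < mix (η • D) ((1 - t) • A + t • B) := by
    have hc : Continuous fun p : ℝ × ℝ => mix (p.1 • D) ((1 - p.2) • A + p.2 • B) := by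
      simp only [mix, Matrix.det_fin_two, Matrix.add_apply, Matrix.smul_apply, smul_eq_mul]
      fun_prop
    have h0 : ∀ t ∈ Set.Icc (0 : ℝ) 1, ∀ᶠ p : ℝ × ℝ in nhds ((0 : ℝ), t),
        0 < mix (p.1 • D) ((1 - p.2) • A + p.2 • B) := by
      intro t _
      refine hc.continuousAt.eventually (lt_mem_nhds ?_)
      simp [mix]
    have h1 := isCompact_Icc.eventually_forall_of_forall_eventually
      (P := fun x t => 0 < mix (x • D) ((1 - t) • A + t • B)) h0
    obtain ⟨η, h2, h3⟩ := ((h1.filter_mono nhdsWithin_le_nhds).and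
      (self_mem_nhdsWithin (a := (0 : ℝ)) (s := Set.Ioi 0))).exists
    exact ⟨η, h3, h2⟩
  have detA : A.det = D.det⁻¹ := by
    rw [hA, Matrix.det_fin_two]
    simp only [Matrix.neg_apply, Matrix.smul_apply, smul_eq_mul]
    rw [Matrix.det_fin_two] at hsD ⊢
    field_simp
  have detB : B.det = s ^ 2 * W.det := by
    rw [hB, Matrix.det_smul, Fintype.card_fin, neg_sq]
  have hAB := nf_equiv_of_segment (l := l) (k := k) (Q := η • D) (A := A) (B := B) (f := -s • e) hl hk
    (fun i => right_ne_zero_of_mul ((mem η 1 hη one_pos).2.2.1 i).ne') (fun i => ?_) (fun i => ?_)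
    (fun a b ha hb hab => ?_) (detA ▸ inv_ne_zero hsD) (detB ▸ mul_ne_zero (pow_ne_zero 2 hs0) hsW)
  · have h1 : A.det⁻¹ • A = -((1 : ℝ) • D) := by
      rw [detA, inv_inv, hA, smul_neg, smul_smul, mul_inv_cancel₀ hsD]
    rw [h1] at hAB
    refine ⟨_, ?_, ((joinedIn_reg_of_sub_eq hp (mem (1/2) (1/2) (by norm_num) (by norm_num))
      ?_).nf.trans (JoinedIn.nf (e := e) (f := -e) (s := s) ?_)).trans hAB⟩
    · have hQ := (mem η 1 hη one_pos).2.2.1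
      have h0 : s ^ 2 * W.det ≠ 0 := mul_ne_zero (pow_ne_zero 2 hs0) hsW
      have hr : 0 < B.det⁻¹ * -s := by
        have h2 : B.det⁻¹ * -s = (s ^ 2 * W.det)⁻¹ ^ 2 * (s ^ 2 * -(s * W.det)) := by
          rw [detB]
          field_simp
        rw [h2]
        have h3 : 0 < -(s * W.det) := by linarith
        have h4 : 0 < (s ^ 2 * W.det)⁻¹ ^ 2 := by positivity
        positivity
      refine ⟨hl, hk, hQ, fun i => ?_, ?_⟩
      · have := mul_pos hr (hW i)
        simp only [el_smul, hB]
        simp only [hB] at this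
        linarith
      · have h1 := hη1 1 ⟨by norm_num, le_rfl⟩
        have h2 : mix (η • D) B = B.det * (η • D - B.det⁻¹ • B).det := by
          have h3 : B.det⁻¹ * B.det = 1 := inv_mul_cancel₀ (detB ▸ h0)
          have h4 : (η • D - B.det⁻¹ • B).det = (η • D).det - B.det⁻¹ * ((η • D) 0 0 * B 1 1 -
              (η • D) 0 1 * B 1 0 - (η • D) 1 0 * B 0 1 + (η • D) 1 1 * B 0 0) +
              B.det⁻¹ * (B.det⁻¹ * B.det) := by
            rw [Matrix.det_fin_two (_ - _), Matrix.det_fin_two (η • D)]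
            conv_rhs => rw [Matrix.det_fin_two B]
            simp only [Matrix.sub_apply, Matrix.smul_apply, smul_eq_mul, Matrix.det_fin_two B]
            ring
          rw [h4, h3, mix]
          linear_combination ((η • D) 0 0 * B 1 1 - (η • D) 0 1 * B 1 0 - (η • D) 1 0 * B 0 1 +
            (η • D) 1 1 * B 0 0 - 1) * h3
        simp only [sub_self, zero_smul, one_smul, zero_add] at h1
        have h3 := mul_pos hr h1
        rw [h2] at h3
        have h4 : B.det⁻¹ * B.det = 1 := inv_mul_cancel₀ (detB ▸ h0)
        have h5 : B.det⁻¹ * -s * (B.det * (η • D - B.det⁻¹ • B).det) =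
          (B.det⁻¹ * B.det) * (-s * (η • D - B.det⁻¹ • B).det) := by ring
        rw [h5, h4, one_mul] at h3
        exact h3
    · rw [← hD, sub_neg_eq_add, ← add_smul]
      norm_num
    · refine JoinedIn.of_segment_subset ?_
      rintro _ ⟨a, b, ha, hb, hab, rfl⟩
      have hl : a * l + b * l = l := by rw [← add_mul, hab, one_mul]
      have hk : a * k + b * k = k := by rw [← add_mul, hab, one_mul]
      have := mem (a * (1 / 2) + b * η) (a * (1 / 2) + b * 1)
        (add_pos_of_convex ha hb hab (by norm_num) hη)
        (add_pos_of_convex ha hb hab (by norm_num) one_pos)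
      convert this using 1
      simp only [Prod.smul_mk, Prod.mk_add_mk, smul_eq_mul, hl, hk, add_smul, smul_neg, mul_smul,
        neg_add]
  · rw [hA, el_neg, el_smul, Pi.smul_apply, smul_eq_mul]
    have h1 := mul_pos (mul_pos (sq_pos_of_ne_zero (inv_ne_zero hsD)) hs) (eD i)
    have h2 : -s * e i * -(D.det⁻¹ * el l k D i) =
        D.det⁻¹ * D.det⁻¹⁻¹ * (D.det⁻¹ * s * (e i * el l k D i)) := by
      rw [mul_inv_cancel₀ (inv_ne_zero hsD)]
      ring
    have h3 : D.det⁻¹ ^ 2 * (s * D.det) * (e i * el l k D i) =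
        D.det⁻¹ * D.det⁻¹⁻¹ * (D.det⁻¹ * s * (e i * el l k D i)) := by
      rw [inv_inv]
      ring
    rw [h2, ← h3]
    exact h1
  · rw [hB, el_smul, Pi.smul_apply, smul_eq_mul]
    have := mul_pos (pow_pos (sq_pos_of_ne_zero hs0) 1) (hW i)
    nlinarith
  · have h1 := hη1 b ⟨hb, by linarith⟩
    rw [← hab, add_sub_cancel_right] at h1
    exact ne_of_gt h1

/-- Existence of matrices in a cone of prescribed signs with prescribed sign of determinant. -/
def ConeMeets (e : Fin 4 → ℝ) (s : ℝ) : Prop :=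
  ∀ l k : ℝ, 1 < l → 1 < k → ∃ W : Matrix (Fin 2) (Fin 2) ℝ,
    (∀ i, 0 < e i * el l k W i) ∧ s * W.det < 0

theorem coneMeets_pppp_pos : ConeMeets ![1, 1, 1, 1] 1 := by
  intro l k hl hk
  refine ⟨!![-2, 1; -1, 1], fun i => ?_, by norm_num [Matrix.det_fin_two_of]⟩
  fin_cases i <;> simp [el] <;> nlinarith

theorem coneMeets_pppp_neg : ConeMeets ![1, 1, 1, 1] (-1) := by
  intro l k hl hk
  refine ⟨!![0, 1; -1, 0], fun i => ?_, by norm_num [Matrix.det_fin_two_of]⟩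
  fin_cases i <;> simp [el]
  linarith

theorem coneMeets_pppn_neg : ConeMeets ![1, 1, 1, -1] (-1) := by
  intro l k hl hk
  have h : 0 < l * k - 1 := by nlinarith
  set t := (l * k - 1) / (4 * (l + k)) with ht
  have h0 : 0 < t := by positivity
  have h1 : (l + k) * t = (l * k - 1) / 4 := by
    rw [ht]; field_simp
  refine ⟨!![-(1 + k * l) / 2, t; -t, -1], fun i => ?_, ?_⟩
  · fin_cases i <;> simp [el] <;> nlinarith
  · rw [Matrix.det_fin_two_of]; nlinarith

theorem coneMeets_pppn_pos : ConeMeets ![1, 1, 1, -1] 1 := by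
  intro l k hl hk
  have ha : 0 < k - 1 := by linarith
  have hd : 0 < l - 1 := by linarith
  obtain ⟨g, hg, hg'⟩ := exists_between (lt_min
    (show 0 < (l - 1) ^ 2 * (k - 1) / k by positivity)
    (show 0 < (k - 1) * (l - 1) / (k - 1 + (l - 1)) by positivity))
  have h1 := hg'.trans_le (min_le_left _ _)
  have h2 := hg'.trans_le (min_le_right _ _)
  rw [lt_div_iff₀ (by linarith)] at h1 h2
  refine ⟨!![k - 1, k - 1 + (l - 1); -g, -(l - 1)], fun i => ?_, ?_⟩
  · fin_cases i <;> simp [el] <;> nlinarith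
  · rw [Matrix.det_fin_two_of]; nlinarith

theorem coneMeets_pnpn_pos : ConeMeets ![1, -1, 1, -1] 1 := by
  intro l k hl hk
  have ha : 0 < k - 1 := by linarith
  have hd : 0 < l - 1 := by linarith
  set g := (l - 1) ^ 2 * (k - 1) / (2 * l) with hg
  have h0 : 0 < g := by positivity
  have h1 : 2 * (l * g) = (l - 1) ^ 2 * (k - 1) := by rw [hg]; field_simp
  refine ⟨!![k - 1, k - 1 + (l - 1) + 2 * g; g, -(l - 1)], fun i => ?_, ?_⟩
  · fin_cases i <;> simp [el] <;> nlinarith [mul_pos h0 (show 0 < k by linarith)]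
  · rw [Matrix.det_fin_two_of]; nlinarith [mul_pos ha hd, mul_pos ha h0, mul_pos hd h0]

/-- All normal forms of a twin type are equivalent. -/
theorem nf_equiv_twin_or {e : Fin 4 → ℝ} {s : ℝ} (he : ∀ i, e i = 1 ∨ e i = -1)
    (h : ConeMeets e s) {p q : Par} (hp : p ∈ Reg e e (-s) ∨ p ∈ Reg e (-e) s)
    (hq : q ∈ Reg e e (-s)) : FrEquiv (nf p) (nf q) := by
  rcases hp with hp | hp
  · exact nf_equiv_twin he hp hq
  · obtain ⟨l, k, Q, R⟩ := p
    obtain ⟨W, hW, hd⟩ := h l k hp.1 hp.2.1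
    obtain ⟨p', hp', h'⟩ := exists_nf_equiv_twin hp hW hd
    exact h'.trans (nf_equiv_twin he hp' hq)

/-! ### Reduction to normal form -/

/-- The brackets of a system of frames have prescribed signs. -/
def Pat (S : Fin 6 → Fin 6 → ℝ) (x : Fr) : Prop :=
  ∀ i j, i ≠ j → 0 < S i j * br (x i) (x j)

theorem Pat.mem {S : Fin 6 → Fin 6 → ℝ} {x : Fr} (h : Pat S x) : x ∈ SkewFr :=
  fun i j hij => right_ne_zero_of_mul (h i j hij).ne'

theorem Pat.image {S : Fin 6 → Fin 6 → ℝ} {x : Fr} (h : Pat S x) {A : Matrix (Fin 4) (Fin 4) ℝ}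
    (hA : 0 < A.det) : Pat S fun i => mapP A (x i) := by
  intro i j hij
  rw [br_mapP]
  have := mul_pos hA (h i j hij)
  linarith

theorem br_pos_of_joinedIn {x y : Fr} (hj : JoinedIn SkewFr x y) {c : ℝ} {i j : Fin 6} (hij : i ≠ j)
    (h : 0 < c * br (x i) (x j)) : 0 < c * br (y i) (y j) := by
  have h1 : Continuous fun x : Fr => br (x i) (x j) :=
    continuous_br.comp (f := fun x : Fr => (x i, x j)) (by fun_prop)
  have hc : c ≠ 0 := left_ne_zero_of_mul h.ne'
  have h3 : ∀ z ∈ SkewFr, c * br (z i) (z j) ≠ 0 := fun z hz => mul_ne_zero hc (hz i j hij)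
  exact hj.pos_of_pos (f := fun x : Fr => c * br (x i) (x j)) (h1.const_mul c).continuousOn h3 h

theorem Pat.joinedIn {S : Fin 6 → Fin 6 → ℝ} {x y : Fr} (h : Pat S x) (hj : JoinedIn SkewFr x y) :
    Pat S y :=
  fun i j hij => br_pos_of_joinedIn hj hij (h i j hij)

/-- A frame given by two `2 × 2` blocks. -/
def fr (P G : Matrix (Fin 2) (Fin 2) ℝ) : V4 × V4 :=
  (![P 0 0, P 0 1, G 0 0, G 0 1], ![P 1 0, P 1 1, G 1 0, G 1 1])

theorem exists_fr (x : V4 × V4) : ∃ P G, x = fr P G := by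
  refine ⟨!![x.1 0, x.1 1; x.2 0, x.2 1], !![x.1 2, x.1 3; x.2 2, x.2 3], ?_⟩
  ext i <;> fin_cases i <;> simp [fr]

theorem act_fr (g P G : Matrix (Fin 2) (Fin 2) ℝ) : act g (fr P G) = fr (g * P) (g * G) := by
  ext i <;> fin_cases i <;> simp [fr, act, Matrix.mul_apply, Fin.sum_univ_two]

/-- A block diagonal transformation. -/
def blk (S R : Matrix (Fin 2) (Fin 2) ℝ) : Matrix (Fin 4) (Fin 4) ℝ :=
  !![S 0 0, S 1 0, 0, 0; S 0 1, S 1 1, 0, 0; 0, 0, R 0 0, R 1 0; 0, 0, R 0 1, R 1 1]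

theorem det_blk (S R : Matrix (Fin 2) (Fin 2) ℝ) : (blk S R).det = S.det * R.det := by
  simp [blk, Matrix.det_succ_row_zero, Fin.sum_univ_succ, Fin.succAbove]
  ring

theorem mapP_blk (S R P G : Matrix (Fin 2) (Fin 2) ℝ) :
    mapP (blk S R) (fr P G) = fr (P * S) (G * R) := by
  ext i <;> fin_cases i <;> simp [fr, mapP, blk, Matrix.mul_apply, Fin.sum_univ_two]

theorem br_fr_one_zero (P G : Matrix (Fin 2) (Fin 2) ℝ) : br (fr 1 0) (fr P G) = G.det := by
  simp [br_eq, fr, Matrix.det_fin_two]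

theorem br_fr_zero_one (P G : Matrix (Fin 2) (Fin 2) ℝ) : br (fr 0 1) (fr P G) = P.det := by
  simp [br_eq, fr, Matrix.det_fin_two]
  try ring

theorem br_fr_one_left (P G H : Matrix (Fin 2) (Fin 2) ℝ) :
    br (fr 1 P) (fr 1 G) = (G - P).det := by
  simp [br_eq, fr, Matrix.det_fin_two]
  ring

theorem exists_diagonalization {H : Matrix (Fin 2) (Fin 2) ℝ} (h : 0 < H.det)
    (h1 : (H - 1).det < 0) : ∃ S : Matrix (Fin 2) (Fin 2) ℝ, ∃ m k : ℝ, 0 < S.det ∧ 0 < m ∧ m < 1 ∧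
      1 < k ∧ H * S = S * !![m, 0; 0, k] := by
  have hd : H.det = H 0 0 * H 1 1 - H 0 1 * H 1 0 := Matrix.det_fin_two _
  have hd1 : (H - 1).det = (H 0 0 - 1) * (H 1 1 - 1) - H 0 1 * H 1 0 := by
    rw [Matrix.det_fin_two]; simp
  set a := H 0 0 with ha
  set b := H 0 1 with hb
  set c := H 1 0 with hc
  set d := H 1 1 with hd'
  rw [hd] at h
  rw [hd1] at h1
  have htr : 1 + (a * d - b * c) < a + d := by linarith
  have hdisc : 0 < (a + d) ^ 2 - 4 * (a * d - b * c) := by nlinarith [sq_nonneg (a * d - b * c - 1)]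
  set r := √((a + d) ^ 2 - 4 * (a * d - b * c)) with hr
  have hr2 : r ^ 2 = (a + d) ^ 2 - 4 * (a * d - b * c) := Real.sq_sqrt hdisc.le
  have hr0 : 0 < r := Real.sqrt_pos.2 hdisc
  set m := (a + d - r) / 2 with hm
  set k := (a + d + r) / 2 with hk
  have hsum : m + k = a + d := by rw [hm, hk]; ring
  have hprod : m * k = a * d - b * c := by rw [hm, hk]; linarith [hr2]
  have hmk : m < k := by rw [hm, hk]; linarith
  have hm1 : (m - 1) * (k - 1) < 0 := by linarith
  have hm2 : m < 1 := by nlinarith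
  have hk2 : 1 < k := by nlinarith
  have hm0 : 0 < m := by nlinarith
  have hH : H = !![a, b; c, d] := Matrix.eta_fin_two H
  have hmroot : (m - a) * (m - d) = b * c := by
    have : k = a + d - m := by linarith
    rw [this] at hprod
    linarith
  have hkroot : (k - a) * (k - d) = b * c := by
    have : m = a + d - k := by linarith
    rw [this] at hprod
    linarith
  obtain ⟨S, hS, hHS⟩ : ∃ S : Matrix (Fin 2) (Fin 2) ℝ, S.det ≠ 0 ∧
      H * S = S * !![m, 0; 0, k] := by
    by_cases hb0 : b = 0
    · by_cases hc0 : c = 0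
      · rw [hb0, zero_mul, mul_eq_zero] at hmroot
        rcases hmroot with h0 | h0
        · refine ⟨1, by simp, ?_⟩
          rw [hH, Matrix.mul_one, Matrix.one_mul, hb0, hc0, show a = m by linarith,
            show d = k by linarith]
        · refine ⟨!![0, 1; 1, 0], by simp [Matrix.det_fin_two], ?_⟩
          rw [hH, hb0, hc0, show d = m by linarith, show a = k by linarith]
          simp
      · refine ⟨!![m - d, k - d; c, c], ?_, ?_⟩
        · rw [Matrix.det_fin_two_of]
          have : (m - d) * c - (k - d) * c = c * (m - k) := by ring
          rw [this]
          exact mul_ne_zero hc0 (sub_ne_zero.2 hmk.ne)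
        · rw [hH]
          ext i j
          fin_cases i <;> fin_cases j <;> simp [Matrix.mul_apply, Fin.sum_univ_two] <;> linarith
    · refine ⟨!![b, b; m - a, k - a], ?_, ?_⟩
      · rw [Matrix.det_fin_two_of]
        have : b * (k - a) - b * (m - a) = b * (k - m) := by ring
        rw [this]
        exact mul_ne_zero hb0 (sub_ne_zero.2 hmk.ne')
      · rw [hH]
        ext i j
        fin_cases i <;> fin_cases j <;> simp [Matrix.mul_apply, Fin.sum_univ_two] <;> linarith
  rcases lt_or_gt_of_ne hS with hS | hS
  · refine ⟨S * !![-1, 0; 0, 1], m, k, ?_, hm0, hm2, hk2, ?_⟩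
    · rw [Matrix.det_mul, Matrix.det_fin_two_of]; linarith
    · rw [← Matrix.mul_assoc, hHS, Matrix.mul_assoc, Matrix.mul_assoc]
      congr 1
      ext i j
      fin_cases i <;> fin_cases j <;> simp
  · exact ⟨S, m, k, hS, hm0, hm2, hk2, hHS⟩

theorem exists_first_two {S : Fin 6 → Fin 6 → ℝ} {x : Fr} (h : Pat S x) (hS : 0 < S 0 1) :
    ∃ y, FrEquiv x y ∧ Pat S y ∧ y 0 = fr 1 0 ∧ y 1 = fr 0 1 := by
  set A : Matrix (Fin 4) (Fin 4) ℝ := (Matrix.of ![(x 0).1, (x 0).2, (x 1).1, (x 1).2]).transpose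
    with hA
  have hdet : 0 < A.det := by
    rw [hA, Matrix.det_transpose]
    exact pos_of_mul_pos_right (h 0 1 (by decide)) hS.le
  have hu : IsUnit A.det := isUnit_iff_ne_zero.2 hdet.ne'
  have hinv : 0 < A⁻¹.det := by
    rw [Matrix.det_nonsing_inv, Ring.inverse_eq_inv']
    exact inv_pos.2 hdet
  refine ⟨fun i => mapP A⁻¹ (x i), FrEquiv.of_mapP h.mem hinv, h.image hinv, ?_, ?_⟩
  · have : x 0 = mapP A (fr 1 0) := by
      ext i <;> fin_cases i <;>
        simp [mapP, fr, hA, Matrix.mulVec, dotProduct, Fin.sum_univ_succ, Matrix.transpose_apply]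
    show mapP A⁻¹ (x 0) = _
    rw [this, mapP_mapP, Matrix.nonsing_inv_mul _ hu, mapP_one]
  · have : x 1 = mapP A (fr 0 1) := by
      ext i <;> fin_cases i <;>
        simp [mapP, fr, hA, Matrix.mulVec, dotProduct, Fin.sum_univ_succ, Matrix.transpose_apply]
    show mapP A⁻¹ (x 1) = _
    rw [this, mapP_mapP, Matrix.nonsing_inv_mul _ hu, mapP_one]

theorem FrEquiv.of_eq {x z : Fr} (hx : x ∈ SkewFr) {B : Matrix (Fin 4) (Fin 4) ℝ} (hB : 0 < B.det)
    {g : Fin 6 → Matrix (Fin 2) (Fin 2) ℝ} (hg : ∀ i, (g i).det ≠ 0)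
    (h : ∀ i, mapP B (x i) = act (g i) (z i)) : FrEquiv x z := by
  have h1 := FrEquiv.of_mapP hx hB
  rw [show (fun i => mapP B (x i)) = fun i => act (g i) (z i) from funext h] at h1
  have hg' : ∀ i, ((g i)⁻¹).det ≠ 0 := fun i =>
    ((g i).isUnit_nonsing_inv_det (isUnit_iff_ne_zero.2 (hg i))).ne_zero
  have h2 := FrEquiv.of_act h1.2.1 hg'
  have h3 : (fun i => act (g i)⁻¹ (act (g i) (z i))) = z := by
    funext i
    rw [act_act, Matrix.nonsing_inv_mul _ (isUnit_iff_ne_zero.2 (hg i)), act_one]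
  have h4 : FrEquiv (fun i => act (g i) (z i)) z := by
    rw [h3] at h2
    exact h2
  exact h1.trans h4

theorem Pat.of_eq {S : Fin 6 → Fin 6 → ℝ} {x z : Fr} (h : Pat S x) {B : Matrix (Fin 4) (Fin 4) ℝ}
    (hB : 0 < B.det) {g : Fin 6 → Matrix (Fin 2) (Fin 2) ℝ} (_hg : ∀ i, (g i).det ≠ 0)
    (hx : ∀ i, mapP B (x i) = act (g i) (z i)) :
    Pat (fun i j => (g i).det * (g j).det * S i j) z := by
  intro i j hij
  have h1 : 0 < S i j * br (mapP B (x i)) (mapP B (x j)) := h.image hB i j hij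
  rw [hx i, hx j, br_act_left, br_act_right] at h1
  show 0 < (g i).det * (g j).det * S i j * br (z i) (z j)
  linarith

theorem Pat.congr {S T : Fin 6 → Fin 6 → ℝ} {x : Fr} (h : Pat S x)
    (hT : ∀ i j, i ≠ j → ∃ c, 0 < c ∧ S i j = c * T i j) : Pat T x := by
  intro i j hij
  obtain ⟨c, hc, hs⟩ := hT i j hij
  have h1 := h i j hij
  rw [hs, mul_assoc] at h1
  exact pos_of_mul_pos_right h1 hc.le

theorem exists_first_four {S : Fin 6 → Fin 6 → ℝ} {y : Fr} (h : Pat S y) (h0 : y 0 = fr 1 0)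
    (h1 : y 1 = fr 0 1) (h02 : 0 < S 0 2) (h03 : 0 < S 0 3) (h12 : 0 < S 1 2) (h13 : 0 < S 1 3)
    (h23 : S 2 3 < 0) : ∃ z l k, FrEquiv y z ∧ Pat S z ∧ z 0 = fr 1 0 ∧ z 1 = fr 0 1 ∧
      z 2 = fr 1 1 ∧ z 3 = fr !![l, 0; 0, 1] !![1, 0; 0, k] ∧ 1 < l ∧ 1 < k := by
  obtain ⟨P2, G2, h2⟩ := exists_fr (y 2)
  obtain ⟨P3, G3, h3⟩ := exists_fr (y 3)
  have hG2 : 0 < G2.det := by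
    have := h 0 2 (by decide)
    rw [h0, h2, br_fr_one_zero] at this
    exact pos_of_mul_pos_right this h02.le
  have hG3 : 0 < G3.det := by
    have := h 0 3 (by decide)
    rw [h0, h3, br_fr_one_zero] at this
    exact pos_of_mul_pos_right this h03.le
  have hP2 : 0 < P2.det := by
    have := h 1 2 (by decide)
    rw [h1, h2, br_fr_zero_one] at this
    exact pos_of_mul_pos_right this h12.le
  have hP3 : 0 < P3.det := by
    have := h 1 3 (by decide)
    rw [h1, h3, br_fr_zero_one] at this
    exact pos_of_mul_pos_right this h13.le
  have uP2 : IsUnit P2.det := isUnit_iff_ne_zero.2 hP2.ne'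
  have uP3 : IsUnit P3.det := isUnit_iff_ne_zero.2 hP3.ne'
  obtain ⟨M, rfl⟩ : ∃ M, G2 = P2 * M := ⟨P2⁻¹ * G2, by
    rw [← Matrix.mul_assoc, Matrix.mul_nonsing_inv _ uP2, Matrix.one_mul]⟩
  obtain ⟨N, rfl⟩ : ∃ N, G3 = P3 * N := ⟨P3⁻¹ * G3, by
    rw [← Matrix.mul_assoc, Matrix.mul_nonsing_inv _ uP3, Matrix.one_mul]⟩
  have hM : 0 < M.det := by
    rw [Matrix.det_mul] at hG2; exact pos_of_mul_pos_right hG2 hP2.le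
  have hN : 0 < N.det := by
    rw [Matrix.det_mul] at hG3; exact pos_of_mul_pos_right hG3 hP3.le
  have uM : IsUnit M.det := isUnit_iff_ne_zero.2 hM.ne'
  obtain ⟨H, rfl⟩ : ∃ H, N = H * M := ⟨N * M⁻¹, by
    rw [Matrix.mul_assoc, Matrix.nonsing_inv_mul _ uM, Matrix.mul_one]⟩
  have hH : 0 < H.det := by
    rw [Matrix.det_mul] at hN; exact pos_of_mul_pos_left hN hM.le
  have hH1 : (H - 1).det < 0 := by
    have h5 := h 2 3 (by decide)
    rw [h2, h3, show fr P2 (P2 * M) = act P2 (fr 1 M) by rw [act_fr, Matrix.mul_one],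
      show fr P3 (P3 * (H * M)) = act P3 (fr 1 (H * M)) by rw [act_fr, Matrix.mul_one],
      br_act_left, br_act_right, br_fr_one_left _ _ 1,
      show H * M - M = (H - 1) * M by rw [Matrix.sub_mul, Matrix.one_mul], Matrix.det_mul] at h5
    by_contra h6
    have h7 : 0 ≤ P2.det * (P3.det * ((H - 1).det * M.det)) := by
      have := not_lt.1 h6
      positivity
    have := mul_nonpos_of_nonpos_of_nonneg h23.le h7
    linarith
  obtain ⟨T, m, k, hT, hm0, hm1, hk, hHT⟩ := exists_diagonalization hH hH1
  have hMi : 0 < (M⁻¹ * T).det := by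
    rw [Matrix.det_mul, Matrix.det_nonsing_inv, Ring.inverse_eq_inv']
    exact mul_pos (inv_pos.2 hM) hT
  have hB : 0 < (blk T (M⁻¹ * T)).det := by
    rw [det_blk]; exact mul_pos hT hMi
  set g : Fin 6 → Matrix (Fin 2) (Fin 2) ℝ :=
    ![T, M⁻¹ * T, P2 * T, P3 * T * !![m, 0; 0, 1], 1, 1] with hgdef
  set z : Fr := ![fr 1 0, fr 0 1, fr 1 1, fr !![m⁻¹, 0; 0, 1] !![1, 0; 0, k],
    mapP (blk T (M⁻¹ * T)) (y 4), mapP (blk T (M⁻¹ * T)) (y 5)] with hz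
  have hg : ∀ i, 0 < (g i).det := by
    have hd3 : 0 < (P3 * T * !![m, 0; 0, 1]).det := by
      rw [Matrix.det_mul, Matrix.det_mul, Matrix.det_fin_two_of]
      have := mul_pos hP3 hT
      nlinarith [mul_pos this hm0]
    have hd2 : 0 < (P2 * T).det := by
      rw [Matrix.det_mul]; exact mul_pos hP2 hT
    have hd4 : (0:ℝ) < (1 : Matrix (Fin 2) (Fin 2) ℝ).det := by simp
    intro i
    fin_cases i
    exacts [hT, hMi, hd2, hd3, hd4, hd4]
  have key : ∀ i, mapP (blk T (M⁻¹ * T)) (y i) = act (g i) (z i) := by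
    have e0 : mapP (blk T (M⁻¹ * T)) (y 0) = act T (fr 1 0) := by
      rw [h0, mapP_blk, act_fr]; simp
    have e1 : mapP (blk T (M⁻¹ * T)) (y 1) = act (M⁻¹ * T) (fr 0 1) := by
      rw [h1, mapP_blk, act_fr]; simp
    have e2 : mapP (blk T (M⁻¹ * T)) (y 2) = act (P2 * T) (fr 1 1) := by
      rw [h2, mapP_blk, act_fr, Matrix.mul_one, Matrix.mul_assoc P2 M,
        ← Matrix.mul_assoc M, Matrix.mul_nonsing_inv _ uM, Matrix.one_mul]
    have e3 : mapP (blk T (M⁻¹ * T)) (y 3) =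
        act (P3 * T * !![m, 0; 0, 1]) (fr !![m⁻¹, 0; 0, 1] !![1, 0; 0, k]) := by
      rw [h3, mapP_blk, act_fr]
      congr 1
      · rw [Matrix.mul_assoc (P3 * T)]
        have : (!![m, 0; 0, 1] * !![m⁻¹, 0; 0, 1] : Matrix (Fin 2) (Fin 2) ℝ) = 1 := by
          ext i j
          fin_cases i <;> fin_cases j <;> simp [hm0.ne']
        rw [this, Matrix.mul_one]
      · have : (!![m, 0; 0, 1] * !![1, 0; 0, k] : Matrix (Fin 2) (Fin 2) ℝ) = !![m, 0; 0, k] := by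
          ext i j
          fin_cases i <;> fin_cases j <;> simp
        rw [Matrix.mul_assoc (P3 * T), this, Matrix.mul_assoc P3 T, ← hHT, Matrix.mul_assoc P3,
          Matrix.mul_assoc H, ← Matrix.mul_assoc M, Matrix.mul_nonsing_inv _ uM, Matrix.one_mul]
    intro i
    fin_cases i
    exacts [e0, e1, e2, e3, (act_one _).symm, (act_one _).symm]
  refine ⟨z, m⁻¹, k, FrEquiv.of_eq h.mem hB (fun i => (hg i).ne') key,
    (h.of_eq hB (fun i => (hg i).ne') key).congr fun i j _ =>
      ⟨_, mul_pos (hg i) (hg j), rfl⟩, rfl, rfl, rfl, rfl, (one_lt_inv₀ hm0).2 hm1, hk⟩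

theorem isOpen_skewFr : IsOpen SkewFr := by
  have : SkewFr = ⋂ i : Fin 6, ⋂ j : Fin 6, ⋂ _ : i ≠ j, {x : Fr | br (x i) (x j) ≠ 0} := by
    ext x
    simp [SkewFr]
  rw [this]
  refine isOpen_iInter_of_finite fun i => isOpen_iInter_of_finite fun j =>
    isOpen_iInter_of_finite fun _ => isOpen_ne.preimage ?_
  exact continuous_br.comp (f := fun x : Fr => (x i, x j)) (by fun_prop)

theorem eventually_quadratic_ne_zero (p q : ℝ) :
    ∀ᶠ t in nhdsWithin (0 : ℝ) (Set.Ioi 0), t ^ 2 + p * t + q ≠ 0 := by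
  by_cases hq : q = 0
  · have h1 : ∀ᶠ t in nhdsWithin (0 : ℝ) (Set.Ioi 0), t + p ≠ 0 := by
      by_cases hp : p = 0
      · filter_upwards [self_mem_nhdsWithin] with t ht
        rw [hp, add_zero]
        exact ne_of_gt ht
      · refine nhdsWithin_le_nhds ?_
        exact (continuous_id.add continuous_const).continuousAt.eventually_ne (by simpa using hp)
    filter_upwards [h1, self_mem_nhdsWithin] with t ht ht'
    rw [hq, show t ^ 2 + p * t + 0 = t * (t + p) by ring]
    exact mul_ne_zero (ne_of_gt ht') ht
  · refine nhdsWithin_le_nhds ?_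
    have : Continuous fun t : ℝ => t ^ 2 + p * t + q := by fun_prop
    exact this.continuousAt.eventually_ne (by simpa using hq)

/-- The block of a frame that is the identity for a line attached to a matrix. -/
def odd (x : V4 × V4) : Matrix (Fin 2) (Fin 2) ℝ := !![x.1 1, x.1 3; x.2 1, x.2 3]

theorem exists_odd_ne_zero {x : Fr} (hx : x ∈ SkewFr) : ∃ z, JoinedIn SkewFr x z ∧
    (∀ i, i ≠ 4 → i ≠ 5 → z i = x i) ∧ (odd (z 4)).det ≠ 0 ∧ (odd (z 5)).det ≠ 0 := by
  set d : V4 × V4 := (![0, 1, 0, 0], ![0, 0, 0, 1]) with hd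
  set c : Fr := ![0, 0, 0, 0, d, d] with hc
  have hcont : Continuous fun t : ℝ => x + t • c := by fun_prop
  have hopen : ∀ᶠ t in nhds (0 : ℝ), x + t • c ∈ SkewFr :=
    hcont.continuousAt.eventually_mem (isOpen_skewFr.mem_nhds (by simpa using hx))
  obtain ⟨δ, hδ, hball⟩ := Metric.eventually_nhds_iff.1 hopen
  have hodd : ∀ y : V4 × V4, ∀ᶠ t in nhdsWithin (0 : ℝ) (Set.Ioi 0), (odd (y + t • d)).det ≠ 0 := by
    intro y
    filter_upwards [eventually_quadratic_ne_zero (y.1 1 + y.2 3) (y.1 1 * y.2 3 - y.1 3 * y.2 1)]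
      with t ht
    convert ht using 1
    simp [odd, hd, Matrix.det_fin_two_of]
    ring
  obtain ⟨t, ⟨⟨h4, h5⟩, ht⟩, ht0⟩ := (((hodd (x 4)).and (hodd (x 5))).and
    ((Ioo_mem_nhdsGT hδ))).and self_mem_nhdsWithin |>.exists
  refine ⟨x + t • c, ?_, ?_, h4, h5⟩
  · have hseg : JoinedIn (Set.Icc (0:ℝ) t) 0 t :=
      JoinedIn.of_segment_subset (by rw [segment_eq_Icc ht.1.le])
    have := (hseg.map hcont).mono (V := SkewFr) (by
      rintro _ ⟨s, hs, rfl⟩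
      refine hball ?_
      rw [Real.dist_eq, sub_zero, abs_of_nonneg hs.1]
      exact lt_of_le_of_lt hs.2 ht.2)
    simpa using this
  · intro i h4 h5
    fin_cases i <;> first
      | exact absurd rfl h4
      | exact absurd rfl h5
      | simp [hc]

theorem eq_act_lineQ {x : V4 × V4} (h : (odd x).det ≠ 0) : ∃ Q, x = act (odd x) (lineQ Q) := by
  refine ⟨(odd x)⁻¹ * !![x.1 0, x.1 2; x.2 0, x.2 2], ?_⟩
  set Q := (odd x)⁻¹ * !![x.1 0, x.1 2; x.2 0, x.2 2] with hQ
  have h1 : odd x * Q = !![x.1 0, x.1 2; x.2 0, x.2 2] := by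
    rw [hQ, ← Matrix.mul_assoc, Matrix.mul_nonsing_inv _ (isUnit_iff_ne_zero.2 h), Matrix.one_mul]
  have e := fun i j => congrFun (congrFun h1 i) j
  simp only [Matrix.mul_apply, Fin.sum_univ_two] at e
  have e00 := e 0 0
  have e01 := e 0 1
  have e10 := e 1 0
  have e11 := e 1 1
  simp [odd] at e00 e01 e10 e11
  ext i <;> fin_cases i <;> simp [act, lineQ, odd] <;> linarith

/-- The diagonal transformation changing the sign of the matrices of a normal form. -/
def negA : Matrix (Fin 4) (Fin 4) ℝ := !![-1, 0, 0, 0; 0, 1, 0, 0; 0, 0, -1, 0; 0, 0, 0, 1]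

theorem mapP_negA (a b c d a' b' c' d' : ℝ) : mapP negA (![a, b, c, d], ![a', b', c', d']) =
    (![-a, b, -c, d], ![-a', b', -c', d']) := by
  ext i <;> fin_cases i <;> simp [mapP, negA]

theorem act_neg (a b c d a' b' c' d' : ℝ) :
    act !![-1, 0; 0, 1] (![a, b, c, d], ![a', b', c', d']) =
      (![-a, -b, -c, -d], ![a', b', c', d']) := by
  ext i <;> fin_cases i <;> simp [act]

theorem nf_neg {l k : ℝ} {Q R : Matrix (Fin 2) (Fin 2) ℝ} (h : nf (l, k, Q, R) ∈ SkewFr) :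
    FrEquiv (nf (l, k, Q, R)) (nf (l, k, -Q, -R)) := by
  have hd : 0 < negA.det := by
    simp [negA, Matrix.det_succ_row_zero, Fin.sum_univ_succ, Fin.succAbove]
  set r : Matrix (Fin 2) (Fin 2) ℝ := !![-1, 0; 0, 1] with hr
  have hrd : r.det ≠ 0 := by simp [hr, Matrix.det_fin_two_of]
  have h1 : (1 : Matrix (Fin 2) (Fin 2) ℝ).det ≠ 0 := by simp
  have hQ : ∀ Q, mapP negA (lineQ Q) = act 1 (lineQ (-Q)) := fun Q => by
    rw [lineQ, mapP_negA, act_one, lineQ]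
    simp
  refine FrEquiv.of_eq h hd (g := ![r, r, r, r, 1, 1]) ?_ ?_
  · intro i
    fin_cases i
    exacts [hrd, hrd, hrd, hrd, h1, h1]
  · have e : ∀ a b c d : ℝ, mapP negA (![a, 0, b, 0], ![0, c, 0, d]) =
        act r (![a, 0, b, 0], ![0, c, 0, d]) := fun a b c d => by
      rw [mapP_negA, hr, act_neg]
      simp
    intro i
    fin_cases i
    exacts [e 1 0 1 0, e 0 1 0 1, e 1 1 1 1, e l 1 1 k, hQ Q, hQ R]

theorem mem_reg_neg {e f : Fin 4 → ℝ} {s l k : ℝ} {Q R : Matrix (Fin 2) (Fin 2) ℝ}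
    (h : (l, k, Q, R) ∈ Reg e f s) : (l, k, -Q, -R) ∈ Reg (-e) (-f) s := by
  obtain ⟨h1, h2, h3, h4, h5⟩ := h
  refine ⟨h1, h2, fun i => ?_, fun i => ?_, ?_⟩
  · have := h3 i
    simp only [el_neg, Pi.neg_apply] at this ⊢
    linarith
  · have := h4 i
    simp only [el_neg, Pi.neg_apply] at this ⊢
    linarith
  · have e1 : -Q - -R = -(Q - R) := by abel
    have e2 : (-(Q - R)).det = (Q - R).det := by rw [Matrix.det_neg]; simp
    show 0 < s * (-Q - -R).det
    rw [e1, e2]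
    exact h5

theorem Pat.mem_reg {S : Fin 6 → Fin 6 → ℝ} {p : Par} (h : Pat S (nf p)) (hl : 1 < p.1)
    (hk : 1 < p.2.1) {e f : Fin 4 → ℝ} {s a b : ℝ}
    (he : ∀ i : Fin 4, S (i.castLE (by norm_num)) 4 = a * e i) (ha : 0 < a)
    (hf : ∀ i : Fin 4, S (i.castLE (by norm_num)) 5 = b * f i) (hb : 0 < b)
    (hs : S 4 5 = -(a * b * s)) : p ∈ Reg e f s := by
  refine ⟨hl, hk, fun i => ?_, fun i => ?_, ?_⟩
  · have := h (i.castLE (by norm_num)) 4 (by revert i; decide)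
    rw [br_nf_four, he, mul_assoc] at this
    exact pos_of_mul_pos_right this ha.le
  · have := h (i.castLE (by norm_num)) 5 (by revert i; decide)
    rw [br_nf_five, hf, mul_assoc] at this
    exact pos_of_mul_pos_right this hb.le
  · have := h 4 5 (by decide)
    rw [br_nf_four_five, hs, neg_mul_neg, mul_assoc] at this
    exact pos_of_mul_pos_right this (mul_pos ha hb).le

/-- Every system of six frames with a suitable pattern of signs is equivalent to one in
normal form. -/
theorem Pat.exists_nf {S : Fin 6 → Fin 6 → ℝ} {x : Fr} (h : Pat S x) (h01 : 0 < S 0 1)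
    (h02 : 0 < S 0 2) (h03 : 0 < S 0 3) (h12 : 0 < S 1 2) (h13 : 0 < S 1 3) (h23 : S 2 3 < 0)
    {e f : Fin 4 → ℝ} {s : ℝ} (he : ∀ i : Fin 4, S (i.castLE (by norm_num)) 4 = e i)
    (hf : ∀ i : Fin 4, S (i.castLE (by norm_num)) 5 = f i) (hs : S 4 5 = s) :
    ∃ p, FrEquiv x (nf p) ∧ (p ∈ Reg e f (-s) ∨ p ∈ Reg e (-f) s) := by
  obtain ⟨y, hxy, hy, hy0, hy1⟩ := exists_first_two h h01
  obtain ⟨z, l, k, hyz, hz, hz0, hz1, hz2, hz3, hl, hk⟩ :=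
    exists_first_four hy hy0 hy1 h02 h03 h12 h13 h23
  obtain ⟨w, hzw, hwz, h4, h5⟩ := exists_odd_ne_zero hz.mem
  have hw : Pat S w := hz.joinedIn hzw
  obtain ⟨Q, hQ⟩ := eq_act_lineQ h4
  obtain ⟨R, hR⟩ := eq_act_lineQ h5
  set a := (odd (w 4)).det with ha
  set b := (odd (w 5)).det with hb
  set g : Fin 6 → Matrix (Fin 2) (Fin 2) ℝ := ![1, 1, 1, 1, odd (w 4), odd (w 5)] with hg
  have h1 : (1 : Matrix (Fin 2) (Fin 2) ℝ).det = 1 := by simp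
  have hgd : ∀ i, (g i).det ≠ 0 := by
    have h1 : (1 : Matrix (Fin 2) (Fin 2) ℝ).det ≠ 0 := by simp
    intro i
    fin_cases i
    exacts [h1, h1, h1, h1, h4, h5]
  have key : ∀ i, mapP 1 (w i) = act (g i) (nf (l, k, Q, R) i) := by
    have e0 : w 0 = act 1 (nf (l, k, Q, R) 0) := by
      rw [act_one, hwz 0 (by decide) (by decide), hz0]
      ext i <;> fin_cases i <;> simp [fr, nf]
    have e1 : w 1 = act 1 (nf (l, k, Q, R) 1) := by
      rw [act_one, hwz 1 (by decide) (by decide), hz1]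
      ext i <;> fin_cases i <;> simp [fr, nf]
    have e2 : w 2 = act 1 (nf (l, k, Q, R) 2) := by
      rw [act_one, hwz 2 (by decide) (by decide), hz2]
      ext i <;> fin_cases i <;> simp [fr, nf]
    have e3 : w 3 = act 1 (nf (l, k, Q, R) 3) := by
      rw [act_one, hwz 3 (by decide) (by decide), hz3]
      ext i <;> fin_cases i <;> simp [fr, nf]
    intro i
    rw [mapP_one]
    fin_cases i
    exacts [e0, e1, e2, e3, hQ, hR]
  have hxn : FrEquiv x (nf (l, k, Q, R)) := hxy.trans (hyz.trans (hzw.frEquiv.trans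
    (FrEquiv.of_eq hw.mem (by simp) hgd key)))
  have hp := hw.of_eq (by simp) hgd key
  have hn := hxn.trans (nf_neg hxn.2.1)
  have c4 : ∀ i : Fin 4, (g (i.castLE (by norm_num))).det * (g 4).det *
      S (i.castLE (by norm_num)) 4 = a * e i := by
    intro i
    have : g (i.castLE (by norm_num)) = 1 := by fin_cases i <;> rfl
    rw [this, he, h1, one_mul]
    rfl
  have c5 : ∀ i : Fin 4, (g (i.castLE (by norm_num))).det * (g 5).det *
      S (i.castLE (by norm_num)) 5 = b * f i := by
    intro i
    have : g (i.castLE (by norm_num)) = 1 := by fin_cases i <;> rfl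
    rw [this, hf, h1, one_mul]
    rfl
  have c45 : (g 4).det * (g 5).det * S 4 5 = a * b * s := by rw [hs]; rfl
  rcases lt_or_gt_of_ne h4 with ha' | ha' <;> rcases lt_or_gt_of_ne h5 with hb' | hb'
  · refine ⟨_, hn, Or.inl ?_⟩
    have := mem_reg_neg (hp.mem_reg (e := -e) (f := -f) (s := -s) (a := -a) (b := -b) hl hk
      (fun i => (c4 i).trans (by simp)) (neg_pos.2 ha') (fun i => (c5 i).trans (by simp))
      (neg_pos.2 hb') (c45.trans (by ring)))
    simpa using this
  · refine ⟨_, hn, Or.inr ?_⟩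
    have := mem_reg_neg (hp.mem_reg (e := -e) (f := f) (s := s) (a := -a) (b := b) hl hk
      (fun i => (c4 i).trans (by simp)) (neg_pos.2 ha') c5 hb' (c45.trans (by ring)))
    simpa using this
  · exact ⟨_, hxn, Or.inr (hp.mem_reg (e := e) (f := -f) (s := s) (a := a) (b := -b) hl hk
      c4 ha' (fun i => (c5 i).trans (by simp)) (neg_pos.2 hb') (c45.trans (by ring)))⟩
  · exact ⟨_, hxn, Or.inl (hp.mem_reg (e := e) (f := f) (s := -s) (a := a) (b := b) hl hk
      c4 ha' c5 hb' (c45.trans (by ring)))⟩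

/-! ### Representatives of the normal forms -/

/-- The matrix of signs of the brackets of a normal form. -/
def pat {R : Type*} [Zero R] [One R] [Neg R] (e f : Fin 4 → R) (s : R) :
    Matrix (Fin 6) (Fin 6) R :=
  !![0, 1, 1, 1, e 0, f 0; 1, 0, 1, 1, e 1, f 1; 1, 1, 0, -1, e 2, f 2; 1, 1, -1, 0, e 3, f 3;
     e 0, e 1, e 2, e 3, 0, s; f 0, f 1, f 2, f 3, s, 0]

theorem Pat.exists_nf_of_pat {e f : Fin 4 → ℝ} {s : ℝ} {x : Fr} (h : Pat (pat e f s) x) :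
    ∃ p, FrEquiv x (nf p) ∧ (p ∈ Reg e f (-s) ∨ p ∈ Reg e (-f) s) := by
  refine h.exists_nf ?_ ?_ ?_ ?_ ?_ ?_ (e := e) (f := f) (s := s) (fun i => ?_) (fun i => ?_) rfl
  · exact one_pos
  · exact one_pos
  · exact one_pos
  · exact one_pos
  · exact one_pos
  · exact neg_one_lt_zero
  · fin_cases i <;> rfl
  · fin_cases i <;> rfl

theorem pat_symm {R : Type*} [Zero R] [One R] [Neg R] (e f : Fin 4 → R) (s : R) (i j : Fin 6) :
    pat e f s i j = pat e f s j i := by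
  fin_cases i <;> fin_cases j <;> rfl

theorem Pat.of_lt {S : Fin 6 → Fin 6 → ℝ} {x : Fr} (hS : ∀ i j, S i j = S j i)
    (h : ∀ i j, i < j → 0 < S i j * br (x i) (x j)) : Pat S x := by
  intro i j hij
  rcases lt_or_gt_of_ne hij with hlt | hlt
  · exact h i j hlt
  · rw [hS, br_comm]
    exact h j i hlt

theorem pat_nf {e f : Fin 4 → ℝ} {s : ℝ} {p : Par} (hp : p ∈ Reg e f s) :
    Pat (pat e f (-s)) (nf p) := by
  obtain ⟨hl, hk, he, hf, hs⟩ := hp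
  obtain ⟨h01, h02, h12, h03, h13, h23⟩ := br_nf p
  have h4 := br_nf_four p
  have h5 := br_nf_five p
  have h45 := br_nf_four_five p
  refine Pat.of_lt (pat_symm e f (-s)) (forall_lt_six ?_ ?_ ?_ ?_ ?_ ?_ ?_ ?_ ?_ ?_ ?_ ?_ ?_ ?_ ?_)
  · show 0 < (1 : ℝ) * _
    rw [h01]; norm_num
  · show 0 < (1 : ℝ) * _
    rw [h02]; norm_num
  · show 0 < (1 : ℝ) * _
    rw [h03]; linarith
  · show 0 < e 0 * _
    exact (h4 0).symm ▸ he 0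
  · show 0 < f 0 * _
    exact (h5 0).symm ▸ hf 0
  · show 0 < (1 : ℝ) * _
    rw [h12]; norm_num
  · show 0 < (1 : ℝ) * _
    rw [h13]; linarith
  · show 0 < e 1 * _
    exact (h4 1).symm ▸ he 1
  · show 0 < f 1 * _
    exact (h5 1).symm ▸ hf 1
  · show 0 < (-1 : ℝ) * _
    rw [h23]; nlinarith
  · show 0 < e 2 * _
    exact (h4 2).symm ▸ he 2
  · show 0 < f 2 * _
    exact (h5 2).symm ▸ hf 2
  · show 0 < e 3 * _
    exact (h4 3).symm ▸ he 3
  · show 0 < f 3 * _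
    exact (h5 3).symm ▸ hf 3
  · show 0 < -s * _
    rw [h45]; linarith

/-- All systems with the pattern of a normal form of twin type are equivalent. -/
theorem Pat.equiv_twin {e : Fin 4 → ℝ} {s : ℝ} (he : ∀ i, e i = 1 ∨ e i = -1)
    (h : ConeMeets e s) {x : Fr} (hx : Pat (pat e e s) x) {q : Par} (hq : q ∈ Reg e e (-s)) :
    FrEquiv x (nf q) := by
  obtain ⟨p, hxp, hp⟩ := hx.exists_nf_of_pat
  exact hxp.trans (nf_equiv_twin_or he h hp hq)

theorem det_sub_inv_smul {Q A : Matrix (Fin 2) (Fin 2) ℝ} (hA : A.det ≠ 0) :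
    (Q - A.det⁻¹ • A).det = A.det⁻¹ * mix Q A := by
  have h : A.det⁻¹ * A.det = 1 := inv_mul_cancel₀ hA
  generalize A.det⁻¹ = r at h ⊢
  have e : (Q - r • A).det = Q.det - r * (Q 0 0 * A 1 1 - Q 0 1 * A 1 0 - Q 1 0 * A 0 1 +
      Q 1 1 * A 0 0) + r * (r * A.det) := by
    simp [Matrix.det_fin_two]
    ring
  rw [e, h, mix]
  linear_combination (-Q.det) * h

theorem crossing_mem_pos {l k : ℝ} {Q A : Matrix (Fin 2) (Fin 2) ℝ} (hl : 1 < l) (hk : 1 < k)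
    {e f : Fin 4 → ℝ} {s : ℝ} (hQ : ∀ i, 0 < e i * el l k Q i) (hA : ∀ i, 0 < f i * el l k A i)
    (hd : 0 < A.det) (hm : 0 < s * mix Q A) : (l, k, Q, A.det⁻¹ • A) ∈ Reg e f s := by
  have hd' := inv_pos.2 hd
  refine ⟨hl, hk, hQ, fun i => ?_, ?_⟩
  · show 0 < f i * el l k (A.det⁻¹ • A) i
    rw [el_smul]
    have := mul_pos hd' (hA i)
    linarith
  · show 0 < s * (Q - A.det⁻¹ • A).det
    rw [det_sub_inv_smul hd.ne']
    have := mul_pos hd' hm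
    linarith

theorem crossing_mem_neg {l k : ℝ} {Q A : Matrix (Fin 2) (Fin 2) ℝ} (hl : 1 < l) (hk : 1 < k)
    {e f : Fin 4 → ℝ} {s : ℝ} (hQ : ∀ i, 0 < e i * el l k Q i) (hA : ∀ i, 0 < f i * el l k A i)
    (hd : A.det < 0) (hm : 0 < s * mix Q A) : (l, k, Q, A.det⁻¹ • A) ∈ Reg e (-f) (-s) := by
  have hd' := inv_lt_zero.2 hd
  refine ⟨hl, hk, hQ, fun i => ?_, ?_⟩
  · show 0 < (-f i) * el l k (A.det⁻¹ • A) i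
    rw [el_smul]
    have := mul_pos (neg_pos.2 hd') (hA i)
    linarith
  · show 0 < -s * (Q - A.det⁻¹ • A).det
    rw [det_sub_inv_smul hd.ne]
    have := mul_pos (neg_pos.2 hd') hm
    linarith

theorem nf_equiv_of_crossing {l k : ℝ} {Q A B : Matrix (Fin 2) (Fin 2) ℝ} (hl : 1 < l) (hk : 1 < k)
    {e f : Fin 4 → ℝ} {s : ℝ} (hQ : ∀ i, 0 < e i * el l k Q i) (hA : ∀ i, 0 < f i * el l k A i)
    (hB : ∀ i, 0 < f i * el l k B i) (dA : 0 < A.det) (dB : B.det < 0)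
    (mA : 0 < s * mix Q A) (mB : 0 < s * mix Q B)
    (hm : 0 ≤ s * (mix Q (A + B) - Q.det * (A.det + B.det) + 1)) :
    FrEquiv (nf (l, k, Q, A.det⁻¹ • A)) (nf (l, k, Q, B.det⁻¹ • B)) := by
  refine nf_equiv_of_segment hl hk (fun i => right_ne_zero_of_mul (hQ i).ne') hA hB ?_ dA.ne' dB.ne
  intro a b ha hb hab h0
  have key : mix Q (a • A + b • B) = a ^ 2 * mix Q A + b ^ 2 * mix Q B +
      a * b * (mix Q (A + B) - Q.det * (A.det + B.det) + 1) := by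
    obtain rfl : b = 1 - a := by linarith
    simp [mix, Matrix.det_fin_two]
    ring
  have h1 : 0 < a ^ 2 * (s * mix Q A) + b ^ 2 * (s * mix Q B) := by
    rcases ha.eq_or_lt with rfl | ha'
    · have : b = 1 := by linarith
      rw [this]; linarith
    · have := mul_pos (pow_pos ha' 2) mA
      have := mul_nonneg (pow_nonneg hb 2) mB.le
      linarith
  have h2 := mul_nonneg (mul_nonneg ha hb) hm
  have h3 : s * mix Q (a • A + b • B) = 0 := by rw [h0, mul_zero]
  rw [key] at h3
  linarith

theorem sign_pppp : ∀ i, (![1, 1, 1, 1] : Fin 4 → ℝ) i = 1 ∨ (![1, 1, 1, 1] : Fin 4 → ℝ) i = -1 := by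
  intro i; fin_cases i <;> simp

theorem sign_pppn : ∀ i, (![1, 1, 1, -1] : Fin 4 → ℝ) i = 1 ∨
    (![1, 1, 1, -1] : Fin 4 → ℝ) i = -1 := by
  intro i; fin_cases i <;> simp

theorem sign_pnpn : ∀ i, (![1, -1, 1, -1] : Fin 4 → ℝ) i = 1 ∨
    (![1, -1, 1, -1] : Fin 4 → ℝ) i = -1 := by
  intro i; fin_cases i <;> simp

theorem sign_ppnn : ∀ i, (![1, 1, -1, -1] : Fin 4 → ℝ) i = 1 ∨
    (![1, 1, -1, -1] : Fin 4 → ℝ) i = -1 := by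
  intro i; fin_cases i <;> simp

theorem sign_pnnp : ∀ i, (![1, -1, -1, 1] : Fin 4 → ℝ) i = 1 ∨
    (![1, -1, -1, 1] : Fin 4 → ℝ) i = -1 := by
  intro i; fin_cases i <;> simp

theorem sign_ppnp : ∀ i, (![1, 1, -1, 1] : Fin 4 → ℝ) i = 1 ∨
    (![1, 1, -1, 1] : Fin 4 → ℝ) i = -1 := by
  intro i; fin_cases i <;> simp

theorem neg_sign {f : Fin 4 → ℝ} (h : ∀ i, f i = 1 ∨ f i = -1) :
    ∀ i, (-f) i = 1 ∨ (-f) i = -1 := by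
  intro i
  rcases h i with h | h <;> simp [h]

theorem pppp_mem : ((2, 2, !![-4, 2; -2, 2], !![-2, 1; -1, 1]) : Par) ∈
    Reg ![1, 1, 1, 1] ![1, 1, 1, 1] (-1) := by
  refine ⟨by norm_num, by norm_num, fun i => ?_, fun i => ?_, by norm_num [Matrix.det_fin_two]⟩ <;>
  fin_cases i <;> norm_num [el]

theorem pppp_mem' : ((2, 2, !![0, 2; -2, 0], !![0, 1; -1, 0]) : Par) ∈
    Reg ![1, 1, 1, 1] ![1, 1, 1, 1] (- -1) := by
  refine ⟨by norm_num, by norm_num, fun i => ?_, fun i => ?_, by norm_num [Matrix.det_fin_two]⟩ <;>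
  fin_cases i <;> norm_num [el]

theorem pppn_mem : ((2, 2, !![2, 4; -(1 / 2), -2], !![1, 2; -(1 / 4), -1]) : Par) ∈
    Reg ![1, 1, 1, -1] ![1, 1, 1, -1] (-1) := by
  refine ⟨by norm_num, by norm_num, fun i => ?_, fun i => ?_, by norm_num [Matrix.det_fin_two]⟩ <;>
  fin_cases i <;> norm_num [el]

theorem pppn_mem' : ((2, 2, !![-5, 3 / 8; -(3 / 8), -2], !![-(5 / 2), 3 / 16; -(3 / 16), -1]) : Par) ∈
    Reg ![1, 1, 1, -1] ![1, 1, 1, -1] (- -1) := by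
  refine ⟨by norm_num, by norm_num, fun i => ?_, fun i => ?_, by norm_num [Matrix.det_fin_two]⟩ <;>
  fin_cases i <;> norm_num [el]

theorem pnpn_mem : ((2, 2, !![2, 5; 1 / 2, -2], !![1, 5 / 2; 1 / 4, -1]) : Par) ∈
    Reg ![1, -1, 1, -1] ![1, -1, 1, -1] (-1) := by
  refine ⟨by norm_num, by norm_num, fun i => ?_, fun i => ?_, by norm_num [Matrix.det_fin_two]⟩ <;>
  fin_cases i <;> norm_num [el]

/-- Types in which two lines have complementary signs and the two pieces are connected. -/
theorem exists_equiv_pppp_ppnn : ∃ p : Par, Pat (pat ![1, 1, 1, 1] ![1, 1, -1, -1] 1) (nf p) ∧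
    ∀ x, Pat (pat ![1, 1, 1, 1] ![1, 1, -1, -1] 1) x → FrEquiv x (nf p) := by
  have hQ : ∀ i, 0 < (![1, 1, 1, 1] : Fin 4 → ℝ) i * el 2 2 !![-2, 1; -1, 2] i := by
    intro i; fin_cases i <;> norm_num [el]
  have hA : ∀ i, 0 < (![1, 1, -1, -1] : Fin 4 → ℝ) i * el 2 2 !![0, 2; -1, -4] i := by
    intro i; fin_cases i <;> norm_num [el]
  have hB : ∀ i, 0 < (![1, 1, -1, -1] : Fin 4 → ℝ) i * el 2 2 !![2, 1; -4, -4] i := by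
    intro i; fin_cases i <;> norm_num [el]
  have dA : 0 < (!![0, 2; -1, -4] : Matrix (Fin 2) (Fin 2) ℝ).det := by norm_num [Matrix.det_fin_two]
  have dB : (!![2, 1; -4, -4] : Matrix (Fin 2) (Fin 2) ℝ).det < 0 := by norm_num [Matrix.det_fin_two]
  have mA : 0 < (-1 : ℝ) * mix !![-2, 1; -1, 2] !![0, 2; -1, -4] := by
    norm_num [Matrix.det_fin_two, mix]
  have mB : 0 < (-1 : ℝ) * mix !![-2, 1; -1, 2] !![2, 1; -4, -4] := by
    norm_num [Matrix.det_fin_two, mix]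
  have pA := crossing_mem_pos one_lt_two one_lt_two hQ hA dA mA
  have pB := crossing_mem_neg one_lt_two one_lt_two hQ hB dB mB
  have hAB := nf_equiv_of_crossing one_lt_two one_lt_two hQ hA hB dA dB mA mB
    (by norm_num [Matrix.det_fin_two, mix])
  have hp := pat_nf pA
  rw [neg_neg] at hp
  refine ⟨_, hp, fun x hx => ?_⟩
  obtain ⟨p, hxp, hp | hp⟩ := hx.exists_nf_of_pat
  · exact hxp.trans (nf_equiv_good' sign_pppp sign_ppnn (by simp) (by simp) (by simp) (by simp)
      (by simp) hp pA)
  · refine hxp.trans (FrEquiv.trans ?_ hAB.symm)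
    rw [neg_neg] at pB
    exact nf_equiv_good sign_pppp (neg_sign sign_ppnn) (by simp) (by simp) (by simp) (by simp)
      (by simp) hp pB

theorem exists_equiv_pnpn_pnnp : ∃ p : Par, Pat (pat ![1, -1, 1, -1] ![1, -1, -1, 1] (-1)) (nf p) ∧
    ∀ x, Pat (pat ![1, -1, 1, -1] ![1, -1, -1, 1] (-1)) x → FrEquiv x (nf p) := by
  have hQ : ∀ i, 0 < (![1, -1, 1, -1] : Fin 4 → ℝ) i * el 2 2 !![-3, 1; 2, -1] i := by
    intro i; fin_cases i <;> norm_num [el]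
  have hA : ∀ i, 0 < (![1, -1, -1, 1] : Fin 4 → ℝ) i * el 2 2 !![2, 1; 3, 2] i := by
    intro i; fin_cases i <;> norm_num [el]
  have hB : ∀ i, 0 < (![1, -1, -1, 1] : Fin 4 → ℝ) i * el 2 2 !![4, 4; 3, 2] i := by
    intro i; fin_cases i <;> norm_num [el]
  have dA : 0 < (!![2, 1; 3, 2] : Matrix (Fin 2) (Fin 2) ℝ).det := by norm_num [Matrix.det_fin_two]
  have dB : (!![4, 4; 3, 2] : Matrix (Fin 2) (Fin 2) ℝ).det < 0 := by norm_num [Matrix.det_fin_two]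
  have mA : 0 < (1 : ℝ) * mix !![-3, 1; 2, -1] !![2, 1; 3, 2] := by
    norm_num [Matrix.det_fin_two, mix]
  have mB : 0 < (1 : ℝ) * mix !![-3, 1; 2, -1] !![4, 4; 3, 2] := by
    norm_num [Matrix.det_fin_two, mix]
  have pA := crossing_mem_pos one_lt_two one_lt_two hQ hA dA mA
  have pB := crossing_mem_neg one_lt_two one_lt_two hQ hB dB mB
  have hAB := nf_equiv_of_crossing one_lt_two one_lt_two hQ hA hB dA dB mA mB
    (by norm_num [Matrix.det_fin_two, mix])
  refine ⟨_, pat_nf pA, fun x hx => ?_⟩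
  obtain ⟨p, hxp, hp | hp⟩ := hx.exists_nf_of_pat
  · rw [neg_neg] at hp
    exact hxp.trans (nf_equiv_good' sign_pnpn sign_pnnp (by simp) (by simp) (by simp) (by simp)
      (by simp) hp pA)
  · exact hxp.trans ((nf_equiv_good sign_pnpn (neg_sign sign_pnnp) (by simp) (by simp) (by simp)
      (by simp) (by simp) hp pB).trans hAB.symm)

/-- The representative of the first of two classes with the same pattern. -/
noncomputable def parJ : Par := (2, 2, !![-1, 1; -4, -4], (!![5, 1; -2, 1] : Matrix (Fin 2) (Fin 2) ℝ).det⁻¹ •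
  !![5, 1; -2, 1])

theorem exists_equiv_pppn_ppnp : Pat (pat ![1, 1, 1, -1] ![1, 1, -1, 1] (-1)) (nf parJ) ∧
    ∀ x, Pat (pat ![1, 1, 1, -1] ![1, 1, -1, 1] (-1)) x → FrEquiv x (nf parJ) ∨
      ∃ p ∈ Reg ![1, 1, 1, -1] (-![1, 1, -1, 1]) (-1), FrEquiv x (nf p) ∧
        (p.2.2.1 - p.2.2.2) 0 0 < 0 := by
  have hQ : ∀ i, 0 < (![1, 1, 1, -1] : Fin 4 → ℝ) i * el 2 2 !![-1, 1; -4, -4] i := by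
    intro i; fin_cases i <;> norm_num [el]
  have hA : ∀ i, 0 < (![1, 1, -1, 1] : Fin 4 → ℝ) i * el 2 2 !![5, 1; -2, 1] i := by
    intro i; fin_cases i <;> norm_num [el]
  have hB : ∀ i, 0 < (![1, 1, -1, 1] : Fin 4 → ℝ) i * el 2 2 !![5, 1; -4, -1] i := by
    intro i; fin_cases i <;> norm_num [el]
  have dA : 0 < (!![5, 1; -2, 1] : Matrix (Fin 2) (Fin 2) ℝ).det := by norm_num [Matrix.det_fin_two]
  have dB : (!![5, 1; -4, -1] : Matrix (Fin 2) (Fin 2) ℝ).det < 0 := by norm_num [Matrix.det_fin_two]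
  have mA : 0 < (1 : ℝ) * mix !![-1, 1; -4, -4] !![5, 1; -2, 1] := by
    norm_num [Matrix.det_fin_two, mix]
  have mB : 0 < (1 : ℝ) * mix !![-1, 1; -4, -4] !![5, 1; -4, -1] := by
    norm_num [Matrix.det_fin_two, mix]
  have pA := crossing_mem_pos one_lt_two one_lt_two hQ hA dA mA
  have pB := crossing_mem_neg one_lt_two one_lt_two hQ hB dB mB
  have hAB := nf_equiv_of_crossing one_lt_two one_lt_two hQ hA hB dA dB mA mB
    (by norm_num [Matrix.det_fin_two, mix])
  refine ⟨pat_nf pA, fun x hx => ?_⟩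
  obtain ⟨p, hxp, hp | hp⟩ := hx.exists_nf_of_pat
  · rw [neg_neg] at hp
    exact Or.inl (hxp.trans (nf_equiv_good' sign_pppn sign_ppnp (by simp) (by simp) (by simp)
      (by simp) (by simp) hp pA))
  · obtain ⟨hd, h01, h10⟩ := diff_mem (by simp) (by simp) hp
    rcases lt_trichotomy ((p.2.2.1 - p.2.2.2) 0 0) 0 with h | h | h
    · exact Or.inr ⟨p, hp, hxp, h⟩
    · exfalso
      have h2 := hp.2.2.2.2
      rw [Matrix.det_fin_two, h] at h2
      norm_num at h01 h10
      have := mul_pos (sub_pos.2 h01) (sub_pos.2 h10)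
      norm_num at h2
      nlinarith
    · refine Or.inl (hxp.trans (FrEquiv.trans ?_ hAB.symm))
      refine nf_equiv_bad sign_pppn (neg_sign sign_ppnp) (by simp) (by simp) (by simp) (by simp)
        (by simp) hp pB (mul_pos h ?_)
      norm_num [Matrix.det_fin_two]

/-! ### Mirror images and the type with two mirror symmetric classes -/

/-- A reflection. -/
def mirA : Matrix (Fin 4) (Fin 4) ℝ := !![-1, 0, 0, 0; 0, 1, 0, 0; 0, 0, 1, 0; 0, 0, 0, 1]

theorem det_mirA : mirA.det = -1 := by
  simp [mirA, Matrix.det_succ_row_zero, Fin.sum_univ_succ, Fin.succAbove]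

/-- The mirror image of a system of frames. -/
noncomputable def mirror (x : Fr) : Fr := fun i => mapP mirA (x i)

theorem mirror_mirror (x : Fr) : mirror (mirror x) = x := by
  funext i
  have h : ∀ u : V4 × V4, mapP mirA (mapP mirA u) = u := by
    rintro ⟨v, w⟩
    ext i <;> fin_cases i <;> simp [mapP, mirA] <;> rfl
  exact h (x i)

theorem br_mirror (x : Fr) (i j : Fin 6) : br (mirror x i) (mirror x j) = -br (x i) (x j) := by
  simp only [mirror]
  rw [br_mapP, det_mirA, neg_one_mul]

theorem mirror_mem {x : Fr} (hx : x ∈ SkewFr) : mirror x ∈ SkewFr :=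
  mapP_mem hx (by rw [det_mirA]; norm_num)

theorem FrEquiv.mirror {x y : Fr} (h : FrEquiv x y) : FrEquiv (mirror x) (mirror y) :=
  h.map (by rw [det_mirA]; norm_num)

theorem swapQ_swapQ (l k : ℝ) (Q : Matrix (Fin 2) (Fin 2) ℝ) :
    swapQ l k (swapQ l k Q) = -(k * (l - 1) * (k - 1)) • Q := by
  ext i j
  fin_cases i <;> fin_cases j <;> simp [swapQ] <;> ring

theorem nf_comp_swap (l k : ℝ) (Q R : Matrix (Fin 2) (Fin 2) ℝ) :
    nf (l, k, Q, R) ∘ Equiv.swap 4 5 = nf (l, k, R, Q) := by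
  funext i
  fin_cases i <;> rfl

theorem nf_equiv_comp_swap {l k : ℝ} {Q R : Matrix (Fin 2) (Fin 2) ℝ}
    (h : nf (l, k, Q, R) ∈ SkewFr) : FrEquiv (nf (l, k, Q, R)) (nf (l, k, R, Q)) := by
  have := FrEquiv.of_comp h (Equiv.swap 4 5)
  rwa [nf_comp_swap] at this

theorem reg_comm {e f : Fin 4 → ℝ} {s l k : ℝ} {Q R : Matrix (Fin 2) (Fin 2) ℝ}
    (h : (l, k, Q, R) ∈ Reg e f s) : (l, k, R, Q) ∈ Reg f e s := by
  obtain ⟨hl, hk, he, hf, hs⟩ := h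
  refine ⟨hl, hk, hf, he, ?_⟩
  rw [← neg_sub, Matrix.det_neg]
  simpa using hs

theorem nf_equiv_mirror_of_swapPar {p : Par} {e f : Fin 4 → ℝ} {s : ℝ} (hp : p ∈ Reg e f s) {z : Fr}
    (h : FrEquiv (nf (swapPar p)) z) : FrEquiv (nf p) (mirror z) := by
  have hz : mirror z ∈ SkewFr := mirror_mem h.2.1
  have hl' : 0 < p.1 - 1 := by linarith [hp.1]
  have hk' : 0 < p.2.1 - 1 := by linarith [hp.2.1]
  have hk0 : 0 < p.2.1 := by linarith [hp.2.1]
  have neg : (swapA p.1 p.2.1).det < 0 := by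
    rw [det_swapA, neg_lt_zero]
    positivity
  refine FrEquiv.of_map_neg neg (B := mirA) (by rw [det_mirA]; norm_num) ?_ hz
  show FrEquiv _ (mirror (mirror z))
  rw [mirror_mirror]
  exact (nf_swap hp).trans h

theorem swap_diff_ne_zero {e f : Fin 4 → ℝ} {s : ℝ} {p : Par} (h0 : e 0 = -f 0) (h1 : e 1 = -f 1)
    (hs : s = -(e 0 * e 1)) (hp : p ∈ Reg e f s) : (p.2.2.1 - p.2.2.2) 0 0 ≠ 0 := by
  intro h
  obtain ⟨hd, h01, h10⟩ := diff_mem h0 h1 hp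
  have h2 := hp.2.2.2.2
  rw [Matrix.det_fin_two, h, hs] at h2
  have := mul_pos h01 h10
  linarith

/-- Parameters of a representative of the type with two mirror symmetric classes. -/
noncomputable def parM : Par := (2, 2, !![-(1 / 3), 1 / 2; 1 / 2, -(1 / 6)],
  (!![0, -(1 / 6); -(2 / 3), -(1 / 3)] : Matrix (Fin 2) (Fin 2) ℝ).det⁻¹ •
    !![0, -(1 / 6); -(2 / 3), -(1 / 3)])

theorem exists_equiv_mirror_parM : Pat (pat ![1, -1, 1, -1] ![1, -1, -1, 1] 1) (nf parM) ∧
    ∀ x, Pat (pat ![1, -1, 1, -1] ![1, -1, -1, 1] 1) x → FrEquiv x (nf parM) ∨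
      FrEquiv x (mirror (nf parM)) := by
  have hf : (-![-1, 1, 1, -1] : Fin 4 → ℝ) = ![1, -1, -1, 1] := by simp
  have hf' : (-![1, -1, -1, 1] : Fin 4 → ℝ) = ![-1, 1, 1, -1] := by simp
  have hQ : ∀ i, 0 < (![1, -1, 1, -1] : Fin 4 → ℝ) i *
      el 2 2 !![-(1 / 3), 1 / 2; 1 / 2, -(1 / 6)] i := by
    intro i; fin_cases i <;> norm_num [el]
  have hA : ∀ i, 0 < (![-1, 1, 1, -1] : Fin 4 → ℝ) i *
      el 2 2 !![-(2 / 3), -(1 / 6); -(1 / 6), -(1 / 3)] i := by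
    intro i; fin_cases i <;> norm_num [el]
  have hB : ∀ i, 0 < (![-1, 1, 1, -1] : Fin 4 → ℝ) i *
      el 2 2 !![0, -(1 / 6); -(2 / 3), -(1 / 3)] i := by
    intro i; fin_cases i <;> norm_num [el]
  have dA : 0 < (!![-(2 / 3), -(1 / 6); -(1 / 6), -(1 / 3)] : Matrix (Fin 2) (Fin 2) ℝ).det := by
    norm_num [Matrix.det_fin_two]
  have dB : (!![0, -(1 / 6); -(2 / 3), -(1 / 3)] : Matrix (Fin 2) (Fin 2) ℝ).det < 0 := by
    norm_num [Matrix.det_fin_two]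
  have mA : 0 < (1 : ℝ) * mix !![-(1 / 3), 1 / 2; 1 / 2, -(1 / 6)]
      !![-(2 / 3), -(1 / 6); -(1 / 6), -(1 / 3)] := by
    norm_num [Matrix.det_fin_two, mix]
  have mB : 0 < (1 : ℝ) * mix !![-(1 / 3), 1 / 2; 1 / 2, -(1 / 6)]
      !![0, -(1 / 6); -(2 / 3), -(1 / 3)] := by
    norm_num [Matrix.det_fin_two, mix]
  have pA := crossing_mem_pos one_lt_two one_lt_two hQ hA dA mA
  have pB : parM ∈ _ := crossing_mem_neg one_lt_two one_lt_two hQ hB dB mB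
  have hAB := nf_equiv_of_crossing one_lt_two one_lt_two hQ hA hB dA dB mA mB
    (by norm_num [Matrix.det_fin_two, mix])
  have pat_parM := pat_nf pB
  rw [hf, neg_neg] at pat_parM
  have h34 : ∀ q ∈ Reg ![1, -1, 1, -1] ![1, -1, -1, 1] (-1),
      0 < ((swapPar q).2.2.1 - (swapPar q).2.2.2) 0 0 → FrEquiv (nf q) (nf parM) := by
    intro q hq h
    rw [hf] at pB
    refine nf_equiv_bad' sign_pnpn sign_pnnp (by simp) (by simp) (by simp) (by simp)
      (by simp) hq pB (mul_pos h ?_)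
    norm_num [swapPar, parM, swapQ, Matrix.det_fin_two]
  have h12 : ∀ p ∈ Reg ![1, -1, 1, -1] ![-1, 1, 1, -1] 1,
      0 < (p.2.2.1 - p.2.2.2) 0 0 → FrEquiv (nf p) (nf parM) := by
    intro p hp h
    refine FrEquiv.trans ?_ hAB
    refine nf_equiv_bad sign_pnpn (hf' ▸ neg_sign sign_pnnp) (by simp) (by simp) (by simp) (by simp)
        (by simp) hp pA (mul_pos h ?_)
    norm_num [Matrix.det_fin_two]
  refine ⟨pat_parM, fun x hx => ?_⟩
  obtain ⟨p, hxp, hp | hp⟩ := hx.exists_nf_of_pat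
  · have hsw := swapPar_mem hp
    rcases (swap_diff_ne_zero (by simp) (by simp) (by simp) hsw).lt_or_gt with h | h
    · refine Or.inr (hxp.trans (nf_equiv_mirror_of_swapPar hp ?_))
      refine (nf_equiv_comp_swap (nf_mem hsw)).trans (h12 _ ?_ ?_)
      · have := reg_comm hsw
        simpa using this
      · rw [← neg_sub]
        exact neg_pos.2 h
    · exact Or.inl (hxp.trans (h34 p hp h))
  · rw [hf'] at hp
    rcases (swap_diff_ne_zero (by simp) (by simp) (by simp) hp).lt_or_gt with h | h
    · refine Or.inr (hxp.trans (nf_equiv_mirror_of_swapPar hp ?_))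
      have hsw := swapPar_mem hp
      have hn := mem_reg_neg hsw
      refine (nf_neg (nf_mem hsw)).trans ((nf_equiv_comp_swap (nf_mem hn)).trans (h34 _ ?_ ?_))
      · have := reg_comm hn
        simpa using this
      · have e : swapQ p.1 p.2.1 (-swapQ p.1 p.2.1 p.2.2.2) - swapQ p.1 p.2.1
            (-swapQ p.1 p.2.1 p.2.2.1) = -(p.2.1 * (p.1 - 1) * (p.2.1 - 1)) •
              (p.2.2.1 - p.2.2.2) := by
          rw [← swapQ_swapQ, swapQ_sub, swapQ_sub, ← swapQ_sub, ← swapQ_sub]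
          congr 1
          abel
        show 0 < (swapQ p.1 p.2.1 (-swapQ p.1 p.2.1 p.2.2.2) - swapQ p.1 p.2.1
            (-swapQ p.1 p.2.1 p.2.2.1)) 0 0
        rw [e, Matrix.smul_apply, smul_eq_mul]
        have hl' : 0 < p.1 - 1 := by linarith [hp.1]
        have hk' : 0 < p.2.1 - 1 := by linarith [hp.2.1]
        have hk0 : 0 < p.2.1 := by linarith [hp.2.1]
        exact mul_pos_of_neg_of_neg (neg_neg_of_pos (by positivity)) h
    · exact Or.inl (hxp.trans (h12 p hp h))

/-! ### Systems all of whose triples are linked in the same way -/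

/-- A system consisting of a line and of graphs of matrices. -/
def graphs (Q : Fin 5 → Matrix (Fin 2) (Fin 2) ℝ) : Fr :=
  Fin.cons (fr 1 0) fun i => fr (Q i) 1

theorem br_fr_graph (P Q : Matrix (Fin 2) (Fin 2) ℝ) : br (fr P 1) (fr Q 1) = (P - Q).det := by
  simp [br_eq, fr, Matrix.det_fin_two]
  ring

theorem graphs_mem {Q : Fin 5 → Matrix (Fin 2) (Fin 2) ℝ}
    (h : ∀ i j, i ≠ j → (Q i - Q j).det ≠ 0) : graphs Q ∈ SkewFr := by
  intro i j hij
  induction i using Fin.cases with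
  | zero =>
    induction j using Fin.cases with
    | zero => exact absurd rfl hij
    | succ j =>
      simp only [graphs, Fin.cons_zero, Fin.cons_succ]
      rw [br_fr_one_zero]; simp
  | succ i =>
    induction j using Fin.cases with
    | zero =>
      simp only [graphs, Fin.cons_zero, Fin.cons_succ]
      rw [br_comm, br_fr_one_zero]; simp
    | succ j =>
      simp only [graphs, Fin.cons_succ]
      rw [br_fr_graph]
      exact h i j fun e => hij (by rw [e])

theorem continuous_graphs : Continuous graphs := by
  refine continuous_pi fun i => ?_
  induction i using Fin.cases with
  | zero => exact continuous_const
  | succ i =>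
    simp only [graphs, Fin.cons_succ, fr]
    refine Continuous.prodMk ?_ ?_ <;> refine continuous_pi fun j => ?_ <;> fin_cases j <;>
      simp <;> fun_prop

theorem graphs_equiv_of_segment {Q R : Fin 5 → Matrix (Fin 2) (Fin 2) ℝ}
    (h : ∀ a b : ℝ, 0 ≤ a → 0 ≤ b → a + b = 1 → ∀ i j, i ≠ j →
      (a • (Q i - Q j) + b • (R i - R j)).det ≠ 0) : FrEquiv (graphs Q) (graphs R) := by
  refine JoinedIn.frEquiv (((JoinedIn.of_segment_subset (s := segment ℝ Q R) subset_rfl).map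
    continuous_graphs).mono ?_)
  rintro _ ⟨C, ⟨a, b, ha, hb, hab, rfl⟩, rfl⟩
  refine graphs_mem fun i j hij => ?_
  have := h a b ha hb hab i j hij
  convert this using 2
  simp only [Pi.add_apply, Pi.smul_apply, smul_sub]
  abel

theorem graphs_comp_equiv {Q : Fin 5 → Matrix (Fin 2) (Fin 2) ℝ} (h : graphs Q ∈ SkewFr)
    (σ : Equiv.Perm (Fin 5)) : FrEquiv (graphs Q) (graphs (Q ∘ σ)) := by
  have h1 := FrEquiv.of_comp h (Equiv.Perm.decomposeFin.symm (0, σ))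
  have h2 : graphs Q ∘ Equiv.Perm.decomposeFin.symm (0, σ) = graphs (Q ∘ σ) := by
    funext i
    induction i using Fin.cases with
    | zero => simp [graphs]
    | succ i => simp [graphs]
  rwa [h2] at h1

/-- The matrix of multiplication by a complex number. -/
def conf (x y : ℝ) : Matrix (Fin 2) (Fin 2) ℝ := !![x, -y; y, x]

theorem det_conf_sub (a b x y x' y' u v u' v' : ℝ) :
    (a • (conf x y - conf x' y') + b • (conf u v - conf u' v')).det =
      (a * (x - x') + b * (u - u')) ^ 2 + (a * (y - y') + b * (v - v')) ^ 2 := by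
  simp [conf, Matrix.det_fin_two]
  ring

theorem graphs_equiv_conf {Q : Fin 5 → Matrix (Fin 2) (Fin 2) ℝ}
    (h : ∀ i j, i ≠ j → 0 < (Q i - Q j).det) : FrEquiv (graphs Q)
      (graphs fun i => conf ((Q i 0 0 + Q i 1 1) / 2) ((Q i 1 0 - Q i 0 1) / 2)) := by
  refine graphs_equiv_of_segment fun a b ha hb hab i j hij => ne_of_gt ?_
  have h1 := h i j hij
  obtain rfl : b = 1 - a := by linarith
  generalize Q i = P at h1 ⊢
  generalize Q j = R at h1 ⊢
  have key : (a • (P - R) + (1 - a) • (conf ((P 0 0 + P 1 1) / 2) ((P 1 0 - P 0 1) / 2) -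
      conf ((R 0 0 + R 1 1) / 2) ((R 1 0 - R 0 1) / 2))).det = (P - R).det + (1 - a) * (1 + a) *
      ((((P 0 0 - R 0 0) - (P 1 1 - R 1 1)) / 2) ^ 2 +
        (((P 1 0 - R 1 0) + (P 0 1 - R 0 1)) / 2) ^ 2) := by
    simp [conf, Matrix.det_fin_two]
    ring
  rw [key]
  have := mul_nonneg (mul_nonneg hb (by linarith : 0 ≤ 1 + a)) (add_nonneg
    (sq_nonneg (((P 0 0 - R 0 0) - (P 1 1 - R 1 1)) / 2))
    (sq_nonneg (((P 1 0 - R 1 0) + (P 0 1 - R 0 1)) / 2)))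
  linarith

theorem exists_injective_shear (x y : Fin 5 → ℝ) (h : ∀ i j, i ≠ j → x i ≠ x j ∨ y i ≠ y j) :
    ∃ t : ℝ, Function.Injective fun i => x i + t * y i := by
  have hfin : (Set.range fun p : Fin 5 × Fin 5 => -(x p.1 - x p.2) / (y p.1 - y p.2)).Finite :=
    Set.finite_range _
  obtain ⟨t, ht⟩ := hfin.infinite_compl.nonempty
  refine ⟨t, fun i j hij => ?_⟩
  by_contra hne
  simp only at hij
  by_cases hy : y i = y j
  · rw [hy] at hij
    rcases h i j hne with h' | h'
    · exact h' (by linarith)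
    · exact h' hy
  · have hy' : y i - y j ≠ 0 := sub_ne_zero.2 hy
    refine ht ⟨(i, j), ?_⟩
    simp only
    rw [div_eq_iff hy']
    linarith

theorem conf_equiv_standard {x y : Fin 5 → ℝ} (h : ∀ i j, i ≠ j → x i ≠ x j ∨ y i ≠ y j) :
    FrEquiv (graphs fun i => conf (x i) (y i)) (graphs fun i => conf (i : ℝ) 0) := by
  obtain ⟨t, ht⟩ := exists_injective_shear x y h
  have h1 : FrEquiv (graphs fun i => conf (x i) (y i))
      (graphs fun i => conf (x i + t * y i) (y i)) := by
    refine graphs_equiv_of_segment fun a b ha hb hab i j hij h0 => ?_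
    rw [det_conf_sub] at h0
    have e1 : a * (y i - y j) + b * (y i - y j) = y i - y j := by rw [← add_mul, hab, one_mul]
    rw [e1] at h0
    have hy : y i - y j = 0 := by nlinarith [sq_nonneg (a * (x i - x j) + b * (x i + t * y i -
      (x j + t * y j))), sq_nonneg (y i - y j)]
    have hx : a * (x i - x j) + b * (x i + t * y i - (x j + t * y j)) = 0 := by
      rw [hy] at h0
      simpa using h0
    have hx' : x i - x j = 0 := by
      linear_combination hx - b * t * hy - (x i - x j) * hab
    rcases h i j hij with h' | h'
    · exact h' (sub_eq_zero.1 hx')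
    · exact h' (sub_eq_zero.1 hy)
  set u : Fin 5 → ℝ := fun i => x i + t * y i with hu
  set σ := Tuple.sort u with hσ
  have hmono : StrictMono (u ∘ σ) :=
    (Tuple.monotone_sort u).strictMono_of_injective (ht.comp σ.injective)
  refine h1.trans ((graphs_comp_equiv h1.2.1 σ).trans (graphs_equiv_of_segment ?_))
  intro a b ha hb hab i j hij
  simp only [Function.comp_apply]
  rw [det_conf_sub]
  refine ne_of_gt (add_pos_of_pos_of_nonneg (pow_two_pos_of_ne_zero ?_) (sq_nonneg _))
  have key : ∀ i j : Fin 5, i < j → a * (x (σ i) + t * y (σ i) - (x (σ j) + t * y (σ j))) +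
      b * ((i : ℝ) - (j : ℝ)) < 0 := by
    intro i j hij
    have h2 : x (σ i) + t * y (σ i) - (x (σ j) + t * y (σ j)) < 0 := sub_neg.2 (hmono hij)
    have h3 : (i : ℝ) - (j : ℝ) < 0 := sub_neg.2 (by exact_mod_cast hij)
    have h4 := add_pos_of_convex ha hb hab (by linarith : 0 < 1 * -(x (σ i) + t * y (σ i) -
      (x (σ j) + t * y (σ j)))) (by linarith : 0 < 1 * -((i : ℝ) - (j : ℝ)))
    linarith
  rcases lt_or_gt_of_ne hij with hlt | hlt
  · exact (key i j hlt).ne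
  · have := key j i hlt
    intro h0
    linarith

/-- The standard system in which all triples are linked positively. -/
def stdFr : Fr := graphs fun i => conf (i : ℝ) 0

theorem Pat.equiv_std {x : Fr} (h : Pat (fun _ _ => 1) x) : FrEquiv x stdFr := by
  obtain ⟨y, hxy, hy, hy0, -⟩ := exists_first_two h one_pos
  have hex : ∀ i : Fin 5, ∃ Q, ∃ G : Matrix (Fin 2) (Fin 2) ℝ, 0 < G.det ∧
      y i.succ = act G (fr Q 1) := by
    intro i
    obtain ⟨P, G, hPG⟩ := exists_fr (y i.succ)
    have h0 := hy 0 i.succ (Fin.succ_ne_zero i).symm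
    rw [hy0, hPG, br_fr_one_zero, one_mul] at h0
    refine ⟨G⁻¹ * P, G, h0, ?_⟩
    rw [act_fr, mul_one, ← mul_assoc, Matrix.mul_nonsing_inv _ (isUnit_iff_ne_zero.2 h0.ne'),
      one_mul, hPG]
  choose Q G hG hQ using hex
  have heq : y = fun i => act ((Fin.cons 1 G : Fin 6 → Matrix (Fin 2) (Fin 2) ℝ) i) (graphs Q i) := by
    funext i
    induction i using Fin.cases with
    | zero => rw [hy0]; simp [graphs, act_one]
    | succ i => rw [hQ]; simp [graphs]
  have hpos : ∀ i j, i ≠ j → 0 < (Q i - Q j).det := by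
    intro i j hij
    have h1 := hy i.succ j.succ (fun e => hij (Fin.succ_injective _ e))
    rw [hQ, hQ, br_act_left, br_act_right, br_fr_graph, one_mul] at h1
    have h2 := mul_pos (hG i) (hG j)
    rw [← mul_assoc, mul_comm (G i).det] at h1
    first
      | exact pos_of_mul_pos_right h1 h2.le
      | exact pos_of_mul_pos_right h1 (by linarith)
  have hyg : FrEquiv (graphs Q) y := by
    rw [heq]
    refine FrEquiv.of_act (graphs_mem fun i j hij => (hpos i j hij).ne') fun i => ?_
    induction i using Fin.cases with
    | zero => simp
    | succ i => simpa using (hG i).ne'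
  refine hxy.trans (hyg.symm.trans ((graphs_equiv_conf hpos).trans (conf_equiv_standard ?_)))
  intro i j hij
  by_contra! hcon
  obtain ⟨h1, h2⟩ := hcon
  have h3 := hpos i j hij
  rw [Matrix.det_fin_two] at h3
  simp only [Matrix.sub_apply] at h3
  have h4 : Q i 0 0 - Q j 0 0 = -(Q i 1 1 - Q j 1 1) := by linarith
  have h5 : Q i 1 0 - Q j 1 0 = Q i 0 1 - Q j 0 1 := by linarith
  rw [h4, h5] at h3
  nlinarith [sq_nonneg (Q i 1 1 - Q j 1 1), sq_nonneg (Q i 0 1 - Q j 0 1)]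

theorem pat_std : Pat (fun _ _ => 1) stdFr := by
  intro i j hij
  rw [one_mul]
  induction i using Fin.cases with
  | zero =>
    induction j using Fin.cases with
    | zero => exact absurd rfl hij
    | succ j =>
      simp only [stdFr, graphs, Fin.cons_zero, Fin.cons_succ]
      rw [br_fr_one_zero]; simp
  | succ i =>
    induction j using Fin.cases with
    | zero =>
      simp only [stdFr, graphs, Fin.cons_zero, Fin.cons_succ]
      rw [br_comm, br_fr_one_zero]; simp
    | succ j =>
      simp only [stdFr, graphs, Fin.cons_succ]
      rw [br_fr_graph]
      have h : (i : ℝ) ≠ (j : ℝ) := fun e => hij (by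
        rw [Fin.ext (by exact_mod_cast e : (i : ℕ) = j)])
      have := det_conf_sub 1 0 i 0 j 0 0 0 0 0
      rw [one_smul, zero_smul, add_zero] at this
      rw [this]
      have := pow_two_pos_of_ne_zero (sub_ne_zero.2 h)
      nlinarith

/-! ### Reduction to ten sign patterns -/

/-- The product of the signs of a triple. -/
def tri (s : ℕ → ℕ → Bool) (f u v : ℕ) : Bool := s u v ^^ (s u f ^^ s v f)

/-- The signs of the triples containing the last element, read as the digits of a number. -/
def triMask (s : ℕ → ℕ → Bool) (a b c d e f : ℕ) : ℕ :=
  (tri s f a b).toNat + 2 * (tri s f a c).toNat + 4 * (tri s f a d).toNat +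
    8 * (tri s f a e).toNat + 16 * (tri s f b c).toNat + 32 * (tri s f b d).toNat +
    64 * (tri s f b e).toNat + 128 * (tri s f c d).toNat + 256 * (tri s f c e).toNat +
    512 * (tri s f d e).toNat

/-- The sign matrix encoded by a number. -/
def bits (r u v : ℕ) : Bool := r.testBit (6 * u + v)

/-- `triMask` for a list of six elements. -/
def listMask (r : ℕ) : List ℕ → ℕ
  | [a, b, c, d, e, f] => triMask (bits r) a b c d e f
  | _ => 0

/-- Sign patterns not equivalent to their mirror images. -/
def chiral : List ℕ :=
  [0, 1081344, 8737816576, 17717821440, 10918857728, 22151331840, 6615632896]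

/-- Sign patterns equivalent to their mirror images. -/
def achiral : List ℕ := [12894502912, 26454556672, 24332372992]

/-- The masks obtained from a sign pattern by permutations. -/
def masks (r : ℕ) : List ℕ := (List.permutations' [0, 1, 2, 3, 4, 5]).map (listMask r)

/-- The set of masks obtained from the ten sign patterns and their mirror images. -/
def maskSet : ℕ :=
  (((chiral.flatMap masks).flatMap fun m => [m, 1023 - m]) ++ achiral.flatMap masks).foldr
    (fun m a => 1 <<< m ||| a) 0

theorem maskSet_eq : maskSet = 2 ^ 1024 - 1 := by
  decide +kernel

theorem testBit_foldr {n : ℕ} {l : List ℕ}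
    (h : (l.foldr (fun m a => 1 <<< m ||| a) 0).testBit n = true) : n ∈ l := by
  induction l with
  | nil => simp at h
  | cons m l ih =>
    simp only [List.foldr_cons, Nat.testBit_or, Bool.or_eq_true] at h
    rcases h with h | h
    · rw [Nat.one_shiftLeft, Nat.testBit_two_pow] at h
      simp only [decide_eq_true_eq] at h
      simp [h]
    · simp [ih h]

theorem mem_masks {r m : ℕ} : m ∈ masks r ↔
    ∃ l : List ℕ, l.Perm [0, 1, 2, 3, 4, 5] ∧ listMask r l = m := by
  simp only [masks, List.mem_map, List.mem_permutations']

theorem exists_listMask {n : ℕ} (hn : n < 1024) :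
    (∃ r ∈ chiral, ∃ l : List ℕ, l.Perm [0, 1, 2, 3, 4, 5] ∧
      (listMask r l = n ∨ 1023 - listMask r l = n)) ∨
    ∃ r ∈ achiral, ∃ l : List ℕ, l.Perm [0, 1, 2, 3, 4, 5] ∧ listMask r l = n := by
  have h : maskSet.testBit n = true := by
    rw [maskSet_eq, Nat.testBit_two_pow_sub_one]
    simpa using hn
  have hm := testBit_foldr h
  simp only [List.mem_append, List.mem_flatMap, mem_masks, List.mem_cons, List.not_mem_nil,
    or_false] at hm
  rcases hm with ⟨m, ⟨r, hr, l, hl, rfl⟩, h⟩ | ⟨r, hr, l, hl, h⟩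
  · exact Or.inl ⟨r, hr, l, hl, h.imp Eq.symm Eq.symm⟩
  · exact Or.inr ⟨r, hr, l, hl, h⟩

theorem exists_perm_of_list {l : List ℕ} (h : l.Perm [0, 1, 2, 3, 4, 5]) :
    ∃ π : Equiv.Perm (Fin 6), l = [(π 0).1, (π 1).1, (π 2).1, (π 3).1, (π 4).1, (π 5).1] := by
  have hlen : l.length = 6 := h.length_eq
  have hnd : l.Nodup := h.nodup_iff.2 (by decide)
  have hlt : ∀ a ∈ l, a < 6 := fun a ha => by
    have := h.mem_iff.1 ha
    simp at this; omega
  match l, hlen with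
  | [a, b, c, d, e, f], _ =>
    simp only [List.mem_cons, List.not_mem_nil, or_false, forall_eq_or_imp, forall_eq] at hlt
    obtain ⟨ha, hb, hc, hd, he, hf⟩ := hlt
    let φ : Fin 6 → Fin 6 := ![⟨a, ha⟩, ⟨b, hb⟩, ⟨c, hc⟩, ⟨d, hd⟩, ⟨e, he⟩, ⟨f, hf⟩]
    have hinj : Function.Injective φ := by
      simp only [List.nodup_cons, List.mem_cons, List.not_mem_nil, or_false, not_or,
        List.nodup_nil, not_false_iff, and_true] at hnd
      intro i j hij
      fin_cases i <;> fin_cases j <;> simp [φ] at hij ⊢ <;> omega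
    exact ⟨Equiv.ofBijective φ (Finite.injective_iff_bijective.1 hinj), by simp [φ]⟩

theorem toNat_le_one (b : Bool) : b.toNat ≤ 1 := by cases b <;> decide

theorem triMask_eq {s t : ℕ → ℕ → Bool} {a b c d e f a' b' c' d' e' f' : ℕ}
    (h : triMask s a b c d e f = triMask t a' b' c' d' e' f') :
    tri s f a b = tri t f' a' b' ∧ tri s f a c = tri t f' a' c' ∧ tri s f a d = tri t f' a' d' ∧
    tri s f a e = tri t f' a' e' ∧ tri s f b c = tri t f' b' c' ∧ tri s f b d = tri t f' b' d' ∧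
    tri s f b e = tri t f' b' e' ∧ tri s f c d = tri t f' c' d' ∧ tri s f c e = tri t f' c' e' ∧
    tri s f d e = tri t f' d' e' := by
  simp only [triMask] at h
  have hinj : ∀ {b b' : Bool}, b.toNat = b'.toNat → b = b' := fun {b b'} => by
    cases b <;> cases b' <;> simp
  have h1 := toNat_le_one (tri s f a b)
  have h2 := toNat_le_one (tri s f a c)
  have h3 := toNat_le_one (tri s f a d)
  have h4 := toNat_le_one (tri s f a e)
  have h5 := toNat_le_one (tri s f b c)
  have h6 := toNat_le_one (tri s f b d)
  have h7 := toNat_le_one (tri s f b e)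
  have h8 := toNat_le_one (tri s f c d)
  have h9 := toNat_le_one (tri s f c e)
  have h0 := toNat_le_one (tri s f d e)
  have k1 := toNat_le_one (tri t f' a' b')
  have k2 := toNat_le_one (tri t f' a' c')
  have k3 := toNat_le_one (tri t f' a' d')
  have k4 := toNat_le_one (tri t f' a' e')
  have k5 := toNat_le_one (tri t f' b' c')
  have k6 := toNat_le_one (tri t f' b' d')
  have k7 := toNat_le_one (tri t f' b' e')
  have k8 := toNat_le_one (tri t f' c' d')
  have k9 := toNat_le_one (tri t f' c' e')
  have k0 := toNat_le_one (tri t f' d' e')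
  refine ⟨?_, ?_, ?_, ?_, ?_, ?_, ?_, ?_, ?_, ?_⟩ <;> apply hinj <;> omega

theorem triMask_lt (s : ℕ → ℕ → Bool) (a b c d e f : ℕ) : triMask s a b c d e f < 1024 := by
  simp only [triMask]
  have h1 := toNat_le_one (tri s f a b)
  have h2 := toNat_le_one (tri s f a c)
  have h3 := toNat_le_one (tri s f a d)
  have h4 := toNat_le_one (tri s f a e)
  have h5 := toNat_le_one (tri s f b c)
  have h6 := toNat_le_one (tri s f b d)
  have h7 := toNat_le_one (tri s f b e)
  have h8 := toNat_le_one (tri s f c d)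
  have h9 := toNat_le_one (tri s f c e)
  have h0 := toNat_le_one (tri s f d e)
  omega

/-- The signs of the brackets of a system of frames. -/
noncomputable def sg (x : Fr) (u v : ℕ) : Bool :=
  decide (br (x (Fin.ofNat 6 u)) (x (Fin.ofNat 6 v)) < 0)

/-- A real sign from a Boolean. -/
def sr {R : Type*} [One R] [Neg R] (b : Bool) : R := if b then -1 else 1

theorem triMask_mirror {x : Fr} (hx : x ∈ SkewFr) :
    triMask (sg (mirror x)) 0 1 2 3 4 5 = 1023 - triMask (sg x) 0 1 2 3 4 5 := by
  have hs : ∀ u v, Fin.ofNat 6 u ≠ Fin.ofNat 6 v → sg (mirror x) u v = !sg x u v := by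
    intro u v huv
    have := hx _ _ huv
    simp only [sg, br_mirror]
    generalize br (x (Fin.ofNat 6 u)) (x (Fin.ofNat 6 v)) = c at this ⊢
    rcases lt_or_gt_of_ne this with h | h
    · simp [h, h.le]
    · simp [h, h.le]
  have ht : ∀ u v : ℕ, Fin.ofNat 6 u ≠ 5 → Fin.ofNat 6 v ≠ 5 → Fin.ofNat 6 u ≠ Fin.ofNat 6 v →
      (tri (sg (mirror x)) 5 u v).toNat = 1 - (tri (sg x) 5 u v).toNat := by
    intro u v hu hv huv
    simp only [tri]
    rw [hs _ _ huv, hs _ _ hu, hs _ _ hv]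
    cases sg x u v <;> cases sg x u 5 <;> cases sg x v 5 <;> rfl
  simp only [triMask]
  rw [ht 0 1, ht 0 2, ht 0 3, ht 0 4, ht 1 2, ht 1 3, ht 1 4, ht 2 3, ht 2 4, ht 3 4] <;>
    try decide
  have h1 := toNat_le_one (tri (sg x) 5 0 1)
  have h2 := toNat_le_one (tri (sg x) 5 0 2)
  have h3 := toNat_le_one (tri (sg x) 5 0 3)
  have h4 := toNat_le_one (tri (sg x) 5 0 4)
  have h5 := toNat_le_one (tri (sg x) 5 1 2)
  have h6 := toNat_le_one (tri (sg x) 5 1 3)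
  have h7 := toNat_le_one (tri (sg x) 5 1 4)
  have h8 := toNat_le_one (tri (sg x) 5 2 3)
  have h9 := toNat_le_one (tri (sg x) 5 2 4)
  have h0 := toNat_le_one (tri (sg x) 5 3 4)
  omega

theorem sr_xor {R : Type*} [Ring R] (a b : Bool) : (sr (a ^^ b) : R) = sr a * sr b := by
  cases a <;> cases b <;> simp [sr]

theorem sr_ne_zero (a : Bool) : (sr a : ℝ) ≠ 0 := by
  cases a <;> simp [sr]

theorem bits_patterns : ∀ r ∈ chiral ++ achiral, ∀ i j : Fin 6,
    bits r i j = bits r j i ∧ bits r i i = false := by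
  decide +kernel

theorem sg_self (x : Fr) (i : ℕ) : sg x i i = false := by
  simp only [sg, br_self]
  simp

theorem sg_comm (x : Fr) (i j : ℕ) : sg x i j = sg x j i := by
  simp only [sg]
  rw [br_comm]

theorem sg_eq_of_listMask {x : Fr} {r : ℕ} (hr : r ∈ chiral ++ achiral) {π : Equiv.Perm (Fin 6)}
    (h : listMask r [(π 0).1, (π 1).1, (π 2).1, (π 3).1, (π 4).1, (π 5).1] =
      triMask (sg x) 0 1 2 3 4 5) {i j : Fin 6} (hij : i ≠ j) :
    sg x i j = (((sg x i 5 ^^ bits r (π i) (π 5)) ^^ (sg x j 5 ^^ bits r (π j) (π 5))) ^^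
      bits r (π i) (π j)) := by
  have hb := bits_patterns r hr
  have hs : sg x 5 5 = false := sg_self x 5
  have h5 := (hb (π 5) (π 5)).2
  obtain ⟨h0, h1, h2, h3, h4, h5', h6, h7, h8, h9⟩ := triMask_eq h
  simp only [tri] at h0 h1 h2 h3 h4 h5' h6 h7 h8 h9
  have aux : ∀ {a b c a' b' c' : Bool}, (a' ^^ (b' ^^ c')) = (a ^^ (b ^^ c)) →
      a = (((b ^^ b') ^^ (c ^^ c')) ^^ a') := by decide
  have aux2 : ∀ {a b : Bool}, a = (((a ^^ b) ^^ (false ^^ false)) ^^ b) := by decide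
  have key : ∀ i j : Fin 6, i < j →
      sg x i j = (((sg x i 5 ^^ bits r (π i) (π 5)) ^^ (sg x j 5 ^^ bits r (π j) (π 5))) ^^
        bits r (π i) (π j)) := by
    have aux3 : ∀ i : Fin 6,
        sg x i 5 = (((sg x i 5 ^^ bits r (π i) (π 5)) ^^ (sg x 5 5 ^^ bits r (π 5) (π 5))) ^^
          bits r (π i) (π 5)) := by
      intro i
      rw [hs, h5]
      exact aux2
    refine forall_lt_six ?_ ?_ ?_ ?_ ?_ ?_ ?_ ?_ ?_ ?_ ?_ ?_ ?_ ?_ ?_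
    · exact aux h0
    · exact aux h1
    · exact aux h2
    · exact aux h3
    · exact aux3 0
    · exact aux h4
    · exact aux h5'
    · exact aux h6
    · exact aux3 1
    · exact aux h7
    · exact aux h8
    · exact aux3 2
    · exact aux h9
    · exact aux3 3
    · exact aux3 4
  rcases lt_or_gt_of_ne hij with h | h
  · exact key i j h
  · rw [sg_comm x i j, key j i h, (hb (π j) (π i)).1]
    congr 1
    exact Bool.xor_comm _ _

theorem exists_pat_of_listMask {x : Fr} (hx : x ∈ SkewFr) {r : ℕ} (hr : r ∈ chiral ++ achiral) {l : List ℕ}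
    (hl : l.Perm [0, 1, 2, 3, 4, 5]) (h : listMask r l = triMask (sg x) 0 1 2 3 4 5) :
    ∃ y, FrEquiv x y ∧ Pat (fun i j => sr (bits r i j)) y := by
  obtain ⟨π, rfl⟩ := exists_perm_of_list hl
  have key := fun i j => sg_eq_of_listMask (i := i) (j := j) hr h
  set d : Fin 6 → Bool := fun i => sg x i 5 ^^ bits r (π i) (π 5) with hd
  have hdet : ∀ i, (!![(sr (d (π.symm i)) : ℝ), 0; 0, 1]).det = sr (d (π.symm i)) := fun i => by
    simp [Matrix.det_fin_two]
  refine ⟨fun i => act !![sr (d (π.symm i)), 0; 0, 1] ((x ∘ π.symm) i),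
    (FrEquiv.of_comp hx π.symm).trans
      (FrEquiv.of_act (comp_mem hx _) fun i => by rw [hdet]; exact sr_ne_zero _), ?_⟩
  intro i j hij
  rw [br_act_left, br_act_right, hdet, hdet]
  have hne : π.symm i ≠ π.symm j := fun h => hij (π.symm.injective h)
  have h1 := key _ _ hne
  rw [π.apply_symm_apply, π.apply_symm_apply] at h1
  have h2 : 0 < (sr (sg x (π.symm i) (π.symm j)) : ℝ) * br (x (π.symm i)) (x (π.symm j)) := by
    have h3 := hx _ _ hne
    have h4 : sg x (π.symm i) (π.symm j) = decide (br (x (π.symm i)) (x (π.symm j)) < 0) := by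
      simp only [sg, Fin.ofNat_eq_cast, Fin.cast_val_eq_self]
    rw [h4]
    rcases lt_or_gt_of_ne h3 with h | h
    · simp [sr, h]
    · simp [sr, h, h.le, not_lt.2]
  rw [h1, sr_xor, sr_xor] at h2
  have h3 : ∀ k, d (π.symm k) = (sg x (π.symm k) 5 ^^ bits r k (π 5)) := fun k => by
    simp only [hd, π.apply_symm_apply]
  simp only [Function.comp_apply, h3]
  convert h2 using 1
  ring

/-- Every configuration or its mirror image has one of ten sign patterns. -/
theorem exists_pat_rep {x : Fr} (hx : x ∈ SkewFr) :
    (∃ r ∈ chiral, ∃ y, (FrEquiv x y ∨ FrEquiv (mirror x) y) ∧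
      Pat (fun i j => sr (bits r i j)) y) ∨
    ∃ r ∈ achiral, ∃ y, FrEquiv x y ∧ Pat (fun i j => sr (bits r i j)) y := by
  rcases exists_listMask (triMask_lt (sg x) 0 1 2 3 4 5) with
    ⟨r, hr, l, hl, h | h⟩ | ⟨r, hr, l, hl, h⟩
  · obtain ⟨y, h1, h2⟩ := exists_pat_of_listMask hx (by simp [hr]) hl h
    exact Or.inl ⟨r, hr, y, Or.inl h1, h2⟩
  · obtain ⟨y, h1, h2⟩ := exists_pat_of_listMask (r := r) (mirror_mem hx) (by simp [hr]) hl (by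
      rw [triMask_mirror hx, ← h]
      have : listMask r l < 1024 := by
        unfold listMask
        split
        · exact triMask_lt _ _ _ _ _ _ _
        · norm_num
      omega)
    exact Or.inl ⟨r, hr, y, Or.inr h1, h2⟩
  · obtain ⟨y, h1, h2⟩ := exists_pat_of_listMask hx (by simp [hr]) hl h
    exact Or.inr ⟨r, hr, y, h1, h2⟩

/-! ### Lines as matrices in the basis given by two lines -/

/-- The matrix of a line in the basis given by two frames. -/
noncomputable def lmat (a b u : V4 × V4) : Matrix (Fin 2) (Fin 2) ℝ :=
  !![br u (a.1, b.1), br u (a.1, b.2); br u (a.2, b.1), br u (a.2, b.2)]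

/-- The polarization of the determinant. -/
def mx (M N : Matrix (Fin 2) (Fin 2) ℝ) : ℝ :=
  M 0 0 * N 1 1 + M 1 1 * N 0 0 - M 0 1 * N 1 0 - M 1 0 * N 0 1

theorem br_mul_br (a b u v : V4 × V4) :
    br u v * br a b = br u a * br v b + br u b * br v a - mx (lmat a b u) (lmat a b v) := by
  obtain ⟨u1, u2⟩ := u
  obtain ⟨v1, v2⟩ := v
  simp only [lmat, mx, br_eq, Matrix.of_apply, Matrix.cons_val_zero, Matrix.cons_val_one,
    Matrix.cons_val', Matrix.cons_val_fin_one]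
  generalize u1 0 * u2 1 - u1 1 * u2 0 = p1
  generalize u1 0 * u2 2 - u1 2 * u2 0 = p2
  generalize u1 0 * u2 3 - u1 3 * u2 0 = p3
  generalize u1 1 * u2 2 - u1 2 * u2 1 = p4
  generalize u1 1 * u2 3 - u1 3 * u2 1 = p5
  generalize u1 2 * u2 3 - u1 3 * u2 2 = p6
  generalize v1 0 * v2 1 - v1 1 * v2 0 = q1
  generalize v1 0 * v2 2 - v1 2 * v2 0 = q2
  generalize v1 0 * v2 3 - v1 3 * v2 0 = q3
  generalize v1 1 * v2 2 - v1 2 * v2 1 = q4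
  generalize v1 1 * v2 3 - v1 3 * v2 1 = q5
  generalize v1 2 * v2 3 - v1 3 * v2 2 = q6
  ring

theorem mx_self (M : Matrix (Fin 2) (Fin 2) ℝ) : mx M M = 2 * M.det := by
  rw [mx, Matrix.det_fin_two]; ring

theorem det_lmat (a b u : V4 × V4) : (lmat a b u).det = br u a * br u b := by
  have h := br_mul_br a b u u
  rw [br_self, mx_self] at h
  linarith

theorem det_sub_eq {a b u v : V4 × V4} (hu : br u a ≠ 0) (hv : br v a ≠ 0) :
    ((br u a)⁻¹ • lmat a b u - (br v a)⁻¹ • lmat a b v).det =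
      (br u a)⁻¹ * (br v a)⁻¹ * (br u v * br a b) := by
  have h1 := det_lmat a b u
  have h2 := det_lmat a b v
  rw [br_mul_br a b u v]
  rw [Matrix.det_fin_two] at h1 h2 ⊢
  simp only [Matrix.sub_apply, Matrix.smul_apply, smul_eq_mul, mx]
  generalize lmat a b u = M at *
  generalize lmat a b v = N at *
  generalize br u a = x at *
  generalize br v a = y at *
  field_simp
  linear_combination y ^ 2 * h1 + x ^ 2 * h2

/-- Two vectors of positive determinant in a three-dimensional space of matrices have opposite
orientations if their sum has negative determinant. -/
theorem orient_mul_neg {A B C E w1 w2 z1 z2 w1' w2' z1' z2' : ℝ}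
    (hN : C ^ 2 + E ^ 2 ≤ A ^ 2 + B ^ 2) (h0 : 0 < A ^ 2 + B ^ 2)
    (hv : A * w1 + B * w2 + C * z1 + E * z2 = 0)
    (hv' : A * w1' + B * w2' + C * z1' + E * z2' = 0)
    (hd : z1 ^ 2 + z2 ^ 2 < w1 ^ 2 + w2 ^ 2) (hd' : z1' ^ 2 + z2' ^ 2 < w1' ^ 2 + w2' ^ 2)
    (hs : (w1 + w1') ^ 2 + (w2 + w2') ^ 2 < (z1 + z1') ^ 2 + (z2 + z2') ^ 2) :
    (A * w2 - B * w1) * (A * w2' - B * w1') < 0 := by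
  set n := A ^ 2 + B ^ 2 with hn
  set p := n - (C ^ 2 + E ^ 2) with hp
  have hp0 : 0 ≤ p := by linarith
  set h := A * w2 - B * w1 with hh
  set h' := A * w2' - B * w1' with hh'
  set k := p * (z1 ^ 2 + z2 ^ 2) + (E * z1 - C * z2) ^ 2 with hk
  set k' := p * (z1' ^ 2 + z2' ^ 2) + (E * z1' - C * z2') ^ 2 with hk'
  set m := p * (z1 * z1' + z2 * z2') + (E * z1 - C * z2) * (E * z1' - C * z2') with hm
  have e1 : h ^ 2 - k = n * (w1 ^ 2 + w2 ^ 2 - (z1 ^ 2 + z2 ^ 2)) := by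
    rw [hh, hk, hp, hn]
    linear_combination (-(A * w1 + B * w2) + (C * z1 + E * z2)) * hv
  have e2 : h' ^ 2 - k' = n * (w1' ^ 2 + w2' ^ 2 - (z1' ^ 2 + z2' ^ 2)) := by
    rw [hh', hk', hp, hn]
    linear_combination (-(A * w1' + B * w2') + (C * z1' + E * z2')) * hv'
  have e3 : h * h' - m = n * (w1 * w1' + w2 * w2' - (z1 * z1' + z2 * z2')) := by
    rw [hh, hh', hm, hp, hn]
    linear_combination (-(A * w1' + B * w2')) * hv + (C * z1 + E * z2) * hv'
  have hkk : m ^ 2 ≤ k * k' := by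
    have : k * k' - m ^ 2 = p ^ 2 * (z1 * z2' - z2 * z1') ^ 2 + p *
        (((E * z1' - C * z2') * z1 - (E * z1 - C * z2) * z1') ^ 2 +
          ((E * z1' - C * z2') * z2 - (E * z1 - C * z2) * z2') ^ 2) := by
      rw [hk, hk', hm]; ring
    have : 0 ≤ k * k' - m ^ 2 := by rw [this]; positivity
    linarith
  have hk0 : 0 ≤ k := by rw [hk]; positivity
  have hk0' : 0 ≤ k' := by rw [hk']; positivity
  have hlt : k < h ^ 2 := by
    have := mul_pos h0 (sub_pos.2 hd)
    linarith
  have hlt' : k' < h' ^ 2 := by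
    have := mul_pos h0 (sub_pos.2 hd')
    linarith
  have hs' : 2 * (h * h' - m) + (h ^ 2 - k) + (h' ^ 2 - k') < 0 := by
    rw [e1, e2, e3]
    have := mul_pos h0 (sub_pos.2 hs)
    linarith
  by_contra hc
  push Not at hc
  have h1 : m ^ 2 < (h * h') ^ 2 := by
    calc m ^ 2 ≤ k * k' := hkk
      _ ≤ h ^ 2 * k' := by gcongr
      _ < h ^ 2 * h' ^ 2 := by
        have : 0 < h ^ 2 := lt_of_le_of_lt hk0 hlt
        gcongr
      _ = (h * h') ^ 2 := by ring
  have h2 : m ≤ h * h' := (abs_le_of_sq_le_sq' h1.le hc).2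
  linarith

theorem prod_neg_five {a b c d e : ℝ} (h1 : a * b < 0) (h2 : b * c < 0) (h3 : c * d < 0)
    (h4 : d * e < 0) (h5 : e * a < 0) : False := by
  have h12 := mul_pos_of_neg_of_neg h1 h2
  have h34 := mul_pos_of_neg_of_neg h3 h4
  have h := mul_neg_of_pos_of_neg (mul_pos h12 h34) h5
  have : a * b * (b * c) * (c * d * (d * e)) * (e * a) = (a * b * c * d * e) ^ 2 := by ring
  rw [this] at h
  exact absurd h (not_lt.2 (sq_nonneg _))

/-- Five points in a three-dimensional affine space of matrices with a pentagon of determinants. -/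
theorem not_pentagon {A B C E : ℝ} (hN : C ^ 2 + E ^ 2 ≤ A ^ 2 + B ^ 2) (h0 : 0 < A ^ 2 + B ^ 2)
    {w w' z z' : Fin 5 → ℝ}
    (hv : ∀ i, A * w i + B * w' i + C * z i + E * z' i = 0)
    (hd : ∀ i, (z i - z (i + 1)) ^ 2 + (z' i - z' (i + 1)) ^ 2 <
      (w i - w (i + 1)) ^ 2 + (w' i - w' (i + 1)) ^ 2)
    (hs : ∀ i, (w i - w (i + 2)) ^ 2 + (w' i - w' (i + 2)) ^ 2 <
      (z i - z (i + 2)) ^ 2 + (z' i - z' (i + 2)) ^ 2) : False := by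
  have key : ∀ i, (A * (w' i - w' (i + 1)) - B * (w i - w (i + 1))) *
      (A * (w' (i + 1) - w' (i + 1 + 1)) - B * (w (i + 1) - w (i + 1 + 1))) < 0 := by
    intro i
    have h2 : i + 2 = i + 1 + 1 := by rw [add_assoc]; rfl
    refine orient_mul_neg hN h0 ?_ ?_ (hd i) (hd (i + 1)) ?_
    · linear_combination hv i - hv (i + 1)
    · linear_combination hv (i + 1) - hv (i + 1 + 1)
    · have := hs i
      rw [h2] at this
      convert this using 1 <;> ring
  exact prod_neg_five (key 0) (key 1) (key 2) (key 3) (key 4)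

/-- The determinant of the matrices of the last four lines. -/
noncomputable def quad (x : Fr) : ℝ :=
  (Matrix.of fun i j : Fin 4 =>
    lmat (x 0) (x 1) (x (i.natAdd 2)) (![0, 0, 1, 1] j) (![0, 1, 0, 1] j)).det

theorem continuous_lmat (i : Fin 6) (p q : Fin 2) :
    Continuous fun x : Fr => lmat (x 0) (x 1) (x i) p q := by
  have h : ∀ f g : V4 × V4 → V4, Continuous f → Continuous g →
      Continuous fun x : Fr => br (x i) (f (x 0), g (x 1)) := fun f g hf hg =>
    continuous_br.comp (f := fun x : Fr => (x i, (f (x 0), g (x 1)))) (by fun_prop)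
  fin_cases p <;> fin_cases q
  · exact h _ _ continuous_fst continuous_fst
  · exact h _ _ continuous_fst continuous_snd
  · exact h _ _ continuous_snd continuous_fst
  · exact h _ _ continuous_snd continuous_snd

theorem continuous_quad : Continuous quad :=
  Continuous.matrix_det (continuous_matrix fun _ _ => continuous_lmat _ _ _)

theorem lmat_right (a b : V4 × V4) : lmat a b b = 0 := by
  ext i j
  fin_cases i <;> fin_cases j <;> simp [lmat, br_eq] <;> ring

theorem four_mul_det (M : Matrix (Fin 2) (Fin 2) ℝ) : 4 * M.det =
    (M 0 0 + M 1 1) ^ 2 + (M 1 0 - M 0 1) ^ 2 - ((M 0 0 - M 1 1) ^ 2 + (M 0 1 + M 1 0) ^ 2) := by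
  rw [Matrix.det_fin_two]; ring

theorem Pat.quad_ne_zero {x : Fr} (h : Pat (pat ![1, -1, 1, -1] ![1, -1, -1, 1] 1) x) :
    quad x ≠ 0 := by
  intro h0
  obtain ⟨n, hn, hq⟩ := Matrix.exists_mulVec_eq_zero_iff.2 h0
  obtain ⟨u, hu⟩ : ∃ u : Fin 6 → Matrix (Fin 2) (Fin 2) ℝ,
    ∀ i, u i = (br (x i) (x 0))⁻¹ • lmat (x 0) (x 1) (x i) := ⟨_, fun i => rfl⟩
  have hN : ∀ i, i ≠ 0 →
      n 0 * u i 0 0 + n 1 * u i 0 1 + n 2 * u i 1 0 + n 3 * u i 1 1 = 0 := by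
    intro i hi
    rw [hu]
    by_cases h1 : i = 1
    · rw [h1, lmat_right]; simp
    · obtain ⟨j, rfl⟩ : ∃ j : Fin 4, i = j.natAdd 2 := by
        refine ⟨⟨i - 2, by omega⟩, Fin.ext ?_⟩
        have : (i : ℕ) ≠ 0 := fun h => hi (Fin.ext h)
        have : (i : ℕ) ≠ 1 := fun h => h1 (Fin.ext h)
        simp; omega
      have := congrFun hq j
      simp only [Matrix.mulVec, dotProduct, Fin.sum_univ_four, Matrix.of_apply,
        Matrix.cons_val_zero, Matrix.cons_val_one, Matrix.cons_val, Pi.zero_apply] at this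
      simp only [Matrix.smul_apply, smul_eq_mul]
      linear_combination (br (x (j.natAdd 2)) (x 0))⁻¹ * this
  have hb : ∀ i, i ≠ 0 → 0 < br (x i) (x 0) := by
    intro i hi
    have := h i 0 hi
    have h1 : pat (![1, -1, 1, -1] : Fin 4 → ℝ) ![1, -1, -1, 1] 1 i 0 = 1 := by
      fin_cases i <;> first | exact absurd rfl hi | simp [pat]
    rwa [h1, one_mul] at this
  have hd : ∀ i j, i ≠ 0 → j ≠ 0 → i ≠ j →
      0 < pat (![1, -1, 1, -1] : Fin 4 → ℝ) ![1, -1, -1, 1] 1 i j * (4 * (u i - u j).det) := by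
    intro i j hi hj hij
    rw [hu, hu, det_sub_eq (hb i hi).ne' (hb j hj).ne']
    have h1 := h i j hij
    have h2 := inv_pos.2 (hb i hi)
    have h3 := inv_pos.2 (hb j hj)
    have h4 := hb 1 one_ne_zero
    rw [br_comm] at h4
    have := mul_pos (mul_pos (mul_pos h2 h3) h4) h1
    nlinarith
  simp only [four_mul_det, Matrix.sub_apply] at hd
  have hn0 : 0 < (n 0 + n 3) ^ 2 + (n 2 - n 1) ^ 2 ∨ 0 < (n 0 - n 3) ^ 2 + (n 1 + n 2) ^ 2 := by
    by_contra hc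
    push Not at hc
    apply hn
    have h1 : n 0 + n 3 = 0 := by nlinarith
    have h2 : n 2 - n 1 = 0 := by nlinarith
    have h3 : n 0 - n 3 = 0 := by nlinarith
    have h4 : n 1 + n 2 = 0 := by nlinarith
    funext i
    fin_cases i <;> simp <;> linarith
  rcases le_total ((n 0 - n 3) ^ 2 + (n 1 + n 2) ^ 2) ((n 0 + n 3) ^ 2 + (n 2 - n 1) ^ 2) with hle | hle
  · have hne : ∀ i : Fin 5, (![1, 2, 4, 5, 3] : Fin 5 → Fin 6) i ≠ 0 := by decide
    refine not_pentagon hle (hn0.elim id fun h => h.trans_le hle)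
      (w := fun i => u (![1, 2, 4, 5, 3] i) 0 0 + u (![1, 2, 4, 5, 3] i) 1 1)
      (w' := fun i => u (![1, 2, 4, 5, 3] i) 1 0 - u (![1, 2, 4, 5, 3] i) 0 1)
      (z := fun i => u (![1, 2, 4, 5, 3] i) 0 0 - u (![1, 2, 4, 5, 3] i) 1 1)
      (z' := fun i => u (![1, 2, 4, 5, 3] i) 0 1 + u (![1, 2, 4, 5, 3] i) 1 0) ?_ ?_ ?_
    · intro i
      linear_combination 2 * hN _ (hne i)
    · intro i
      have h1 := hd (![1, 2, 4, 5, 3] i) (![1, 2, 4, 5, 3] (i + 1)) (hne i) (hne _)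
        (by revert i; decide)
      have h2 : pat (![1, -1, 1, -1] : Fin 4 → ℝ) ![1, -1, -1, 1] 1 (![1, 2, 4, 5, 3] i)
          (![1, 2, 4, 5, 3] (i + 1)) = 1 := by
        fin_cases i <;> simp [pat]
      rw [h2] at h1
      linarith
    · intro i
      have h1 := hd (![1, 2, 4, 5, 3] i) (![1, 2, 4, 5, 3] (i + 2)) (hne i) (hne _)
        (by revert i; decide)
      have h2 : pat (![1, -1, 1, -1] : Fin 4 → ℝ) ![1, -1, -1, 1] 1 (![1, 2, 4, 5, 3] i)
          (![1, 2, 4, 5, 3] (i + 2)) = -1 := by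
        fin_cases i <;> simp [pat]
      rw [h2] at h1
      linarith
  · have hne : ∀ i : Fin 5, (![1, 4, 3, 2, 5] : Fin 5 → Fin 6) i ≠ 0 := by decide
    refine not_pentagon hle (hn0.elim (fun h => h.trans_le hle) id)
      (w := fun i => u (![1, 4, 3, 2, 5] i) 0 0 - u (![1, 4, 3, 2, 5] i) 1 1)
      (w' := fun i => u (![1, 4, 3, 2, 5] i) 0 1 + u (![1, 4, 3, 2, 5] i) 1 0)
      (z := fun i => u (![1, 4, 3, 2, 5] i) 0 0 + u (![1, 4, 3, 2, 5] i) 1 1)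
      (z' := fun i => u (![1, 4, 3, 2, 5] i) 1 0 - u (![1, 4, 3, 2, 5] i) 0 1) ?_ ?_ ?_
    · intro i
      linear_combination 2 * hN _ (hne i)
    · intro i
      have h1 := hd (![1, 4, 3, 2, 5] i) (![1, 4, 3, 2, 5] (i + 1)) (hne i) (hne _)
        (by revert i; decide)
      have h2 : pat (![1, -1, 1, -1] : Fin 4 → ℝ) ![1, -1, -1, 1] 1 (![1, 4, 3, 2, 5] i)
          (![1, 4, 3, 2, 5] (i + 1)) = -1 := by
        fin_cases i <;> simp [pat]
      rw [h2] at h1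
      linarith
    · intro i
      have h1 := hd (![1, 4, 3, 2, 5] i) (![1, 4, 3, 2, 5] (i + 2)) (hne i) (hne _)
        (by revert i; decide)
      have h2 : pat (![1, -1, 1, -1] : Fin 4 → ℝ) ![1, -1, -1, 1] 1 (![1, 4, 3, 2, 5] i)
          (![1, 4, 3, 2, 5] (i + 2)) = 1 := by
        fin_cases i <;> simp [pat]
      rw [h2] at h1
      linarith

/-! ### Invariants of sign patterns -/

/-- A change of frame of determinant `d`. -/
def sgm (d : ℤ) : Matrix (Fin 2) (Fin 2) ℝ := !![(d : ℝ), 0; 0, 1]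

theorem det_sgm (d : ℤ) : (sgm d).det = d := by simp [sgm]

theorem FrEquiv.exists_joinedIn {x y : Fr} (h : FrEquiv x y) :
    ∃ π : Equiv.Perm (Fin 6), ∃ d : Fin 6 → ℤ, (∀ i, d i = 1 ∨ d i = -1) ∧
      JoinedIn SkewFr x fun i => act (sgm (d i)) (y (π i)) := by
  obtain ⟨hx, hy, h⟩ := h
  obtain ⟨π, h⟩ := deformEquiv_iff.1 h
  obtain ⟨x', y', hj, hx', hy'⟩ := deformation_iff.1 h
  obtain ⟨g, hg, rfl⟩ := exists_act_fr hx hx'.symm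
  obtain ⟨k, hk, rfl⟩ := exists_act_fr (x := y ∘ π) hj.target_mem hy'
  have h1 : JoinedIn SkewFr (fun i => act (g i) (x' i))
      (fun i => act (g i * k i) (y (π i))) := by
    have := (hj.map (f := fun u i => act (g i) (u i)) (by unfold act; fun_prop)).mono
      (V := SkewFr) (by
        rintro _ ⟨u, hu, rfl⟩
        exact act_mem hu hg)
    simpa only [act_act, Function.comp_apply] using this
  have hm : ∀ i, (g i * k i).det ≠ 0 := fun i => by
    rw [Matrix.det_mul]; exact mul_ne_zero (hg i) (hk i)
  generalize (fun i => g i * k i) = m at hm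
  have hd : ∀ i, ∃ d : ℤ, (d = 1 ∨ d = -1) ∧ 0 < ((g i * k i) * sgm d).det := by
    intro i
    rcases lt_or_gt_of_ne (hm i) with h | h
    · refine ⟨-1, Or.inr rfl, ?_⟩
      rw [Matrix.det_mul, det_sgm]; push_cast; linarith
    · refine ⟨1, Or.inl rfl, ?_⟩
      rw [Matrix.det_mul, det_sgm]; push_cast; linarith
  choose d hd hpos using hd
  have hdd : ∀ i, sgm (d i) * sgm (d i) = 1 := by
    intro i
    rcases hd i with h | h <;> rw [h] <;> ext a b <;> fin_cases a <;> fin_cases b <;> simp [sgm]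
  refine ⟨π, d, hd, h1.trans ?_⟩
  have h2 : JoinedIn (Set.pi Set.univ fun _ : Fin 6 => {M : Matrix (Fin 2) (Fin 2) ℝ | 0 < M.det})
      (fun i => (g i * k i) * sgm (d i)) (fun _ => 1) :=
    JoinedIn.pi fun i => joinedIn_one_of_det_pos_two (hpos i)
  have h3 : (fun i => act (sgm (d i)) (y (π i))) ∈ SkewFr :=
    act_mem (comp_mem hy π) fun i => by
      rw [det_sgm]; rcases hd i with h | h <;> rw [h] <;> norm_num
  have h4 := (h2.map (f := fun M i => act (M i) (act (sgm (d i)) (y (π i))))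
    (by unfold act; fun_prop)).mono (V := SkewFr) (by
      rintro _ ⟨M, hM, rfl⟩
      exact act_mem h3 fun i => ne_of_gt (hM i trivial))
  simpa only [act_act, act_one, mul_assoc, hdd, mul_one, one_mul] using h4

/-- Integral sign patterns. -/
def PatZ (T : Fin 6 → Fin 6 → ℤ) (x : Fr) : Prop := Pat (fun i j => (T i j : ℝ)) x

/-- Matrices with vanishing diagonal and all other entries equal to `1` or `-1`. -/
def IsSign (T : Fin 6 → Fin 6 → ℤ) : Prop :=
  ∀ i j, if i = j then T i j = 0 else T i j = 1 ∨ T i j = -1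

instance (T : Fin 6 → Fin 6 → ℤ) : Decidable (IsSign T) := by unfold IsSign; infer_instance

theorem PatZ.eq {T T' : Fin 6 → Fin 6 → ℤ} {x y : Fr} (hT : IsSign T) (hT' : IsSign T')
    (h : PatZ T x) (h' : PatZ T' y) {π : Equiv.Perm (Fin 6)} {d : Fin 6 → ℤ}
    (hd : ∀ i, d i = 1 ∨ d i = -1) (hj : JoinedIn SkewFr x fun i => act (sgm (d i)) (y (π i))) :
    ∀ i j, T i j = d i * d j * T' (π i) (π j) := by
  intro i j
  have h1 := hT i j
  have h2 := hT' (π i) (π j)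
  by_cases hij : i = j
  · rw [if_pos hij] at h1
    rw [if_pos (congrArg π hij)] at h2
    rw [h1, h2, mul_zero]
  · rw [if_neg hij] at h1
    rw [if_neg fun h => hij (π.injective h)] at h2
    have h3 := br_pos_of_joinedIn (c := (T i j : ℝ)) hj hij (h i j hij)
    have h4 : 0 < (T' (π i) (π j) : ℝ) * br (y (π i)) (y (π j)) :=
      h' (π i) (π j) fun h => hij (π.injective h)
    rw [br_act_left, br_act_right, det_sgm, det_sgm] at h3
    generalize T' (π i) (π j) = t' at *
    generalize br (y (π i)) (y (π j)) = b at *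
    have h5 := mul_pos h3 h4
    rcases hd i with e1 | e1 <;> rcases hd j with e2 | e2 <;> rcases h1 with e3 | e3 <;>
      rcases h2 with e4 | e4 <;> rw [e1, e2, e3] at h5 <;> rw [e4] at h5 <;> rw [e1, e2, e3, e4] <;>
      first | norm_num; done | (exfalso; push_cast at h5; nlinarith [sq_nonneg b])

/-- The diagonal entries of the cube of a matrix. -/
def cubeDiag (T : Fin 6 → Fin 6 → ℤ) (i : Fin 6) : ℤ := ∑ j, ∑ k, T i j * T j k * T k i

theorem cubeDiag_eq {T T' : Fin 6 → Fin 6 → ℤ} {π : Equiv.Perm (Fin 6)} {d : Fin 6 → ℤ}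
    (hd : ∀ i, d i = 1 ∨ d i = -1) (h : ∀ i j, T i j = d i * d j * T' (π i) (π j)) (i : Fin 6) :
    cubeDiag T i = cubeDiag T' (π i) := by
  have hdd : ∀ i, d i * d i = 1 := fun i => by rcases hd i with h | h <;> rw [h] <;> norm_num
  rw [cubeDiag, cubeDiag, ← Equiv.sum_comp π fun j => ∑ k, T' (π i) j * T' j k * T' k (π i)]
  refine Finset.sum_congr rfl fun j _ => ?_
  rw [← Equiv.sum_comp π fun k => T' (π i) (π j) * T' (π j) k * T' k (π i)]
  refine Finset.sum_congr rfl fun k _ => ?_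
  rw [h i j, h j k, h k i]
  linear_combination T' (π i) (π j) * T' (π j) (π k) * T' (π k) (π i) *
    (d j * d j * (d k * d k) * hdd i + (d k * d k) * hdd j + hdd k)

theorem FrEquiv.sum_cubeDiag {T T' : Fin 6 → Fin 6 → ℤ} {x y : Fr} (hT : IsSign T)
    (hT' : IsSign T') (h : PatZ T x) (h' : PatZ T' y) (hxy : FrEquiv x y) (f : ℤ → ℤ) :
    ∑ i, f (cubeDiag T i) = ∑ i, f (cubeDiag T' i) := by
  obtain ⟨π, d, hd, hj⟩ := hxy.exists_joinedIn
  rw [← Equiv.sum_comp π fun i => f (cubeDiag T' i)]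
  exact Finset.sum_congr rfl fun i _ => by rw [cubeDiag_eq hd (PatZ.eq hT hT' h h' hd hj)]

theorem PatZ.mirror {T : Fin 6 → Fin 6 → ℤ} {x : Fr} (h : PatZ T x) :
    PatZ (fun i j => -T i j) (mirror x) := by
  intro i j hij
  rw [br_mirror]
  have := h i j hij
  push_cast
  linarith

/-! ### Integral frames and finite verifications -/

/-- The sign matrix encoded by a number, up to a common sign. -/
def matZ (c : Bool) (r : ℕ) (i j : Fin 6) : ℤ := if i = j then 0 else sr (c ^^ bits r i j)

theorem isSign_matZ (c : Bool) (r : ℕ) : IsSign (matZ c r) := by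
  intro i j
  unfold matZ
  split_ifs
  · rfl
  · cases c ^^ bits r i j <;> simp [sr]

theorem PatZ.mirror_matZ {c : Bool} {r : ℕ} {x : Fr} (h : PatZ (matZ c r) x) :
    PatZ (matZ (!c) r) (_root_.mirror x) := by
  have := h.mirror
  have e : (fun i j => -matZ c r i j) = matZ (!c) r := by
    funext i j
    unfold matZ
    split_ifs
    · rfl
    · cases c <;> cases bits r i j <;> simp [sr]
  rwa [e] at this

/-- Systems of integral frames. -/
abbrev ZFr : Type := Fin 6 → (Fin 4 → ℤ) × (Fin 4 → ℤ)

/-- A system of integral frames as a system of real frames. -/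
def ZFr.toFr (X : ZFr) : Fr := fun i => (fun k => ((X i).1 k : ℝ), fun k => ((X i).2 k : ℝ))

/-- Brackets of integral frames. -/
def brZ (x y : (Fin 4 → ℤ) × (Fin 4 → ℤ)) : ℤ :=
  (x.1 0 * x.2 1 - x.1 1 * x.2 0) * (y.1 2 * y.2 3 - y.1 3 * y.2 2)
    - (x.1 0 * x.2 2 - x.1 2 * x.2 0) * (y.1 1 * y.2 3 - y.1 3 * y.2 1)
    + (x.1 0 * x.2 3 - x.1 3 * x.2 0) * (y.1 1 * y.2 2 - y.1 2 * y.2 1)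
    + (x.1 1 * x.2 2 - x.1 2 * x.2 1) * (y.1 0 * y.2 3 - y.1 3 * y.2 0)
    - (x.1 1 * x.2 3 - x.1 3 * x.2 1) * (y.1 0 * y.2 2 - y.1 2 * y.2 0)
    + (x.1 2 * x.2 3 - x.1 3 * x.2 2) * (y.1 0 * y.2 1 - y.1 1 * y.2 0)

theorem br_toFr (X : ZFr) (i j : Fin 6) : br (X.toFr i) (X.toFr j) = brZ (X i) (X j) := by
  rw [br_eq, brZ]
  push_cast
  rfl

/-- The matrices of the lines in the basis given by the first two frames. -/
def lmatZ (X : ZFr) (i : Fin 6) : Matrix (Fin 2) (Fin 2) ℤ :=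
  !![brZ (X i) ((X 0).1, (X 1).1), brZ (X i) ((X 0).1, (X 1).2);
    brZ (X i) ((X 0).2, (X 1).1), brZ (X i) ((X 0).2, (X 1).2)]

theorem lmat_toFr (X : ZFr) (i : Fin 6) :
    lmat (X.toFr 0) (X.toFr 1) (X.toFr i) = (lmatZ X i).map (Int.cast : ℤ → ℝ) := by
  have h : ∀ u v w, br (X.toFr i) (fun k => ((v k : ℤ) : ℝ), fun k => ((w k : ℤ) : ℝ)) =
      (brZ (X i) (v, w) : ℝ) ∨ u := by
    intro u v w
    left
    rw [br_eq, brZ]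
    push_cast
    rfl
  ext p q
  fin_cases p <;> fin_cases q
  · exact (h False _ _).resolve_right id
  · exact (h False _ _).resolve_right id
  · exact (h False _ _).resolve_right id
  · exact (h False _ _).resolve_right id

/-- Permutation and change of orientations of integral frames. -/
def ZFr.move (Y : ZFr) (p : Fin 6 → Fin 6) (c : Fin 6 → Bool) : ZFr :=
  fun i => (fun k => sr (c i) * (Y (p i)).1 k, (Y (p i)).2)

theorem ZFr.toFr_move (Y : ZFr) (p : Fin 6 → Fin 6) (c : Fin 6 → Bool) :
    (Y.move p c).toFr = fun i => act (sgm (sr (c i))) (Y.toFr (p i)) := by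
  funext i
  ext k <;> simp [ZFr.toFr, ZFr.move, act, sgm]

/-- A property of all permutations and changes of orientations which carry one sign pattern to
another one. -/
def Search (s s' : Fin 6 → Fin 6 → Bool) (P : (Fin 6 → Fin 6) → (Fin 6 → Bool) → Bool) : Prop :=
  ∀ p0 c0 p1 c1, p0 ≠ p1 → s 0 1 = (c0 ^^ c1 ^^ s' p0 p1) →
  ∀ p2 c2, p0 ≠ p2 → s 0 2 = (c0 ^^ c2 ^^ s' p0 p2) → p1 ≠ p2 → s 1 2 = (c1 ^^ c2 ^^ s' p1 p2) →
  ∀ p3 c3, p0 ≠ p3 → s 0 3 = (c0 ^^ c3 ^^ s' p0 p3) → p1 ≠ p3 → s 1 3 = (c1 ^^ c3 ^^ s' p1 p3) →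
    p2 ≠ p3 → s 2 3 = (c2 ^^ c3 ^^ s' p2 p3) →
  ∀ p4 c4, p0 ≠ p4 → s 0 4 = (c0 ^^ c4 ^^ s' p0 p4) → p1 ≠ p4 → s 1 4 = (c1 ^^ c4 ^^ s' p1 p4) →
    p2 ≠ p4 → s 2 4 = (c2 ^^ c4 ^^ s' p2 p4) → p3 ≠ p4 → s 3 4 = (c3 ^^ c4 ^^ s' p3 p4) →
  ∀ p5 c5, p0 ≠ p5 → s 0 5 = (c0 ^^ c5 ^^ s' p0 p5) → p1 ≠ p5 → s 1 5 = (c1 ^^ c5 ^^ s' p1 p5) →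
    p2 ≠ p5 → s 2 5 = (c2 ^^ c5 ^^ s' p2 p5) → p3 ≠ p5 → s 3 5 = (c3 ^^ c5 ^^ s' p3 p5) →
    p4 ≠ p5 → s 4 5 = (c4 ^^ c5 ^^ s' p4 p5) → P ![p0, p1, p2, p3, p4, p5] ![c0, c1, c2, c3, c4, c5]

set_option synthInstance.maxSize 1000 in
set_option synthInstance.maxHeartbeats 400000 in
instance (s s' : Fin 6 → Fin 6 → Bool) (P : (Fin 6 → Fin 6) → (Fin 6 → Bool) → Bool) :
    Decidable (Search s s' P) := by
  unfold Search; infer_instance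

theorem Search.apply {s s' : Fin 6 → Fin 6 → Bool} {P : (Fin 6 → Fin 6) → (Fin 6 → Bool) → Bool}
    (h : Search s s' P) {p : Fin 6 → Fin 6} {c : Fin 6 → Bool} (hp : ∀ i j, i ≠ j → p i ≠ p j)
    (hs : ∀ i j, i ≠ j → s i j = (c i ^^ c j ^^ s' (p i) (p j))) : P p c := by
  have := h (p 0) (c 0) (p 1) (c 1) (hp _ _ (by decide)) (hs _ _ (by decide))
    (p 2) (c 2) (hp _ _ (by decide)) (hs _ _ (by decide)) (hp _ _ (by decide)) (hs _ _ (by decide))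
    (p 3) (c 3) (hp _ _ (by decide)) (hs _ _ (by decide)) (hp _ _ (by decide)) (hs _ _ (by decide))
    (hp _ _ (by decide)) (hs _ _ (by decide))
    (p 4) (c 4) (hp _ _ (by decide)) (hs _ _ (by decide)) (hp _ _ (by decide)) (hs _ _ (by decide))
    (hp _ _ (by decide)) (hs _ _ (by decide)) (hp _ _ (by decide)) (hs _ _ (by decide))
    (p 5) (c 5) (hp _ _ (by decide)) (hs _ _ (by decide)) (hp _ _ (by decide)) (hs _ _ (by decide))
    (hp _ _ (by decide)) (hs _ _ (by decide)) (hp _ _ (by decide)) (hs _ _ (by decide))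
    (hp _ _ (by decide)) (hs _ _ (by decide))
  have e1 : (![p 0, p 1, p 2, p 3, p 4, p 5] : Fin 6 → Fin 6) = p := by
    funext i; fin_cases i <;> rfl
  have e2 : (![c 0, c 1, c 2, c 3, c 4, c 5] : Fin 6 → Bool) = c := by
    funext i; fin_cases i <;> rfl
  rwa [e1, e2] at this

theorem sr_injective {a b : Bool} (h : (sr a : ℤ) = sr b) : a = b := by
  cases a <;> cases b <;> simp [sr] at h ⊢

/-- Equivalent systems of integral frames are joined after some move which satisfies a property
verified by a finite search. -/
theorem Search.exists_joinedIn {c c' : Bool} {r r' : ℕ} {P : (Fin 6 → Fin 6) → (Fin 6 → Bool) → Bool}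
    (h : Search (fun i j => c ^^ bits r i j) (fun i j => c' ^^ bits r' i j) P) {x : Fr} {Y : ZFr}
    (hx : PatZ (matZ c r) x) (hY : PatZ (matZ c' r') Y.toFr) (hxy : FrEquiv x Y.toFr) :
    ∃ p s, P p s ∧ JoinedIn SkewFr x (Y.move p s).toFr := by
  obtain ⟨π, d, hd, hj⟩ := hxy.exists_joinedIn
  have hc : ∀ i, ∃ b : Bool, d i = sr b := fun i => by
    rcases hd i with h | h
    · exact ⟨false, h⟩
    · exact ⟨true, h⟩
  choose s hs using hc
  have key := PatZ.eq (isSign_matZ _ _) (isSign_matZ _ _) hx hY hd hj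
  refine ⟨π, s, h.apply (fun i j hij h => hij (π.injective h)) fun i j hij => ?_, ?_⟩
  · have := key i j
    rw [matZ, matZ, if_neg hij, if_neg fun h => hij (π.injective h), hs, hs, ← sr_xor, ← sr_xor]
      at this
    exact sr_injective this
  · rw [ZFr.toFr_move]
    simpa only [hs] using hj

/-- Evaluation of an argument before the application of a function. -/
def forceFin {α : Type} (i : Fin 6) (f : Fin 6 → α) : α :=
  match i with
  | 0 => f 0 | 1 => f 1 | 2 => f 2 | 3 => f 3 | 4 => f 4 | 5 => f 5

/-- Evaluation of an argument before the application of a function. -/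
def forceBool {α : Type} (i : Bool) (f : Bool → α) : α :=
  match i with
  | true => f true | false => f false

theorem forceFin_eq {α : Type} (i : Fin 6) (f : Fin 6 → α) : forceFin i f = f i := by
  fin_cases i <;> rfl

theorem forceBool_eq {α : Type} (i : Bool) (f : Bool → α) : forceBool i f = f i := by
  cases i <;> rfl

/-- Evaluation of permutations and signs before the application of a function. -/
def forceMove (p : Fin 6 → Fin 6) (c : Fin 6 → Bool) (f : (Fin 6 → Fin 6) → (Fin 6 → Bool) → Bool) :
    Bool :=
  forceFin (p 0) fun p0 => forceFin (p 1) fun p1 => forceFin (p 2) fun p2 => forceFin (p 3) fun p3 =>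
  forceFin (p 4) fun p4 => forceFin (p 5) fun p5 => forceBool (c 0) fun c0 => forceBool (c 1) fun c1 =>
  forceBool (c 2) fun c2 => forceBool (c 3) fun c3 => forceBool (c 4) fun c4 => forceBool (c 5) fun c5 =>
  f ![p0, p1, p2, p3, p4, p5] ![c0, c1, c2, c3, c4, c5]

theorem forceMove_eq (p : Fin 6 → Fin 6) (c : Fin 6 → Bool)
   (f : (Fin 6 → Fin 6) → (Fin 6 → Bool) → Bool) : forceMove p c f = f p c := by
  simp only [forceMove, forceFin_eq, forceBool_eq]
  congr 1 <;> funext i <;> fin_cases i <;> rfl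

/-! ### The two classes of the type with pattern of pentagons -/

/-- The entries of the matrix of a line as a vector. -/
def rowZ (X : ZFr) (i : Fin 6) : Fin 4 → ℤ :=
  ![lmatZ X i 0 0, lmatZ X i 0 1, lmatZ X i 1 0, lmatZ X i 1 1]

/-- The determinant of the matrices of the last four lines. -/
def quadZ (X : ZFr) : ℤ := brZ (rowZ X 2, rowZ X 3) (rowZ X 4, rowZ X 5)

theorem quad_toFr (X : ZFr) : quad X.toFr = quadZ X := by
  have h : quad X.toFr = br (fun k => (rowZ X 2 k : ℝ), fun k => (rowZ X 3 k : ℝ))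
      (fun k => (rowZ X 4 k : ℝ), fun k => (rowZ X 5 k : ℝ)) := by
    rw [quad, br, det2]
    simp only [lmat_toFr]
    congr 1
    ext i j
    fin_cases i <;> fin_cases j <;> rfl
  rw [h, br_eq, quadZ, brZ]
  push_cast
  rfl

/-- Integral normal forms. -/
def nfZ (l k : ℤ) (a : Fin 2 → ℤ) (A : Matrix (Fin 2) (Fin 2) ℤ) (b : Fin 2 → ℤ)
    (B : Matrix (Fin 2) (Fin 2) ℤ) : ZFr :=
  ![(![1, 0, 0, 0], ![0, 1, 0, 0]), (![0, 0, 1, 0], ![0, 0, 0, 1]),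
    (![1, 0, 1, 0], ![0, 1, 0, 1]), (![l, 0, 1, 0], ![0, 1, 0, k]),
    (![A 0 0, a 0, A 0 1, 0], ![A 1 0, 0, A 1 1, a 1]),
    (![B 0 0, b 0, B 0 1, 0], ![B 1 0, 0, B 1 1, b 1])]

theorem act_lineQ {Q : Matrix (Fin 2) (Fin 2) ℝ} {a : Fin 2 → ℤ} {A : Matrix (Fin 2) (Fin 2) ℤ}
    (h : ∀ i j, (a i : ℝ) * Q i j = A i j) :
    act !![(a 0 : ℝ), 0; 0, (a 1 : ℝ)] (lineQ Q) =
      (fun k => ((![A 0 0, a 0, A 0 1, 0] : Fin 4 → ℤ) k : ℝ),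
        fun k => ((![A 1 0, 0, A 1 1, a 1] : Fin 4 → ℤ) k : ℝ)) := by
  have h00 := h 0 0
  have h01 := h 0 1
  have h10 := h 1 0
  have h11 := h 1 1
  ext k <;> fin_cases k <;> simp [act, lineQ, h00, h01, h10, h11]

theorem nf_equiv_toFr {p : Par} (hp : nf p ∈ SkewFr) {l k : ℤ} {a b : Fin 2 → ℤ}
    {A B : Matrix (Fin 2) (Fin 2) ℤ} (ha : ∀ i, a i ≠ 0) (hb : ∀ i, b i ≠ 0) (hl : p.1 = l)
    (hk : p.2.1 = k) (hA : ∀ i j, (a i : ℝ) * p.2.2.1 i j = A i j)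
    (hB : ∀ i j, (b i : ℝ) * p.2.2.2 i j = B i j) : FrEquiv (nf p) (nfZ l k a A b B).toFr := by
  have h := FrEquiv.of_act hp
    (g := ![1, 1, 1, 1, !![(a 0 : ℝ), 0; 0, (a 1 : ℝ)], !![(b 0 : ℝ), 0; 0, (b 1 : ℝ)]])
    (by intro i; fin_cases i <;> simp [ha, hb])
  have e : (fun i => act ((![1, 1, 1, 1, !![(a 0 : ℝ), 0; 0, (a 1 : ℝ)],
      !![(b 0 : ℝ), 0; 0, (b 1 : ℝ)]] : Fin 6 → Matrix (Fin 2) (Fin 2) ℝ) i) (nf p i)) =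
      (nfZ l k a A b B).toFr := by
    funext i
    obtain ⟨l', k', Q, R⟩ := p
    obtain rfl : l' = l := hl
    obtain rfl : k' = k := hk
    fin_cases i
    · refine (act_one _).trans ?_
      ext j <;> fin_cases j <;> simp [nf, nfZ, ZFr.toFr]
    · refine (act_one _).trans ?_
      ext j <;> fin_cases j <;> simp [nf, nfZ, ZFr.toFr]
    · refine (act_one _).trans ?_
      ext j <;> fin_cases j <;> simp [nf, nfZ, ZFr.toFr]
    · refine (act_one _).trans ?_
      ext j <;> fin_cases j <;> simp [nf, nfZ, ZFr.toFr]
    · exact act_lineQ hA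
    · exact act_lineQ hB
  rwa [e] at h

/-- The mirror image of a system of integral frames. -/
def ZFr.refl (X : ZFr) : ZFr :=
  fun i => (fun k => if k = 0 then -(X i).1 k else (X i).1 k,
    fun k => if k = 0 then -(X i).2 k else (X i).2 k)

theorem mirror_toFr (X : ZFr) : mirror X.toFr = X.refl.toFr := by
  funext i
  ext j <;> fin_cases j <;>
    simp [mirror, mapP, mirA, ZFr.toFr, ZFr.refl, dotProduct, Fin.sum_univ_four]

/-- The lines of the first class. -/
def framesM : ZFr := nfZ 2 2 ![6, 6] !![-2, 3; 3, -1] ![2, 1] !![0, 3; 6, 3]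

theorem search_framesM : Search (fun i j => false ^^ bits 6615632896 i j)
    (fun i j => true ^^ bits 6615632896 i j) fun p c => forceMove p c fun p c =>
      decide (quadZ (framesM.refl.move p c) < 0) := by
  decide +kernel

theorem quadZ_framesM : 0 < quadZ framesM := by decide +kernel

theorem nf_parM_equiv : FrEquiv (nf parM) framesM.toFr := by
  refine nf_equiv_toFr exists_equiv_mirror_parM.1.mem (by decide) (by decide) ?_ ?_ ?_ ?_
  · norm_num [parM]
  · norm_num [parM]
  · intro i j
    fin_cases i <;> fin_cases j <;> norm_num [parM]
  · intro i j
    fin_cases i <;> fin_cases j <;> norm_num [parM, Matrix.det_fin_two]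

theorem patZ_toFr {T : Fin 6 → Fin 6 → ℤ} {X : ZFr}
    (h : ∀ i j, i ≠ j → 0 < T i j * brZ (X i) (X j)) : PatZ T X.toFr := by
  intro i j hij
  rw [br_toFr]
  have := h i j hij
  dsimp only
  exact_mod_cast this

theorem cast_pat (e f : Fin 4 → ℤ) (s : ℤ) (i j : Fin 6) : ((pat e f s i j : ℤ) : ℝ) =
    pat (fun i => (e i : ℝ)) (fun i => (f i : ℝ)) s i j := by
  fin_cases i <;> fin_cases j <;> simp [pat]

theorem cast_vec (a b c d : ℤ) :
    (fun i => ((![a, b, c, d] : Fin 4 → ℤ) i : ℝ)) = ![(a : ℝ), b, c, d] := by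
  funext i; fin_cases i <;> rfl

theorem PatZ.pat {x : Fr} {T : Fin 6 → Fin 6 → ℤ} (h : PatZ T x) (a b c d a' b' c' d' s : ℤ)
    (hT : ∀ i j, T i j - _root_.pat ![a, b, c, d] ![a', b', c', d'] s i j = 0) :
    Pat (_root_.pat ![(a : ℝ), b, c, d] ![(a' : ℝ), b', c', d'] s) x := by
  intro i j hij
  have h1 := h i j hij
  have h2 := cast_pat ![a, b, c, d] ![a', b', c', d'] s i j
  rw [cast_vec, cast_vec] at h2
  rw [← h2, ← sub_eq_zero.1 (hT i j)]
  exact h1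

theorem PatZ.of_pat {x : Fr} {T : Fin 6 → Fin 6 → ℤ} {a b c d a' b' c' d' s : ℤ}
    (h : Pat (_root_.pat ![(a : ℝ), b, c, d] ![(a' : ℝ), b', c', d'] s) x)
    (hT : ∀ i j, T i j - _root_.pat ![a, b, c, d] ![a', b', c', d'] s i j = 0) : PatZ T x := by
  intro i j hij
  have h1 := h i j hij
  have h2 := cast_pat ![a, b, c, d] ![a', b', c', d'] s i j
  rw [cast_vec, cast_vec] at h2
  rw [← h2, ← sub_eq_zero.1 (hT i j)] at h1
  exact h1

theorem patZ_framesM : PatZ (matZ false 6615632896) framesM.toFr :=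
  patZ_toFr (by decide +kernel)

theorem patZ_refl_framesM : PatZ (matZ true 6615632896) framesM.refl.toFr :=
  patZ_toFr (by decide +kernel)

theorem Pat.joinedIn_setOf {S : Fin 6 → Fin 6 → ℝ} {x y : Fr} (h : Pat S x)
    (hj : JoinedIn SkewFr x y) : JoinedIn {z | Pat S z} x y := by
  obtain ⟨γ, hγ⟩ := hj
  refine ⟨γ, fun t => ?_⟩
  have : PathConnectedSpace unitInterval := isPathConnected_iff_pathConnectedSpace.1
    ((convex_Icc (0 : ℝ) 1).isPathConnected ⟨0, by simp⟩)
  have h1 := (isPathConnected_range γ.continuous).joinedIn (γ 0) ⟨0, rfl⟩ (γ t) ⟨t, rfl⟩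
  rw [γ.source] at h1
  exact h.joinedIn (h1.mono (Set.range_subset_iff.2 hγ))

theorem not_frEquiv_mirror_parM : ¬ FrEquiv (nf parM) (mirror (nf parM)) := by
  intro h
  have h1 := (nf_parM_equiv.symm.trans h).trans nf_parM_equiv.mirror
  rw [mirror_toFr] at h1
  obtain ⟨p, s, hP, hj⟩ := search_framesM.exists_joinedIn patZ_framesM patZ_refl_framesM h1
  rw [forceMove_eq, decide_eq_true_eq] at hP
  have hpat : Pat (pat ![1, -1, 1, -1] ![1, -1, -1, 1] 1) framesM.toFr := by
    have := patZ_framesM.pat 1 (-1) 1 (-1) 1 (-1) (-1) 1 1 (by decide +kernel)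
    simpa only [Int.cast_one, Int.cast_neg] using this
  have h2 : 0 < quad framesM.toFr := by
    rw [quad_toFr]
    exact_mod_cast quadZ_framesM
  have h3 : quad (framesM.refl.move p s).toFr < 0 := by
    rw [quad_toFr]
    exact_mod_cast hP
  exact h3.not_gt ((hpat.joinedIn_setOf hj).pos_of_pos continuous_quad.continuousOn
    (fun z hz => hz.quad_ne_zero) h2)

/-! ### The two classes of the type with a cycle of four pairs -/

/-- The part of a real matrix which commutes with the complex structure. -/
def linPart (M : Matrix (Fin 2) (Fin 2) ℝ) : ℂ := ⟨M 0 0 + M 1 1, M 1 0 - M 0 1⟩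

/-- The part of a real matrix which anticommutes with the complex structure. -/
def conjPart (M : Matrix (Fin 2) (Fin 2) ℝ) : ℂ := ⟨M 0 0 - M 1 1, M 0 1 + M 1 0⟩

theorem four_mul_det_eq_norm (M : Matrix (Fin 2) (Fin 2) ℝ) :
    4 * M.det = ‖linPart M‖ ^ 2 - ‖conjPart M‖ ^ 2 := by
  rw [four_mul_det, Complex.sq_norm, Complex.sq_norm, Complex.normSq_apply, Complex.normSq_apply,
    linPart, conjPart]
  ring

theorem linPart_smul (c : ℝ) (M : Matrix (Fin 2) (Fin 2) ℝ) : linPart (c • M) = c * linPart M := by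
  apply Complex.ext <;> simp [linPart] <;> ring

theorem linPart_sub (M N : Matrix (Fin 2) (Fin 2) ℝ) :
    linPart (M - N) = linPart M - linPart N := by
  apply Complex.ext <;> simp [linPart] <;> ring

theorem conjPart_sub (M N : Matrix (Fin 2) (Fin 2) ℝ) :
    conjPart (M - N) = conjPart M - conjPart N := by
  apply Complex.ext <;> simp [conjPart] <;> ring

theorem norm_conjPart_lt {M : Matrix (Fin 2) (Fin 2) ℝ} (h : 0 < M.det) :
    ‖conjPart M‖ < ‖linPart M‖ := by
  have := four_mul_det_eq_norm M
  exact lt_of_pow_lt_pow_left₀ 2 (norm_nonneg _) (by linarith)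

/-- Twice the principal square root of `u * conj v`, up to a positive factor. -/
noncomputable def turn (u v : ℂ) : ℂ := u * starRingEnd ℂ v + (‖u‖ * ‖v‖ : ℝ)

/-- Being not opposite. -/
def NotOpp (u v : ℂ) : Prop := 0 < ‖u‖ * ‖v‖ + (u * starRingEnd ℂ v).re

theorem notOpp_of_det {M N : Matrix (Fin 2) (Fin 2) ℝ} (hM : 0 < M.det) (hN : 0 < N.det)
    (h : (M - N).det < 0) : NotOpp (linPart M) (linPart N) := by
  have h1 := four_mul_det_eq_norm (M - N)
  rw [linPart_sub, conjPart_sub] at h1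
  have h2 := norm_conjPart_lt hM
  have h3 := norm_conjPart_lt hN
  have h4 := norm_sub_le (conjPart M) (conjPart N)
  have h5 : ‖linPart M - linPart N‖ ^ 2 = ‖linPart M‖ ^ 2 + ‖linPart N‖ ^ 2 -
      2 * (linPart M * starRingEnd ℂ (linPart N)).re := by
    rw [Complex.sq_norm, Complex.sq_norm, Complex.sq_norm, Complex.normSq_sub]
  have h6 : ‖conjPart M - conjPart N‖ ^ 2 ≤ (‖linPart M‖ + ‖linPart N‖) ^ 2 :=
    pow_le_pow_left₀ (norm_nonneg _) (by linarith) 2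
  have h7 : ‖linPart M - linPart N‖ ^ 2 < ‖conjPart M - conjPart N‖ ^ 2 := by linarith
  unfold NotOpp
  nlinarith

theorem NotOpp.of_smul {u v : ℂ} {a b : ℝ} (ha : 0 < a) (hb : 0 < b)
    (h : NotOpp (a * u) (b * v)) : NotOpp u v := by
  have e : ‖(a : ℂ) * u‖ * ‖(b : ℂ) * v‖ + ((a : ℂ) * u * starRingEnd ℂ ((b : ℂ) * v)).re =
      a * b * (‖u‖ * ‖v‖ + (u * starRingEnd ℂ v).re) := by
    rw [norm_mul, norm_mul, Complex.norm_of_nonneg ha.le, Complex.norm_of_nonneg hb.le]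
    simp
    ring
  unfold NotOpp at h ⊢
  rw [e] at h
  exact pos_of_mul_pos_right h (mul_pos ha hb).le

theorem turn_sq (u v : ℂ) :
    turn u v ^ 2 = (2 * (‖u‖ * ‖v‖ + (u * starRingEnd ℂ v).re) : ℝ) * (u * starRingEnd ℂ v) := by
  have h1 := Complex.add_conj (u * starRingEnd ℂ v)
  have h2 := Complex.mul_conj' u
  have h3 := Complex.mul_conj' v
  rw [map_mul, Complex.conj_conj] at h1
  unfold turn
  push_cast at h1 ⊢
  linear_combination (u * starRingEnd ℂ v) * h1 - (‖v‖ : ℂ) ^ 2 * h2 - u * starRingEnd ℂ u * h3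

/-- The sign of the real part of this product is the parity of the winding number of a closed
quadrilateral. -/
noncomputable def quadTurn (a b c d : ℂ) : ℂ := turn a b * turn b c * turn c d * turn d a

theorem NotOpp.ne_zero {u v : ℂ} (h : NotOpp u v) : u ≠ 0 := by
  rintro rfl
  simp [NotOpp] at h

theorem quadTurn_re_ne_zero {a b c d : ℂ} (h1 : NotOpp a b) (h2 : NotOpp b c) (h3 : NotOpp c d)
    (h4 : NotOpp d a) : (quadTurn a b c d).re ≠ 0 := by
  have h : quadTurn a b c d ^ 2 = (2 * (‖a‖ * ‖b‖ + (a * starRingEnd ℂ b).re) *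
      (2 * (‖b‖ * ‖c‖ + (b * starRingEnd ℂ c).re)) * (2 * (‖c‖ * ‖d‖ + (c * starRingEnd ℂ d).re)) *
      (2 * (‖d‖ * ‖a‖ + (d * starRingEnd ℂ a).re)) * (‖a‖ ^ 2 * ‖b‖ ^ 2 * ‖c‖ ^ 2 * ‖d‖ ^ 2) : ℝ) := by
    have e : quadTurn a b c d ^ 2 = turn a b ^ 2 * turn b c ^ 2 * turn c d ^ 2 * turn d a ^ 2 := by
      unfold quadTurn; ring
    have ea := Complex.mul_conj' a
    have eb := Complex.mul_conj' b
    have ec := Complex.mul_conj' c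
    have ed := Complex.mul_conj' d
    rw [e, turn_sq, turn_sq, turn_sq, turn_sq]
    push_cast
    rw [← ea, ← eb, ← ec, ← ed]
    ring
  have hpos : 0 < 2 * (‖a‖ * ‖b‖ + (a * starRingEnd ℂ b).re) *
      (2 * (‖b‖ * ‖c‖ + (b * starRingEnd ℂ c).re)) * (2 * (‖c‖ * ‖d‖ + (c * starRingEnd ℂ d).re)) *
      (2 * (‖d‖ * ‖a‖ + (d * starRingEnd ℂ a).re)) *
      (‖a‖ ^ 2 * ‖b‖ ^ 2 * ‖c‖ ^ 2 * ‖d‖ ^ 2) := by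
    have ha := norm_pos_iff.2 h1.ne_zero
    have hb := norm_pos_iff.2 h2.ne_zero
    have hc := norm_pos_iff.2 h3.ne_zero
    have hd := norm_pos_iff.2 h4.ne_zero
    unfold NotOpp at h1 h2 h3 h4
    positivity
  intro h0
  have hre := congrArg Complex.re h
  rw [Complex.ofReal_re, sq, Complex.mul_re, h0] at hre
  nlinarith [mul_self_nonneg (quadTurn a b c d).im]

theorem turn_eq_of_re_pos {u v : ℂ} (hu : 0 < u.re) (hv : 0 < v.re) :
    ∃ c : ℝ, 0 < c ∧ turn u v = c * ((u + ‖u‖) * starRingEnd ℂ (v + ‖v‖)) := by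
  have key : ∀ z : ℂ, 0 < z.re → ∃ s y : ℝ, 0 < s ∧ |y| < s ∧ z = ((s : ℂ) + y * Complex.I) ^ 2 / (2 * s) ∧
      ‖z‖ = (s ^ 2 + y ^ 2) / (2 * s) := by
    intro z hz
    have hz0 : 0 ≤ ‖z‖ := norm_nonneg z
    have hn : ‖z‖ ^ 2 = z.re ^ 2 + z.im ^ 2 := by
      rw [Complex.sq_norm, Complex.normSq_apply]; ring
    have hs : 0 < ‖z‖ + z.re := by linarith
    have hi := Complex.abs_im_le_norm z
    refine ⟨‖z‖ + z.re, z.im, hs, by linarith, ?_, ?_⟩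
    · have hs' : (‖z‖ : ℂ) + z.re ≠ 0 := by exact_mod_cast hs.ne'
      push_cast
      rw [eq_div_iff (mul_ne_zero two_ne_zero hs')]
      have hz' := Complex.re_add_im z
      have hn' : (‖z‖ : ℂ) ^ 2 = (z.re : ℂ) ^ 2 + (z.im : ℂ) ^ 2 := by exact_mod_cast hn
      linear_combination (-2 : ℂ) * (‖z‖ + z.re) * hz' - hn' - (z.im : ℂ) ^ 2 * Complex.I_sq
    · rw [eq_div_iff (by positivity)]
      linear_combination hn
  obtain ⟨s, y, hs, hy, eu, nu⟩ := key u hu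
  obtain ⟨t, z, ht, hz, ev, nv⟩ := key v hv
  refine ⟨(1 + y * z / (s * t)) / 2, ?_, ?_⟩
  · have h1 : |y * z| < s * t := by
      rw [abs_mul]
      exact mul_lt_mul'' hy hz (abs_nonneg _) (abs_nonneg _)
    have h2 : 0 < s * t := mul_pos hs ht
    have h3 := (abs_lt.1 h1).1
    have : -1 < y * z / (s * t) := by
      rw [lt_div_iff₀ h2]; linarith
    linarith
  · have hs' : (s : ℂ) ≠ 0 := by exact_mod_cast hs.ne'
    have ht' : (t : ℂ) ≠ 0 := by exact_mod_cast ht.ne'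
    rw [turn, nu, nv, eu, ev]
    simp only [map_div₀, map_pow, map_add, map_mul, Complex.conj_ofReal, Complex.conj_I, map_ofNat]
    push_cast
    field_simp
    linear_combination ((s : ℂ) * t * y ^ 2 * z ^ 2 * (Complex.I ^ 2 + 1)
      - y ^ 3 * z ^ 3 * (Complex.I ^ 2 + 1) - 2 * s * t ^ 2 * y ^ 2 * z * Complex.I
      - 2 * s * y ^ 2 * z ^ 3 * Complex.I + 2 * s ^ 2 * t * y * z ^ 2 * Complex.I
      - 4 * s ^ 2 * t ^ 2 * y * z - 2 * s ^ 2 * y * z ^ 3 + 2 * t * y ^ 3 * z ^ 2 * Complex.I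
      - 2 * t ^ 2 * y ^ 3 * z) * Complex.I_sq

theorem quadTurn_re_pos {a b c d s : ℂ} (ha : 0 < (a * starRingEnd ℂ s).re)
    (hb : 0 < (b * starRingEnd ℂ s).re) (hc : 0 < (c * starRingEnd ℂ s).re)
    (hd : 0 < (d * starRingEnd ℂ s).re) : 0 < (quadTurn a b c d).re := by
  have key : ∀ u v : ℂ, 0 < (u * starRingEnd ℂ s).re → 0 < (v * starRingEnd ℂ s).re →
      ∃ c : ℝ, 0 < c ∧ turn u v = c * ((u * starRingEnd ℂ s + ‖u * starRingEnd ℂ s‖) *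
        starRingEnd ℂ (v * starRingEnd ℂ s + ‖v * starRingEnd ℂ s‖)) := by
    intro u v hu hv
    obtain ⟨c, hc, h⟩ := turn_eq_of_re_pos hu hv
    have hs : s ≠ 0 := by
      rintro rfl
      simp at hu
    have hs' : 0 < ‖s‖ ^ 2 := by positivity
    refine ⟨(‖s‖ ^ 2)⁻¹ * c, by positivity, ?_⟩
    have e : turn (u * starRingEnd ℂ s) (v * starRingEnd ℂ s) = (‖s‖ ^ 2 : ℝ) * turn u v := by
      have h1 := Complex.mul_conj' s
      simp only [turn, norm_mul, map_mul, Complex.conj_conj, RCLike.norm_conj]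
      push_cast
      linear_combination u * starRingEnd ℂ v * h1
    rw [e] at h
    have hs'' : ((‖s‖ ^ 2 : ℝ) : ℂ) ≠ 0 := by exact_mod_cast hs'.ne'
    rw [Complex.ofReal_mul, mul_assoc, ← h, Complex.ofReal_inv, inv_mul_cancel_left₀ hs'']
  obtain ⟨k1, h1, e1⟩ := key a b ha hb
  obtain ⟨k2, h2, e2⟩ := key b c hb hc
  obtain ⟨k3, h3, e3⟩ := key c d hc hd
  obtain ⟨k4, h4, e4⟩ := key d a hd ha
  have hne : ∀ u : ℂ, 0 < u.re → 0 < ‖u + (‖u‖ : ℂ)‖ := by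
    intro u hu
    refine norm_pos_iff.2 fun h => ?_
    have := congrArg Complex.re h
    simp at this
    linarith [norm_nonneg u]
  have pa := hne _ ha
  have pb := hne _ hb
  have pc := hne _ hc
  have pd := hne _ hd
  set A := a * starRingEnd ℂ s + (‖a * starRingEnd ℂ s‖ : ℂ)
  set B := b * starRingEnd ℂ s + (‖b * starRingEnd ℂ s‖ : ℂ)
  set C := c * starRingEnd ℂ s + (‖c * starRingEnd ℂ s‖ : ℂ)
  set D := d * starRingEnd ℂ s + (‖d * starRingEnd ℂ s‖ : ℂ)
  have e : quadTurn a b c d =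
      (k1 * k2 * k3 * k4 * (‖A‖ ^ 2 * ‖B‖ ^ 2 * ‖C‖ ^ 2 * ‖D‖ ^ 2) : ℝ) := by
    have ea := Complex.mul_conj' A
    have eb := Complex.mul_conj' B
    have ec := Complex.mul_conj' C
    have ed := Complex.mul_conj' D
    rw [quadTurn, e1, e2, e3, e4]
    push_cast
    rw [← ea, ← eb, ← ec, ← ed]
    ring
  rw [e, Complex.ofReal_re]
  positivity

/-- The parity of the winding number of the closed quadrilateral given by the last four lines. -/
noncomputable def wind (x : Fr) : ℝ :=
  (quadTurn (linPart (lmat (x 0) (x 1) (x 2))) (linPart (lmat (x 0) (x 1) (x 3)))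
    (linPart (lmat (x 0) (x 1) (x 4))) (linPart (lmat (x 0) (x 1) (x 5)))).re

theorem continuous_linPart (i : Fin 6) : Continuous fun x : Fr => linPart (lmat (x 0) (x 1) (x i)) := by
  have e : (fun x : Fr => linPart (lmat (x 0) (x 1) (x i))) = fun x : Fr =>
      ((lmat (x 0) (x 1) (x i) 0 0 + lmat (x 0) (x 1) (x i) 1 1 : ℝ) : ℂ) +
        ((lmat (x 0) (x 1) (x i) 1 0 - lmat (x 0) (x 1) (x i) 0 1 : ℝ) : ℂ) * Complex.I := by
    funext x
    apply Complex.ext <;> simp [linPart]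
  rw [e]
  exact (Complex.continuous_ofReal.comp ((continuous_lmat i 0 0).add (continuous_lmat i 1 1))).add
    ((Complex.continuous_ofReal.comp ((continuous_lmat i 1 0).sub (continuous_lmat i 0 1))).mul
      continuous_const)

theorem continuous_turn : Continuous fun p : ℂ × ℂ => turn p.1 p.2 := by
  unfold turn
  exact (continuous_fst.mul (Complex.continuous_conj.comp continuous_snd)).add
    (Complex.continuous_ofReal.comp (continuous_fst.norm.mul continuous_snd.norm))

theorem continuous_wind : Continuous wind := by
  have h : ∀ i j : Fin 6, Continuous fun x : Fr =>
      turn (linPart (lmat (x 0) (x 1) (x i))) (linPart (lmat (x 0) (x 1) (x j))) := fun i j =>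
    continuous_turn.comp ((continuous_linPart i).prodMk (continuous_linPart j))
  exact Complex.continuous_re.comp ((((h 2 3).mul (h 3 4)).mul (h 4 5)).mul (h 5 2))

theorem Pat.wind_ne_zero {x : Fr} (h : Pat (pat ![1, 1, 1, -1] ![1, 1, -1, 1] (-1)) x) :
    wind x ≠ 0 := by
  have h01 : 0 < (1 : ℝ) * br (x 0) (x 1) := h 0 1 (by decide)
  have h0 : ∀ i : Fin 4, 0 < br (x (i.natAdd 2)) (x 0) := by
    intro i
    have : ∀ i : Fin 4, 0 < (1 : ℝ) * br (x (i.natAdd 2)) (x 0) := by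
      intro i
      fin_cases i
      · exact h 2 0 (by decide)
      · exact h 3 0 (by decide)
      · exact h 4 0 (by decide)
      · exact h 5 0 (by decide)
    simpa only [one_mul] using this i
  have h1 : ∀ i : Fin 4, 0 < br (x (i.natAdd 2)) (x 1) := by
    intro i
    have : ∀ i : Fin 4, 0 < (1 : ℝ) * br (x (i.natAdd 2)) (x 1) := by
      intro i
      fin_cases i
      · exact h 2 1 (by decide)
      · exact h 3 1 (by decide)
      · exact h 4 1 (by decide)
      · exact h 5 1 (by decide)
    simpa only [one_mul] using this i
  have key : ∀ i j : Fin 4, 0 < (-1 : ℝ) * br (x (i.natAdd 2)) (x (j.natAdd 2)) →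
      NotOpp (linPart (lmat (x 0) (x 1) (x (i.natAdd 2))))
        (linPart (lmat (x 0) (x 1) (x (j.natAdd 2)))) := by
    intro i j hij
    have hi := inv_pos.2 (h0 i)
    have hj := inv_pos.2 (h0 j)
    have hd := det_sub_eq (b := x 1) (h0 i).ne' (h0 j).ne'
    have di : 0 < ((br (x (i.natAdd 2)) (x 0))⁻¹ • lmat (x 0) (x 1) (x (i.natAdd 2))).det := by
      rw [Matrix.det_smul, det_lmat]
      have := h0 i
      have := h1 i
      positivity
    have dj : 0 < ((br (x (j.natAdd 2)) (x 0))⁻¹ • lmat (x 0) (x 1) (x (j.natAdd 2))).det := by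
      rw [Matrix.det_smul, det_lmat]
      have := h0 j
      have := h1 j
      positivity
    have h2 := notOpp_of_det di dj (by
      rw [hd]
      refine mul_neg_of_pos_of_neg (mul_pos hi hj) (mul_neg_of_neg_of_pos ?_ ?_) <;> linarith)
    rw [linPart_smul, linPart_smul] at h2
    exact h2.of_smul hi hj
  exact quadTurn_re_ne_zero (key 0 1 (h 2 3 (by decide))) (key 1 2 (h 3 4 (by decide)))
    (key 2 3 (h 4 5 (by decide))) (key 3 0 (h 5 2 (by decide)))

/-- The part of the matrix of a line which commutes with the complex structure. -/
def linPartZ (X : ZFr) (i : Fin 6) : ℤ × ℤ :=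
  (lmatZ X i 0 0 + lmatZ X i 1 1, lmatZ X i 1 0 - lmatZ X i 0 1)

theorem linPart_toFr (X : ZFr) (i : Fin 6) :
    linPart (lmat (X.toFr 0) (X.toFr 1) (X.toFr i)) =
      ⟨((linPartZ X i).1 : ℝ), ((linPartZ X i).2 : ℝ)⟩ := by
  rw [lmat_toFr]
  apply Complex.ext <;> simp [linPart, linPartZ]

/-- The scalar product of integral vectors. -/
def dotZ (u v : ℤ × ℤ) : ℤ := u.1 * v.1 + u.2 * v.2

theorem wind_toFr_pos {X : ZFr} {s : ℤ × ℤ} (h : 0 < dotZ (linPartZ X 2) s ∧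
    0 < dotZ (linPartZ X 3) s ∧ 0 < dotZ (linPartZ X 4) s ∧ 0 < dotZ (linPartZ X 5) s) :
    0 < wind X.toFr := by
  have key : ∀ i : Fin 6, 0 < dotZ (linPartZ X i) s →
      0 < (linPart (lmat (X.toFr 0) (X.toFr 1) (X.toFr i)) *
        starRingEnd ℂ (⟨(s.1 : ℝ), (s.2 : ℝ)⟩ : ℂ)).re := by
    intro i hi
    rw [linPart_toFr, Complex.mul_re, Complex.conj_re, Complex.conj_im, mul_neg, sub_neg_eq_add]
    have h1 : (0 : ℝ) < dotZ (linPartZ X i) s := Int.cast_pos.2 hi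
    rwa [dotZ, Int.cast_add, Int.cast_mul, Int.cast_mul] at h1
  exact quadTurn_re_pos (key 2 h.1) (key 3 h.2.1) (key 4 h.2.2.1) (key 5 h.2.2.2)

/-- The lines of the first class. -/
def framesJ : ZFr := nfZ 2 2 ![1, 1] !![-1, 1; -4, -4] ![7, 7] !![5, 1; -2, 1]

/-- The lines of the second class. -/
def framesL : ZFr :=
  ![(![1, 0, 0, 0], ![0, 1, 0, 0]), (![0, 0, 1, 0], ![0, 0, 0, 1]),
    (![0, -19, 1, 0], ![1, 0, 0, 1]), (![10, 9, 1, 0], ![9, 10, 0, 1]),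
    (![0, 1, 1, 0], ![-19, 0, 0, 1]), (![-10, 9, 1, 0], ![9, -10, 0, 1])]

theorem search_framesJ : Search (fun i j => false ^^ bits 22151331840 i j)
    (fun i j => false ^^ bits 22151331840 i j) fun p c => forceMove p c fun p c =>
      let X := framesJ.move p c
      let s := linPartZ X 2 + linPartZ X 3 + linPartZ X 4 + linPartZ X 5
      decide (0 < dotZ (linPartZ X 2) s ∧ 0 < dotZ (linPartZ X 3) s ∧
        0 < dotZ (linPartZ X 4) s ∧ 0 < dotZ (linPartZ X 5) s) := by
  decide +kernel

theorem nf_parJ_equiv : FrEquiv (nf parJ) framesJ.toFr := by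
  refine nf_equiv_toFr exists_equiv_pppn_ppnp.1.mem (by decide) (by decide) ?_ ?_ ?_ ?_
  · norm_num [parJ]
  · norm_num [parJ]
  · intro i j
    fin_cases i <;> fin_cases j <;> norm_num [parJ]
  · intro i j
    fin_cases i <;> fin_cases j <;> norm_num [parJ, Matrix.det_fin_two]

theorem patZ_framesJ : PatZ (matZ false 22151331840) framesJ.toFr :=
  patZ_toFr (by decide +kernel)

theorem patZ_framesL : PatZ (matZ false 22151331840) framesL.toFr :=
  patZ_toFr (by decide +kernel)

theorem wind_framesL : wind framesL.toFr < 0 := by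
  have h2 : linPartZ framesL 2 = (20, 0) := by decide +kernel
  have h3 : linPartZ framesL 3 = (0, 20) := by decide +kernel
  have h4 : linPartZ framesL 4 = (-20, 0) := by decide +kernel
  have h5 : linPartZ framesL 5 = (0, -20) := by decide +kernel
  rw [wind, linPart_toFr, linPart_toFr, linPart_toFr, linPart_toFr, h2, h3, h4, h5]
  have e2 : (⟨((20 : ℤ) : ℝ), ((0 : ℤ) : ℝ)⟩ : ℂ) = 20 := by
    apply Complex.ext <;> simp
  have e3 : (⟨((0 : ℤ) : ℝ), ((20 : ℤ) : ℝ)⟩ : ℂ) = 20 * Complex.I := by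
    apply Complex.ext <;> simp
  have e4 : (⟨((-20 : ℤ) : ℝ), ((0 : ℤ) : ℝ)⟩ : ℂ) = -20 := by
    apply Complex.ext <;> simp
  have e5 : (⟨((0 : ℤ) : ℝ), ((-20 : ℤ) : ℝ)⟩ : ℂ) = -(20 * Complex.I) := by
    apply Complex.ext <;> simp
  have hn : ‖(20 : ℂ)‖ = 20 := Complex.norm_ofNat 20
  dsimp only
  rw [e2, e3, e4, e5]
  have t : quadTurn 20 (20 * Complex.I) (-20) (-(20 * Complex.I)) = -102400000000 := by
    simp only [quadTurn, turn, norm_neg, norm_mul, Complex.norm_I, hn, map_mul, map_neg,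
      Complex.conj_I, map_ofNat]
    push_cast
    ring_nf
    simp only [Complex.I_sq, Complex.I_pow_four, Complex.I_pow_three]
    ring
  rw [t]
  norm_num

theorem not_frEquiv_framesL_parJ : ¬ FrEquiv framesL.toFr (nf parJ) := by
  intro h
  obtain ⟨p, s, hP, hj⟩ :=
    search_framesJ.exists_joinedIn patZ_framesL patZ_framesJ (h.trans nf_parJ_equiv)
  rw [forceMove_eq, decide_eq_true_eq] at hP
  have hpat : Pat (pat ![1, 1, 1, -1] ![1, 1, -1, 1] (-1)) framesL.toFr := by
    have := patZ_framesL.pat 1 1 1 (-1) 1 1 (-1) 1 (-1) (by decide +kernel)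
    simpa only [Int.cast_one, Int.cast_neg] using this
  have h3 := (hpat.joinedIn_setOf hj).pos_of_pos (f := fun x => -wind x)
    continuous_wind.neg.continuousOn (fun z hz => neg_ne_zero.2 hz.wind_ne_zero)
    (neg_pos.2 wind_framesL)
  exact (neg_pos.1 h3).not_gt (wind_toFr_pos hP)

theorem Pat.equiv_parJ_or {x : Fr} (h : Pat (pat ![1, 1, 1, -1] ![1, 1, -1, 1] (-1)) x) :
    FrEquiv x (nf parJ) ∨ FrEquiv x framesL.toFr := by
  have hpat : Pat (pat ![1, 1, 1, -1] ![1, 1, -1, 1] (-1)) framesL.toFr := by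
    have := patZ_framesL.pat 1 1 1 (-1) 1 1 (-1) 1 (-1) (by decide +kernel)
    simpa only [Int.cast_one, Int.cast_neg] using this
  refine (exists_equiv_pppn_ppnp.2 x h).imp_right fun ⟨p, hp, hx, h0⟩ => ?_
  obtain hL | ⟨q, hq, hL, h1⟩ := exists_equiv_pppn_ppnp.2 _ hpat
  · exact absurd hL not_frEquiv_framesL_parJ
  · exact (hx.trans (nf_equiv_bad sign_pppn (neg_sign sign_ppnp) (by simp) (by simp) (by simp)
      (by simp) (by simp) hp hq (mul_pos_of_neg_of_neg h0 h1))).trans hL.symm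

/-! ### Enumeration -/

/-- A sign pattern realized by exactly one equivalence class. -/
def Single (r : ℕ) : Prop :=
  ∃ y, PatZ (matZ false r) y ∧ ∀ x, PatZ (matZ false r) x → FrEquiv x y

theorem patZ_of_bits {r : ℕ} {x : Fr} (h : Pat (fun i j => sr (bits r i j)) x) :
    PatZ (matZ false r) x := by
  intro i j hij
  have h1 := h i j hij
  have h2 : ((matZ false r i j : ℤ) : ℝ) = sr (bits r i j) := by
    rw [matZ, if_neg hij, Bool.false_xor]
    cases bits r i j <;> simp [sr]
  dsimp only
  rwa [h2]

theorem single_of_pat {r : ℕ} (a b c d a' b' c' d' s : ℤ)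
    (hT : ∀ i j, matZ false r i j - pat ![a, b, c, d] ![a', b', c', d'] s i j = 0)
    (h : ∃ p, Pat (pat ![(a : ℝ), b, c, d] ![(a' : ℝ), b', c', d'] s) (nf p) ∧
      ∀ x, Pat (pat ![(a : ℝ), b, c, d] ![(a' : ℝ), b', c', d'] s) x → FrEquiv x (nf p)) :
    Single r := by
  obtain ⟨p, hp, hx⟩ := h
  exact ⟨nf p, PatZ.of_pat hp hT, fun x h => hx x (h.pat a b c d a' b' c' d' s hT)⟩

theorem exists_of_twin {e : Fin 4 → ℝ} {s : ℝ} {q : Par} (he : ∀ i, e i = 1 ∨ e i = -1)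
    (h : ConeMeets e s) (hq : q ∈ Reg e e (-s)) :
    ∃ p, Pat (pat e e s) (nf p) ∧ ∀ x, Pat (pat e e s) x → FrEquiv x (nf p) :=
  ⟨q, neg_neg s ▸ pat_nf hq, fun _ hx => hx.equiv_twin he h hq⟩

theorem single_zero : Single 0 := by
  have hT : ∀ i j : Fin 6, i ≠ j → ((matZ false 0 i j : ℤ) : ℝ) = 1 := by
    intro i j hij
    rw [matZ, if_neg hij]
    simp [sr, bits]
  refine ⟨stdFr, fun i j hij => ?_, fun x hx => Pat.equiv_std fun i j hij => ?_⟩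
  · have := pat_std i j hij
    dsimp only
    rwa [hT i j hij]
  · have := hx i j hij
    dsimp only at this
    rwa [hT i j hij] at this

/-- The sign patterns realized by one class, the chiral ones first. -/
def singles : Fin 8 → ℕ :=
  ![0, 1081344, 8737816576, 17717821440, 10918857728, 12894502912, 26454556672, 24332372992]

theorem single_singles (k : Fin 8) : Single (singles k) := by
  fin_cases k
  · exact single_zero
  · exact single_of_pat 1 1 1 1 1 1 1 1 1 (by decide +kernel)
      (by simpa only [Int.cast_one, Int.cast_neg] using exists_of_twin sign_pppp coneMeets_pppp_pos pppp_mem)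
  · exact single_of_pat 1 1 1 (-1) 1 1 1 (-1) 1 (by decide +kernel)
      (by simpa only [Int.cast_one, Int.cast_neg] using exists_of_twin sign_pppn coneMeets_pppn_pos pppn_mem)
  · exact single_of_pat 1 1 1 1 1 1 1 1 (-1) (by decide +kernel)
      (by simpa only [Int.cast_one, Int.cast_neg] using exists_of_twin sign_pppp coneMeets_pppp_neg pppp_mem')
  · exact single_of_pat 1 (-1) 1 (-1) 1 (-1) 1 (-1) 1 (by decide +kernel)
      (by simpa only [Int.cast_one, Int.cast_neg] using exists_of_twin sign_pnpn coneMeets_pnpn_pos pnpn_mem)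
  · exact single_of_pat 1 1 1 1 1 1 (-1) (-1) 1 (by decide +kernel)
      (by simpa only [Int.cast_one, Int.cast_neg] using exists_equiv_pppp_ppnn)
  · exact single_of_pat 1 1 1 (-1) 1 1 1 (-1) (-1) (by decide +kernel)
      (by simpa only [Int.cast_one, Int.cast_neg] using exists_of_twin sign_pppn coneMeets_pppn_neg pppn_mem')
  · exact single_of_pat 1 (-1) 1 (-1) 1 (-1) (-1) 1 (-1) (by decide +kernel)
      (by simpa only [Int.cast_one, Int.cast_neg] using exists_equiv_pnpn_pnnp)

theorem exists_reps : ∃ Y : Fin 8 → Fr, ∀ k, PatZ (matZ false (singles k)) (Y k) ∧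
    ∀ x, PatZ (matZ false (singles k)) x → FrEquiv x (Y k) :=
  ⟨fun k => (single_singles k).choose, fun k => (single_singles k).choose_spec⟩

/-- The mirror flags of the nineteen classes. -/
def flag : Fin 19 → Bool :=
  ![false, false, false, false, false, false, false, false, true, true, true, true, true,
    false, false, true, true, false, true]

/-- The sign patterns of the nineteen classes. -/
def code : Fin 19 → ℕ :=
  ![0, 1081344, 8737816576, 17717821440, 10918857728, 12894502912, 26454556672, 24332372992,
    0, 1081344, 8737816576, 17717821440, 10918857728, 22151331840, 22151331840, 22151331840,
    22151331840, 6615632896, 6615632896]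

/-- Two numerical invariants of the nineteen classes. -/
def classInvariant : Fin 19 → ℤ × ℤ :=
  ![(120, 2400), (72, 1056), (48, 576), (24, 288), (24, 160), (0, 384), (0, 192), (0, 64), (-120, 2400), (-72, 1056), (-48, 576), (-24, 288), (-24, 160), (24, 96), (24, 96), (-24, 96), (-24, 96), (0, 0), (0, 0)]

theorem sum_cubeDiag_code (k : Fin 19) : (∑ i, cubeDiag (matZ (flag k) (code k)) i,
    ∑ i, cubeDiag (matZ (flag k) (code k)) i ^ 2) = classInvariant k := by
  revert k
  decide +kernel

theorem eq_of_classInvariant (k l : Fin 19) (hkl : k < l) (h : classInvariant k = classInvariant l) :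
    (k = 13 ∧ l = 14) ∨ (k = 15 ∧ l = 16) ∨ (k = 17 ∧ l = 18) := by
  revert k l
  decide +kernel

/-- Representatives of the nineteen classes. -/
noncomputable def reps (Y : Fin 8 → Fr) : Fin 19 → Fr :=
  ![Y 0, Y 1, Y 2, Y 3, Y 4, Y 5, Y 6, Y 7, mirror (Y 0), mirror (Y 1), mirror (Y 2), mirror (Y 3),
    mirror (Y 4), nf parJ, framesL.toFr, mirror (nf parJ), mirror framesL.toFr, nf parM,
    mirror (nf parM)]

theorem patZ_parJ : PatZ (matZ false 22151331840) (nf parJ) :=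
  PatZ.of_pat (a := 1) (b := 1) (c := 1) (d := -1) (a' := 1) (b' := 1) (c' := -1) (d' := 1) (s := -1)
    (by simpa only [Int.cast_one, Int.cast_neg] using exists_equiv_pppn_ppnp.1) (by decide +kernel)

theorem patZ_parM : PatZ (matZ false 6615632896) (nf parM) :=
  PatZ.of_pat (a := 1) (b := -1) (c := 1) (d := -1) (a' := 1) (b' := -1) (c' := -1) (d' := 1) (s := 1)
    (by simpa only [Int.cast_one, Int.cast_neg] using exists_equiv_mirror_parM.1) (by decide +kernel)

theorem patZ_reps {Y : Fin 8 → Fr} (hY : ∀ k, PatZ (matZ false (singles k)) (Y k)) (k : Fin 19) :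
    PatZ (matZ (flag k) (code k)) (reps Y k) := by
  fin_cases k
  · exact hY 0
  · exact hY 1
  · exact hY 2
  · exact hY 3
  · exact hY 4
  · exact hY 5
  · exact hY 6
  · exact hY 7
  · exact (hY 0).mirror_matZ
  · exact (hY 1).mirror_matZ
  · exact (hY 2).mirror_matZ
  · exact (hY 3).mirror_matZ
  · exact (hY 4).mirror_matZ
  · exact patZ_parJ
  · exact patZ_framesL
  · exact patZ_parJ.mirror_matZ
  · exact patZ_framesL.mirror_matZ
  · exact patZ_parM
  · exact patZ_parM.mirror_matZ

theorem not_frEquiv_reps {Y : Fin 8 → Fr} (hY : ∀ k, PatZ (matZ false (singles k)) (Y k))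
    {k l : Fin 19} (hkl : k < l) : ¬ FrEquiv (reps Y k) (reps Y l) := by
  intro h
  have hs := FrEquiv.sum_cubeDiag (isSign_matZ _ _) (isSign_matZ _ _) (patZ_reps hY k)
    (patZ_reps hY l) h
  have e : classInvariant k = classInvariant l := by
    rw [← sum_cubeDiag_code, ← sum_cubeDiag_code]
    exact Prod.ext (hs id) (hs (· ^ 2))
  rcases eq_of_classInvariant k l hkl e with ⟨rfl, rfl⟩ | ⟨rfl, rfl⟩ | ⟨rfl, rfl⟩
  · exact not_frEquiv_framesL_parJ (FrEquiv.symm h)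
  · have h1 : FrEquiv (mirror (nf parJ)) (mirror framesL.toFr) := h
    have h2 := h1.mirror
    rw [mirror_mirror, mirror_mirror] at h2
    exact not_frEquiv_framesL_parJ h2.symm
  · exact not_frEquiv_mirror_parM h

theorem exists_reps_of_chiral {Y : Fin 8 → Fr}
    (hY : ∀ k x, PatZ (matZ false (singles k)) x → FrEquiv x (Y k)) {r : ℕ} (hr : r ∈ chiral)
    {y : Fr} (hy : PatZ (matZ false r) y) :
    ∃ k l, FrEquiv y (reps Y k) ∧ FrEquiv (mirror y) (reps Y l) := by
  have key : ∀ z, FrEquiv y z → ∀ k l, reps Y k = z → reps Y l = mirror z →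
      ∃ k l, FrEquiv y (reps Y k) ∧ FrEquiv (mirror y) (reps Y l) := by
    rintro z hz k l rfl hl
    exact ⟨k, l, hz, hl ▸ hz.mirror⟩
  simp only [chiral, List.mem_cons, List.not_mem_nil, or_false] at hr
  rcases hr with rfl | rfl | rfl | rfl | rfl | rfl | rfl
  · exact key _ (hY 0 y hy) 0 8 rfl rfl
  · exact key _ (hY 1 y hy) 1 9 rfl rfl
  · exact key _ (hY 2 y hy) 2 10 rfl rfl
  · exact key _ (hY 3 y hy) 3 11 rfl rfl
  · exact key _ (hY 4 y hy) 4 12 rfl rfl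
  · have h := hy.pat 1 1 1 (-1) 1 1 (-1) 1 (-1) (by decide +kernel)
    simp only [Int.cast_one, Int.cast_neg] at h
    rcases h.equiv_parJ_or with h | h
    · exact key _ h 13 15 rfl rfl
    · exact key _ h 14 16 rfl rfl
  · have h := hy.pat 1 (-1) 1 (-1) 1 (-1) (-1) 1 1 (by decide +kernel)
    simp only [Int.cast_one, Int.cast_neg] at h
    rcases exists_equiv_mirror_parM.2 y h with h | h
    · exact key _ h 17 18 rfl rfl
    · exact key _ h 18 17 rfl (mirror_mirror _).symm

theorem exists_reps_of_achiral {Y : Fin 8 → Fr}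
    (hY : ∀ k x, PatZ (matZ false (singles k)) x → FrEquiv x (Y k)) {r : ℕ} (hr : r ∈ achiral)
    {y : Fr} (hy : PatZ (matZ false r) y) : ∃ k, FrEquiv y (reps Y k) := by
  simp only [achiral, List.mem_cons, List.not_mem_nil, or_false] at hr
  rcases hr with rfl | rfl | rfl
  · exact ⟨5, hY 5 y hy⟩
  · exact ⟨6, hY 6 y hy⟩
  · exact ⟨7, hY 7 y hy⟩

theorem exists_frEquiv_reps {Y : Fin 8 → Fr}
    (hY : ∀ k x, PatZ (matZ false (singles k)) x → FrEquiv x (Y k)) {x : Fr} (hx : x ∈ SkewFr) :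
    ∃ k, FrEquiv x (reps Y k) := by
  rcases exists_pat_rep hx with ⟨r, hr, y, hxy, hy⟩ | ⟨r, hr, y, hxy, hy⟩
  · obtain ⟨k, l, hk, hl⟩ := exists_reps_of_chiral hY hr (patZ_of_bits hy)
    rcases hxy with h | h
    · exact ⟨k, h.trans hk⟩
    · have h1 := h.mirror
      rw [mirror_mirror] at h1
      exact ⟨l, h1.trans hl⟩
  · obtain ⟨k, hk⟩ := exists_reps_of_achiral hY hr (patZ_of_bits hy)
    exact ⟨k, hxy.trans hk⟩

theorem mazurovskii_nineteen_classes :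
    ∃ C : Fin 19 → (Fin 6 → PLine),
      (∀ k, PairwiseSkew (C k)) ∧
      (∀ k l, k ≠ l → ¬ DeformEquiv (C k) (C l)) ∧
      (∀ L : Fin 6 → PLine, PairwiseSkew L → ∃ k, DeformEquiv L (C k)) := by
  obtain ⟨Y, hY⟩ := exists_reps
  have hmem := fun k => (patZ_reps (fun k => (hY k).1) k).mem
  refine ⟨fun k => cfg (reps Y k), fun k => pairwiseSkew_cfg.2 (hmem k), fun k l hkl h => ?_,
    fun L hL => ?_⟩
  · rcases lt_or_gt_of_ne hkl with hlt | hlt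
    · exact not_frEquiv_reps (fun k => (hY k).1) hlt ⟨hmem k, hmem l, h⟩
    · exact not_frEquiv_reps (fun k => (hY k).1) hlt ⟨hmem l, hmem k, deformEquiv_symm h⟩
  · obtain ⟨x, hx, rfl⟩ := exists_cfg hL
    obtain ⟨k, hk⟩ := exists_frEquiv_reps (fun k => (hY k).2) hx
    exact ⟨k, hk.2.2⟩
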